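/- arXiv:1604.04051 — 9 statements merged into one kernel-verified Lean document; each statement's English description precedes it below -/
import Mathlib

section
/- Let h ∈ L¹([0,T],ℝ^n). Then for every ρ ∈ (0,1) there exists a Lebesgue-measurable set Q_ρ ⊂ [0,T] with λ(Q_ρ) = ρT such that sup over t ∈ [0,T] of ‖∫₀ᵗ (1 − (1/ρ) 𝟙_{Q_ρ}(s)) h(s) ds‖ is at most ρ. -/
open MeasureTheory

/-- The set of points lying in the first `ρ`-fraction of a cell `[kδ, (k+1)δ)`, `k ∈ ℤ`. -/
def spikeSet (ρ δ : ℝ) : Set ℝ := {s | Int.fract (s / δ) < ρ}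

/-- The weight `1 - ρ⁻¹ 𝟙` associated with the periodic set `spikeSet ρ δ`. -/
noncomputable def spikeWeight (ρ δ s : ℝ) : ℝ :=
  1 - ρ⁻¹ * Set.indicator (spikeSet ρ δ) (fun _ => (1 : ℝ)) s

lemma measurableSet_spikeSet (ρ δ : ℝ) : MeasurableSet (spikeSet ρ δ) :=
  measurableSet_lt (measurable_fract.comp (measurable_id.div_const δ)) measurable_const

lemma measurable_spikeWeight (ρ δ : ℝ) : Measurable (spikeWeight ρ δ) :=
  measurable_const.sub
    (measurable_const.mul (measurable_const.indicator (measurableSet_spikeSet ρ δ)))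

lemma abs_spikeWeight_le {ρ : ℝ} (hρ : ρ ∈ Set.Ioo (0 : ℝ) 1) (δ s : ℝ) :
    |spikeWeight ρ δ s| ≤ ρ⁻¹ := by
  have h1 : 1 ≤ ρ⁻¹ := (one_le_inv₀ hρ.1).2 hρ.2.le
  unfold spikeWeight
  by_cases hs : s ∈ spikeSet ρ δ
  · rw [Set.indicator_of_mem hs, abs_le]
    constructor <;> linarith
  · rw [Set.indicator_of_notMem hs]
    simpa using h1

section

variable {E : Type*} [NormedAddCommGroup E] [NormedSpace ℝ E]

lemma MeasureTheory.Integrable.spikeWeight_smul {ρ : ℝ} (hρ : ρ ∈ Set.Ioo (0 : ℝ) 1) (δ : ℝ)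
    {f : ℝ → E} {μ : Measure ℝ} (hf : Integrable f μ) :
    Integrable (fun s => spikeWeight ρ δ s • f s) μ :=
  hf.bdd_smul ρ⁻¹ (measurable_spikeWeight ρ δ).aestronglyMeasurable
    (.of_forall fun s => abs_spikeWeight_le hρ δ s)

lemma Continuous.intervalIntegrable_spikeWeight_smul {ρ : ℝ} (hρ : ρ ∈ Set.Ioo (0 : ℝ) 1) (δ : ℝ)
    {g : ℝ → E} (hg : Continuous g) (a b : ℝ) :
    IntervalIntegrable (fun s => spikeWeight ρ δ s • g s) volume a b :=
  have hi := hg.intervalIntegrable (μ := volume) a b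
  ⟨hi.1.spikeWeight_smul hρ δ, hi.2.spikeWeight_smul hρ δ⟩

lemma intervalIntegrable_spikeWeight {ρ : ℝ} (hρ : ρ ∈ Set.Ioo (0 : ℝ) 1) (δ a b : ℝ) :
    IntervalIntegrable (spikeWeight ρ δ) volume a b := by
  simpa using (continuous_const (y := (1 : ℝ))).intervalIntegrable_spikeWeight_smul hρ δ a b

end

lemma Ico_inter_spikeSet {ρ δ : ℝ} (hρ : ρ ∈ Set.Ioo (0 : ℝ) 1) (hδ : 0 < δ) (k : ℕ) :
    Set.Ico (k * δ) ((k + 1) * δ) ∩ spikeSet ρ δ = Set.Ico (k * δ) (k * δ + ρ * δ) := by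
  ext s
  have key : k * δ ≤ s → s < (k + 1) * δ → Int.fract (s / δ) = s / δ - k := by
    intro h1 h2
    rw [Int.fract_eq_iff]
    have h3 : (k : ℝ) ≤ s / δ := (le_div_iff₀ hδ).2 h1
    have h4 : s / δ < k + 1 := (div_lt_iff₀ hδ).2 h2
    exact ⟨by linarith, by linarith, k, by simp⟩
  have hiff : s / δ - k < ρ ↔ s < k * δ + ρ * δ := by
    rw [sub_lt_iff_lt_add, div_lt_iff₀ hδ]
    ring_nf
  simp only [Set.mem_inter_iff, Set.mem_Ico, spikeSet, Set.mem_ofPred_eq]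
  constructor
  · rintro ⟨⟨h1, h2⟩, h3⟩
    rw [key h1 h2, hiff] at h3
    exact ⟨h1, h3⟩
  · rintro ⟨h1, h2⟩
    have h3 : s < (k + 1) * δ := by nlinarith [hρ.2]
    exact ⟨⟨h1, h3⟩, by rwa [key h1 h3, hiff]⟩

lemma setIntegral_spikeWeight (ρ δ : ℝ) {A : Set ℝ} (hA : volume A ≠ ⊤) :
    ∫ s in A, spikeWeight ρ δ s =
      volume.real A - ρ⁻¹ * volume.real (A ∩ spikeSet ρ δ) := by
  have hc : Integrable (fun _ : ℝ => (1 : ℝ)) (volume.restrict A) := integrableOn_const hA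
  have hint := (hc.indicator (measurableSet_spikeSet ρ δ)).const_mul ρ⁻¹
  unfold spikeWeight
  rw [integral_sub hc hint, integral_const_mul,
    setIntegral_indicator (measurableSet_spikeSet ρ δ)]
  simp only [setIntegral_const, smul_eq_mul, mul_one]

lemma integral_spikeWeight_cell {ρ δ : ℝ} (hρ : ρ ∈ Set.Ioo (0 : ℝ) 1) (hδ : 0 < δ) (k : ℕ) :
    ∫ s in (k * δ)..((k + 1) * δ), spikeWeight ρ δ s = 0 := by
  have hle : k * δ ≤ (k + 1) * δ := by nlinarith
  have h0 : 0 ≤ ρ * δ := (mul_pos hρ.1 hδ).le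
  rw [intervalIntegral.integral_of_le hle, ← integral_Ico_eq_integral_Ioc]
  rw [setIntegral_spikeWeight ρ δ (by simp), Ico_inter_spikeSet hρ hδ,
    Real.volume_real_Ico_of_le hle,
    Real.volume_real_Ico_of_le (show k * δ ≤ k * δ + ρ * δ by linarith)]
  have := hρ.1.ne'
  field_simp
  ring

lemma integral_spikeWeight_cells {ρ δ : ℝ} (hρ : ρ ∈ Set.Ioo (0 : ℝ) 1) (hδ : 0 < δ) (k : ℕ) :
    ∫ s in (0 : ℝ)..(k * δ), spikeWeight ρ δ s = 0 := by
  induction k with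
  | zero => simp
  | succ k ih =>
    rw [← intervalIntegral.integral_add_adjacent_intervals
      (intervalIntegrable_spikeWeight hρ δ 0 (k * δ)) (intervalIntegrable_spikeWeight hρ δ _ _),
      ih, Nat.cast_succ, integral_spikeWeight_cell hρ hδ, add_zero]

lemma volume_spikeSet_inter_Icc {ρ δ : ℝ} (hρ : ρ ∈ Set.Ioo (0 : ℝ) 1) (hδ : 0 < δ) (k : ℕ) :
    volume (spikeSet ρ δ ∩ Set.Icc 0 (k * δ)) = ENNReal.ofReal (ρ * (k * δ)) := by
  have hk : 0 ≤ k * δ := by positivity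
  have hfin : volume (Set.Icc 0 (k * δ)) ≠ ⊤ := measure_Icc_lt_top.ne
  have h := integral_spikeWeight_cells hρ hδ k
  rw [intervalIntegral.integral_of_le hk, ← integral_Icc_eq_integral_Ioc,
    setIntegral_spikeWeight ρ δ hfin, Real.volume_real_Icc_of_le hk, Set.inter_comm] at h
  rw [← ENNReal.ofReal_toReal (measure_ne_top_of_subset Set.inter_subset_right hfin),
    ← Measure.real]
  congr 1
  have := hρ.1.ne'
  field_simp at h
  linarith

section

variable {E : Type*} [NormedAddCommGroup E] [NormedSpace ℝ E] [CompleteSpace E]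

lemma norm_integral_spikeWeight_smul_cell_le {ρ δ ω : ℝ} (hρ : ρ ∈ Set.Ioo (0 : ℝ) 1)
    (hδ : 0 < δ) {g : ℝ → E} (hg : Continuous g)
    (hω : ∀ x y, |x - y| ≤ δ → ‖g x - g y‖ ≤ ω) (k : ℕ) :
    ‖∫ s in (k * δ)..((k + 1) * δ), spikeWeight ρ δ s • g s‖ ≤ ρ⁻¹ * ω * δ := by
  have hle : k * δ ≤ (k + 1) * δ := by nlinarith
  have heq : ∫ s in (k * δ)..((k + 1) * δ), spikeWeight ρ δ s • g s =
      ∫ s in (k * δ)..((k + 1) * δ), spikeWeight ρ δ s • (g s - g (k * δ)) := by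
    simp only [smul_sub]
    rw [intervalIntegral.integral_sub (hg.intervalIntegrable_spikeWeight_smul hρ δ _ _)
      (continuous_const.intervalIntegrable_spikeWeight_smul hρ δ _ _),
      intervalIntegral.integral_smul_const, integral_spikeWeight_cell hρ hδ, zero_smul, sub_zero]
  rw [heq]
  refine (intervalIntegral.norm_integral_le_of_norm_le_const (C := ρ⁻¹ * ω) ?_).trans ?_
  · intro s hs
    rw [Set.uIoc_of_le hle] at hs
    rw [norm_smul]
    refine mul_le_mul (abs_spikeWeight_le hρ δ s) (hω _ _ ?_) (norm_nonneg _)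
      (inv_nonneg.2 hρ.1.le)
    rw [abs_le]
    constructor <;> linarith [hs.1, hs.2]
  · rw [show ((k : ℝ) + 1) * δ - k * δ = δ by ring, abs_of_pos hδ]

lemma norm_integral_spikeWeight_smul_cells_le {ρ δ ω : ℝ} (hρ : ρ ∈ Set.Ioo (0 : ℝ) 1)
    (hδ : 0 < δ) {g : ℝ → E} (hg : Continuous g)
    (hω : ∀ x y, |x - y| ≤ δ → ‖g x - g y‖ ≤ ω) (k : ℕ) :
    ‖∫ s in (0 : ℝ)..(k * δ), spikeWeight ρ δ s • g s‖ ≤ ρ⁻¹ * ω * (k * δ) := by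
  induction k with
  | zero => simp
  | succ k ih =>
    rw [← intervalIntegral.integral_add_adjacent_intervals
      (hg.intervalIntegrable_spikeWeight_smul hρ δ 0 (k * δ))
      (hg.intervalIntegrable_spikeWeight_smul hρ δ _ _), Nat.cast_succ]
    refine (norm_add_le_of_le ih
      (norm_integral_spikeWeight_smul_cell_le hρ hδ hg hω k)).trans_eq ?_
    ring

lemma norm_integral_spikeWeight_smul_le {ρ δ ω M : ℝ} (hρ : ρ ∈ Set.Ioo (0 : ℝ) 1)
    (hδ : 0 < δ) {g : ℝ → E} (hg : Continuous g)
    (hω : ∀ x y, |x - y| ≤ δ → ‖g x - g y‖ ≤ ω) (hM : ∀ x, ‖g x‖ ≤ M) {t : ℝ} (ht : 0 ≤ t) :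
    ‖∫ s in (0 : ℝ)..t, spikeWeight ρ δ s • g s‖ ≤ ρ⁻¹ * (ω * t + M * δ) := by
  have hρ' : 0 ≤ ρ⁻¹ := inv_nonneg.2 hρ.1.le
  have hω0 : 0 ≤ ω := (norm_nonneg _).trans (hω 0 0 (by simpa using hδ.le))
  have hM0 : 0 ≤ M := (norm_nonneg _).trans (hM 0)
  set k := ⌊t / δ⌋₊
  have hk : k * δ ≤ t := (le_div_iff₀ hδ).1 (Nat.floor_le (by positivity))
  have hk' : t < (k + 1) * δ := (div_lt_iff₀ hδ).1 (Nat.lt_floor_add_one _)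
  rw [← intervalIntegral.integral_add_adjacent_intervals
    (hg.intervalIntegrable_spikeWeight_smul hρ δ 0 (k * δ))
    (hg.intervalIntegrable_spikeWeight_smul hρ δ _ _)]
  have h2 : ‖∫ s in (k * δ)..t, spikeWeight ρ δ s • g s‖ ≤ ρ⁻¹ * M * |t - k * δ| := by
    refine intervalIntegral.norm_integral_le_of_norm_le_const fun s _ => ?_
    rw [norm_smul]
    exact mul_le_mul (abs_spikeWeight_le hρ δ s) (hM s) (norm_nonneg _) hρ'
  refine (norm_add_le_of_le
    (norm_integral_spikeWeight_smul_cells_le hρ hδ hg hω k) h2).trans ?_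
  have h3 : |t - k * δ| ≤ δ := by
    rw [abs_of_nonneg (by linarith)]
    linarith
  calc ρ⁻¹ * ω * (k * δ) + ρ⁻¹ * M * |t - k * δ| ≤ ρ⁻¹ * ω * t + ρ⁻¹ * M * δ := by gcongr
    _ = ρ⁻¹ * (ω * t + M * δ) := by ring

/-- Averaging: integrals against the rapidly oscillating weight are uniformly small. -/
lemma exists_norm_integral_spikeWeight_smul_le {T ρ ε : ℝ} (hT : 0 < T)
    (hρ : ρ ∈ Set.Ioo (0 : ℝ) 1) (hε : 0 < ε) {f : ℝ → E} (hf : Integrable f) :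
    ∃ N : ℕ, 0 < N ∧ ∀ t ∈ Set.Icc 0 T,
      ‖∫ s in Set.Icc 0 t, spikeWeight ρ (T / N) s • f s‖ ≤ ρ⁻¹ * ε := by
  have hρ' : 0 ≤ ρ⁻¹ := inv_nonneg.2 hρ.1.le
  obtain ⟨g, hgs, hfg, hgc, hgi⟩ :=
    hf.exists_hasCompactSupport_integral_sub_le (show 0 < ε / 3 by positivity)
  obtain ⟨M, hM⟩ := hgs.exists_bound_of_continuous hgc
  obtain ⟨η, hη, hgη⟩ := Metric.uniformContinuous_iff.1
    (hgs.uniformContinuous_of_continuous hgc) (ε / (3 * T)) (by positivity)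
  obtain ⟨N, hN⟩ := exists_nat_gt (max (T / η) (3 * M * T / ε))
  have hN1 : T / η < N := (le_max_left _ _).trans_lt hN
  have hN2 : 3 * M * T / ε < N := (le_max_right _ _).trans_lt hN
  have hN0 : (0 : ℝ) < N := (by positivity : 0 < T / η).trans hN1
  have hδ : 0 < T / N := by positivity
  have hδη : T / N < η := by
    rw [div_lt_iff₀ hη] at hN1
    rw [div_lt_iff₀ hN0]
    linarith
  have hMδ : M * (T / N) ≤ ε / 3 := by
    rw [div_lt_iff₀ hε] at hN2
    rw [mul_div_assoc', div_le_iff₀ hN0]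
    linarith
  refine ⟨N, by exact_mod_cast hN0, fun t ht => ?_⟩
  have hfgi : Integrable fun s => f s - g s := hf.sub hgi
  have hsplit : ∫ s in Set.Icc 0 t, spikeWeight ρ (T / N) s • f s =
      (∫ s in Set.Icc 0 t, spikeWeight ρ (T / N) s • (f s - g s)) +
        ∫ s in (0 : ℝ)..t, spikeWeight ρ (T / N) s • g s := by
    rw [intervalIntegral.integral_of_le ht.1, ← integral_Icc_eq_integral_Ioc,
      ← integral_add (Integrable.spikeWeight_smul hρ _ hfgi.integrableOn)
        (Integrable.spikeWeight_smul hρ _ hgi.integrableOn)]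
    simp only [← smul_add, sub_add_cancel]
  have h1 : ‖∫ s in Set.Icc 0 t, spikeWeight ρ (T / N) s • (f s - g s)‖ ≤ ρ⁻¹ * (ε / 3) := by
    calc _ ≤ ∫ s in Set.Icc 0 t, ρ⁻¹ * ‖f s - g s‖ := by
          refine norm_integral_le_of_norm_le (hfgi.norm.integrableOn.const_mul _)
            (.of_forall fun s => ?_)
          rw [norm_smul]
          exact mul_le_mul_of_nonneg_right (abs_spikeWeight_le hρ _ s) (norm_nonneg _)
      _ = ρ⁻¹ * ∫ s in Set.Icc 0 t, ‖f s - g s‖ := integral_const_mul _ _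
      _ ≤ ρ⁻¹ * (ε / 3) := by
          refine mul_le_mul_of_nonneg_left (le_trans ?_ hfg) hρ'
          exact setIntegral_le_integral hfgi.norm (.of_forall fun s => norm_nonneg _)
  have h2 := norm_integral_spikeWeight_smul_le hρ hδ hgc (ω := ε / (3 * T))
    (fun x y hxy => by
      rw [← dist_eq_norm]
      exact (hgη (by rw [Real.dist_eq]; exact hxy.trans_lt hδη)).le) hM ht.1
  rw [hsplit]
  refine (norm_add_le_of_le h1 h2).trans ?_
  rw [← mul_add]
  refine mul_le_mul_of_nonneg_left ?_ hρ'
  have h3 : ε / (3 * T) * t ≤ ε / 3 := by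
    calc ε / (3 * T) * t ≤ ε / (3 * T) * T := by gcongr; exact ht.2
      _ = ε / 3 := by field_simp
  linarith

end

/-- **Lemma (implicit spike variation sets).** For every `h ∈ L¹([0,T],ℝⁿ)` and every
`ρ ∈ (0,1)` there exists a measurable set `Q_ρ ⊆ [0,T]` with `λ(Q_ρ) = ρT` such that
`sup_{t ∈ [0,T]} ‖∫₀ᵗ (1 - ρ⁻¹ 𝟙_{Q_ρ}(s)) h(s) ds‖ ≤ ρ`. -/
theorem stmt_3 (T : ℝ) (hT : 0 < T) (n : ℕ) (hn : 0 < n)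
    (h : ℝ → (Fin n → ℝ)) (hh : IntegrableOn h (Set.Icc 0 T))
    (ρ : ℝ) (hρ : ρ ∈ Set.Ioo (0:ℝ) 1) :
    ∃ Q : Set ℝ, MeasurableSet Q ∧ Q ⊆ Set.Icc 0 T ∧
      volume Q = ENNReal.ofReal (ρ * T) ∧
      ∀ t ∈ Set.Icc (0:ℝ) T,
        ‖∫ s in Set.Icc (0:ℝ) t,
            ((1:ℝ) - ρ⁻¹ * Set.indicator Q (fun _ => (1:ℝ)) s) • h s‖ ≤ ρ := by
  obtain ⟨N, hN, hbound⟩ := exists_norm_integral_spikeWeight_smul_le hT hρ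
    (ε := ρ * ρ) (mul_pos hρ.1 hρ.1) (hh.integrable_indicator measurableSet_Icc)
  have hN' : (0 : ℝ) < N := by exact_mod_cast hN
  have hcells : N * (T / N) = T := by field_simp
  refine ⟨spikeSet ρ (T / N) ∩ Set.Icc 0 T,
    (measurableSet_spikeSet _ _).inter measurableSet_Icc, Set.inter_subset_right, ?_,
    fun t ht => ?_⟩
  · have hvol := volume_spikeSet_inter_Icc hρ (show 0 < T / N by positivity) N
    rwa [hcells] at hvol
  · have hb := hbound t ht
    rw [inv_mul_cancel_left₀ hρ.1.ne'] at hb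
    refine (congrArg _ (setIntegral_congr_fun measurableSet_Icc fun s hs => ?_)).trans_le hb
    have hsT : s ∈ Set.Icc 0 T := ⟨hs.1, hs.2.trans ht.2⟩
    have hind : (spikeSet ρ (T / N) ∩ Set.Icc 0 T).indicator (fun _ => (1 : ℝ)) s =
        (spikeSet ρ (T / N)).indicator (fun _ => 1) s := by
      rw [Set.inter_comm, ← Set.indicator_indicator, Set.indicator_of_mem hsT]
    simp only [spikeWeight, hind, Set.indicator_of_mem hsT]
end

section
/- Let u, u' : [0,T] → ℝ^m be measurable and essentially bounded, and let q : [0,T] → ℝ^n be continuous with q(t) = q₀ + ∫₀ᵗ f(q(τ),u(τ),τ) dτ for all t ∈ [0,T]. Define h(τ) := f(q(τ),u'(τ),τ) − f(q(τ),u(τ),τ) for a.e. τ, and let w : [0,T] → ℝ^n be the continuous solution of w(t) = ∫₀ᵗ [∂₁f(q(τ),u(τ),τ) · w(τ) + h(τ)] dτ. For each ρ ∈ (0,1) let Q_ρ ⊂ [0,T] be a measurable set with λ(Q_ρ) = ρT and sup_{t ∈ [0,T]} ‖∫₀ᵗ (1 − (1/ρ) 𝟙_{Q_ρ}(s)) h(s)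 ds‖ ≤ ρ, and define the spike variation u_ρ := u' on Q_ρ and u_ρ := u on [0,T] \ Q_ρ. Then for every ε > 0 there exists ρ₀ > 0 such that for every ρ ∈ (0,ρ₀), any continuous q_ρ : [0,T] → ℝ^n satisfying q_ρ(t) = q₀ + ∫₀ᵗ f(q_ρ(τ),u_ρ(τ),τ) dτ for all t ∈ [0,T] also satisfies sup_{t ∈ [0,T]} ‖q_ρ(t) − q(t) − ρ w(t)‖ ≤ ε ρ. In other words, the map ρ ↦ q_ρ ∈ C([0,T],ℝ^n) is differentiable at ρ = 0 with derivative w. -/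
open MeasureTheory Matrix

/-- A Grönwall inequality whose hypothesis at time `t` may use the conclusion before `t`. -/
theorem lt_mul_exp_of_le_integral_of_forall_lt {φ : ℝ → ℝ} {T K a b : ℝ} (hK : 0 < K)
    (hab : a < b) (hφ : ContinuousOn φ (Set.Icc 0 T))
    (h : ∀ t ∈ Set.Icc 0 T, (∀ s ∈ Set.Ico 0 t, φ s < b * Real.exp (K * s)) →
      φ t ≤ a + ∫ s in (0 : ℝ)..t, K * φ s) :
    ∀ t ∈ Set.Icc 0 T, φ t < b * Real.exp (K * t) := by
  by_contra! hcon
  obtain ⟨t₀, ht₀, hbt₀⟩ := hcon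
  have hclosed : IsClosed (Set.Icc 0 T ∩ (fun t => φ t - b * Real.exp (K * t)) ⁻¹' Set.Ici 0) :=
    ContinuousOn.preimage_isClosed_of_isClosed (by fun_prop) isClosed_Icc isClosed_Ici
  obtain ⟨t, ⟨ht, htb⟩, hmin⟩ := (isCompact_Icc.of_isClosed_subset hclosed
    Set.inter_subset_left).exists_isLeast ⟨t₀, ht₀, by simpa using hbt₀⟩
  have hlt : ∀ s ∈ Set.Ico 0 t, φ s < b * Real.exp (K * s) := by
    intro s hs
    by_contra! hle
    exact hs.2.not_ge (hmin ⟨⟨hs.1, hs.2.le.trans ht.2⟩, by simpa using hle⟩)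
  have hderiv : ∀ s ∈ Set.uIcc 0 t,
      HasDerivAt (fun s => b * Real.exp (K * s)) (K * (b * Real.exp (K * s))) s := by
    intro s _
    refine (((hasDerivAt_id s).const_mul K).exp.const_mul b).congr_deriv ?_
    simp only [id, mul_one]
    ring
  have hint : ∫ s in (0 : ℝ)..t, K * (b * Real.exp (K * s)) = b * Real.exp (K * t) - b := by
    rw [intervalIntegral.integral_eq_sub_of_hasDerivAt hderiv
      (Continuous.intervalIntegrable (by fun_prop) _ _)]
    simp
  have hmono : ∫ s in (0 : ℝ)..t, K * φ s ≤ ∫ s in (0 : ℝ)..t, K * (b * Real.exp (K * s)) := by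
    refine intervalIntegral.integral_mono_on_of_le_Ioo ht.1 ?_
      (Continuous.intervalIntegrable (by fun_prop) _ _) fun s hs =>
        mul_le_mul_of_nonneg_left (hlt s ⟨hs.1.le, hs.2⟩).le hK.le
    refine ContinuousOn.intervalIntegrable ?_
    rw [Set.uIcc_of_le ht.1]
    exact (hφ.mono (Set.Icc_subset_Icc_right ht.2)).const_mul K
  have htb' : b * Real.exp (K * t) ≤ φ t := by simpa using htb
  linarith [h t ht hlt]

section Control

variable {E V G : Type*} [NormedAddCommGroup E] [NormedAddCommGroup V] [NormedAddCommGroup G]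
  [ProperSpace E] [ProperSpace V] {T R : ℝ}

/-- A continuous function is bounded along states and controls of norm at most `R`. -/
theorem exists_norm_le_of_continuousOn_univ_prod_Icc {g : (E × V) × ℝ → G}
    (hg : ContinuousOn g (Set.univ ×ˢ Set.Icc 0 T)) (R : ℝ) :
    ∃ C, ∀ x v t, ‖x‖ ≤ R → ‖v‖ ≤ R → t ∈ Set.Icc 0 T → ‖g ((x, v), t)‖ ≤ C := by
  obtain ⟨C, hC⟩ := (((isCompact_closedBall (0 : E) R).prod (isCompact_closedBall (0 : V) R)).prod
    (isCompact_Icc (a := (0 : ℝ)) (b := T))).exists_bound_of_continuousOn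
      (hg.mono (Set.prod_mono_left (Set.subset_univ _)))
  exact ⟨C, fun x v t hx hv ht => hC _ ⟨⟨by simpa using hx, by simpa using hv⟩, ht⟩⟩

/-- A continuous function of state, control and time is integrable along a continuous state and
an essentially bounded control. -/
theorem integrableOn_comp_of_ae_norm_le (hT : 0 ≤ T) {g : (E × V) × ℝ → G}
    (hg : ContinuousOn g (Set.univ ×ˢ Set.Icc 0 T)) {x : ℝ → E} (hx : ContinuousOn x (Set.Icc 0 T))
    {v : ℝ → V} (hv : AEStronglyMeasurable v (volume.restrict (Set.Icc 0 T)))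
    (hvR : ∀ᵐ τ ∂(volume.restrict (Set.Icc 0 T)), ‖v τ‖ ≤ R) :
    IntegrableOn (fun τ => g ((x τ, v τ), τ)) (Set.Icc 0 T) := by
  have hcont : Continuous fun p : (E × V) × ℝ => g (p.1, Set.projIcc 0 T hT p.2) :=
    hg.comp_continuous (by fun_prop) fun p => ⟨trivial, Subtype.coe_prop _⟩
  have hmeas : AEStronglyMeasurable (fun τ => g ((x τ, v τ), τ))
      (volume.restrict (Set.Icc 0 T)) := by
    refine (hcont.comp_aestronglyMeasurable (((hx.aestronglyMeasurable
      measurableSet_Icc).prodMk hv).prodMk aestronglyMeasurable_id)).congr ?_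
    filter_upwards [ae_restrict_mem measurableSet_Icc] with τ hτ
    simp [Set.projIcc_of_mem hT hτ]
  obtain ⟨Rx, hRx⟩ := isCompact_Icc.exists_bound_of_continuousOn hx
  obtain ⟨C, hC⟩ := exists_norm_le_of_continuousOn_univ_prod_Icc hg (max Rx R)
  have hbound : ∀ᵐ τ ∂(volume.restrict (Set.Icc 0 T)), ‖g ((x τ, v τ), τ)‖ ≤ C := by
    filter_upwards [ae_restrict_mem measurableSet_Icc, hvR] with τ hτ hτv
    exact hC _ _ _ ((hRx τ hτ).trans (le_max_left _ _)) (hτv.trans (le_max_right _ _)) hτ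
  have : IsFiniteMeasure (volume.restrict (Set.Icc 0 T)) :=
    ⟨by simp⟩
  exact Integrable.of_bound hmeas C hbound

variable [NormedSpace ℝ E] {f : E → V → ℝ → E} {L : E → V → ℝ → E →L[ℝ] E}

/-- First-order Taylor expansion in the state, uniform on bounded sets of states and controls. -/
theorem exists_forall_norm_sub_sub_le
    (hL : ∀ x v, ∀ t ∈ Set.Icc 0 T, HasFDerivAt (fun y => f y v t) (L x v t) x)
    (hLc : ContinuousOn (fun p : (E × V) × ℝ => L p.1.1 p.1.2 p.2) (Set.univ ×ˢ Set.Icc 0 T))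
    (R : ℝ) {η : ℝ} (hη : 0 < η) :
    ∃ r > 0, ∀ x y v t, ‖x‖ ≤ R → ‖v‖ ≤ R → t ∈ Set.Icc 0 T → ‖y - x‖ ≤ r →
      ‖f y v t - f x v t - L x v t (y - x)‖ ≤ η * ‖y - x‖ := by
  have hcompact := ((isCompact_closedBall (0 : E) (R + 1)).prod
    (isCompact_closedBall (0 : V) R)).prod (isCompact_Icc (a := (0 : ℝ)) (b := T))
  obtain ⟨r, hr, hunif⟩ := Metric.uniformContinuousOn_iff_le.1
    (hcompact.uniformContinuousOn_of_continuous
      (hLc.mono (Set.prod_mono_left (Set.subset_univ _)))) η hη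
  refine ⟨min r 1, by positivity, fun x y v t hx hv ht hyx => ?_⟩
  refine (convex_closedBall x (min r 1)).norm_image_sub_le_of_norm_hasFDerivWithin_le'
    (f' := fun z => L z v t) (fun z _ => (hL z v t ht).hasFDerivWithinAt) (fun z hz => ?_)
    (Metric.mem_closedBall_self (by positivity)) (by rwa [mem_closedBall_iff_norm])
  have hzx : dist z x ≤ min r 1 := hz
  have hz : ‖z‖ ≤ R + 1 := by
    have := norm_le_norm_add_norm_sub' z x
    rw [← dist_eq_norm] at this
    linarith [min_le_right r 1]
  rw [← dist_eq_norm]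
  refine hunif ((z, v), t) ⟨⟨by simpa using hz, by simpa using hv⟩, ht⟩ ((x, v), t)
    ⟨⟨by simpa using hx.trans (by linarith), by simpa using hv⟩, ht⟩ ?_
  simpa [Prod.dist_eq, hr.le] using hzx.trans (min_le_left _ _)

/-- Differentiability at `0` of the trajectories of spike variations. -/
theorem exists_forall_norm_trajectory_sub_le (hT : 0 < T)
    (hfc : ContinuousOn (fun p : (E × V) × ℝ => f p.1.1 p.1.2 p.2) (Set.univ ×ˢ Set.Icc 0 T))
    (hL : ∀ x v, ∀ t ∈ Set.Icc 0 T, HasFDerivAt (fun y => f y v t) (L x v t) x)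
    (hLc : ContinuousOn (fun p : (E × V) × ℝ => L p.1.1 p.1.2 p.2) (Set.univ ×ˢ Set.Icc 0 T))
    {u u' : ℝ → V} (hu : StronglyMeasurable u) (hu' : StronglyMeasurable u')
    (hub : ∀ᵐ τ ∂(volume.restrict (Set.Icc 0 T)), ‖u τ‖ ≤ R)
    (hub' : ∀ᵐ τ ∂(volume.restrict (Set.Icc 0 T)), ‖u' τ‖ ≤ R)
    {q₀ : E} {q : ℝ → E} (hqc : ContinuousOn q (Set.Icc 0 T))
    (hq : ∀ t ∈ Set.Icc (0 : ℝ) T, q t = q₀ + ∫ τ in (0 : ℝ)..t, f (q τ) (u τ) τ)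
    {w : ℝ → E} (hwc : ContinuousOn w (Set.Icc 0 T))
    (hw : ∀ t ∈ Set.Icc (0 : ℝ) T, w t = ∫ τ in (0 : ℝ)..t,
      (L (q τ) (u τ) τ (w τ) + (f (q τ) (u' τ) τ - f (q τ) (u τ) τ)))
    {Q : ℝ → Set ℝ}
    (hQ : ∀ ρ ∈ Set.Ioo (0 : ℝ) 1, MeasurableSet (Q ρ) ∧
      volume (Q ρ) = ENNReal.ofReal (ρ * T) ∧
      ∀ t ∈ Set.Icc (0 : ℝ) T,
        ‖∫ s in Set.Icc (0 : ℝ) t,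
          ((1 : ℝ) - ρ⁻¹ * Set.indicator (Q ρ) (fun _ => (1 : ℝ)) s) •
            (f (q s) (u' s) s - f (q s) (u s) s)‖ ≤ ρ)
    {ε : ℝ} (hε : 0 < ε) :
    ∃ ρ₀ > (0 : ℝ), ∀ ρ : ℝ, 0 < ρ → ρ < ρ₀ → ρ < 1 → ∀ uρ : ℝ → V,
      (∀ τ ∈ Q ρ, uρ τ = u' τ) → (∀ τ ∈ Set.Icc (0 : ℝ) T \ Q ρ, uρ τ = u τ) →
      ∀ qρ : ℝ → E, ContinuousOn qρ (Set.Icc 0 T) →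
        (∀ t ∈ Set.Icc (0 : ℝ) T, qρ t = q₀ + ∫ τ in (0 : ℝ)..t, f (qρ τ) (uρ τ) τ) →
        ∀ t ∈ Set.Icc (0 : ℝ) T, ‖qρ t - q t - ρ • w t‖ ≤ ε * ρ := by
  obtain ⟨Rq, hRq⟩ := isCompact_Icc.exists_bound_of_continuousOn hqc
  obtain ⟨W', hW'⟩ := isCompact_Icc.exists_bound_of_continuousOn hwc
  obtain ⟨W, hW0, hW⟩ : ∃ W ≥ 0, ∀ t ∈ Set.Icc 0 T, ‖w t‖ ≤ W :=
    ⟨max W' 0, le_max_right _ _, fun t ht => (hW' t ht).trans (le_max_left _ _)⟩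
  obtain ⟨K', hK'⟩ := exists_norm_le_of_continuousOn_univ_prod_Icc hLc (max Rq R)
  obtain ⟨K, hK0, hK⟩ : ∃ K ≥ 0, ∀ x v t, ‖x‖ ≤ max Rq R → ‖v‖ ≤ max Rq R → t ∈ Set.Icc 0 T →
      ‖L x v t‖ ≤ K :=
    ⟨max K' 0, le_max_right _ _, fun x v t hx hv ht => (hK' x v t hx hv ht).trans (le_max_left _ _)⟩
  set κ : ℝ := 3 * K + 1 with hκ
  set c : ℝ := ε * Real.exp (-(κ * T)) with hc
  have hc0 : 0 < c := by positivity
  obtain ⟨η, hη0, hη1, hηc⟩ : ∃ η > 0, η ≤ 1 ∧ η * (W * T) < c / 2 := by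
    refine ⟨min 1 (c / 2 / (W * T + 1)), by positivity, min_le_left _ _, ?_⟩
    calc _ ≤ c / 2 / (W * T + 1) * (W * T) := by gcongr; exact min_le_right _ _
      _ < c / 2 := by
        rw [div_mul_eq_mul_div, div_lt_iff₀ (by positivity)]
        nlinarith
  obtain ⟨r, hr, htaylor⟩ := exists_forall_norm_sub_sub_le hL hLc (max Rq R) hη0
  refine ⟨min (c / 2 / (1 + 2 * K * W * T)) (r / (ε + W)), by positivity, ?_⟩
  intro ρ hρ0 hρ hρ1 uρ huQ huQc qρ hqρc hqρ
  obtain ⟨hQm, hQvol, hQint⟩ := hQ ρ ⟨hρ0, hρ1⟩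
  have hρc : ρ * (1 + 2 * K * W * T) < c / 2 :=
    (lt_div_iff₀ (by positivity)).1 (hρ.trans_le (min_le_left _ _))
  have hρr : ρ * (ε + W) < r := (lt_div_iff₀ (by positivity)).1 (hρ.trans_le (min_le_right _ _))
  have huρm : AEStronglyMeasurable uρ (volume.restrict (Set.Icc 0 T)) := by
    classical
    have hpw : StronglyMeasurable ((Q ρ).piecewise u' u) := hu'.piecewise hQm hu
    refine hpw.aestronglyMeasurable.congr ?_
    filter_upwards [ae_restrict_mem measurableSet_Icc] with τ hτ
    by_cases hτQ : τ ∈ Q ρ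
    · simp [hτQ, huQ]
    · simp [hτQ, huQc τ ⟨hτ, hτQ⟩]
  have huρb : ∀ᵐ τ ∂(volume.restrict (Set.Icc 0 T)), ‖uρ τ‖ ≤ R := by
    filter_upwards [ae_restrict_mem measurableSet_Icc, hub, hub'] with τ hτ h1 h2
    by_cases hτQ : τ ∈ Q ρ
    · rwa [huQ τ hτQ]
    · rwa [huQc τ ⟨hτ, hτQ⟩]
  have hLwc : ContinuousOn (fun p : ((E × E) × V) × ℝ => L p.1.1.1 p.1.2 p.2 p.1.1.2)
      (Set.univ ×ˢ Set.Icc 0 T) := by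
    have : ContinuousOn (fun p : ((E × E) × V) × ℝ => L p.1.1.1 p.1.2 p.2)
        (Set.univ ×ˢ Set.Icc 0 T) :=
      hLc.comp (f := fun p : ((E × E) × V) × ℝ => ((p.1.1.1, p.1.2), p.2)) (by fun_prop)
        fun p hp => ⟨trivial, hp.2⟩
    exact this.clm_apply (by fun_prop)
  have hf_int : IntegrableOn (fun τ => f (q τ) (u τ) τ) (Set.Icc 0 T) :=
    integrableOn_comp_of_ae_norm_le hT.le hfc hqc hu.aestronglyMeasurable hub
  have hf'_int : IntegrableOn (fun τ => f (q τ) (u' τ) τ) (Set.Icc 0 T) :=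
    integrableOn_comp_of_ae_norm_le hT.le hfc hqc hu'.aestronglyMeasurable hub'
  have hfρ_int : IntegrableOn (fun τ => f (qρ τ) (uρ τ) τ) (Set.Icc 0 T) :=
    integrableOn_comp_of_ae_norm_le hT.le hfc hqρc huρm huρb
  have hfqρ_int : IntegrableOn (fun τ => f (q τ) (uρ τ) τ) (Set.Icc 0 T) :=
    integrableOn_comp_of_ae_norm_le hT.le hfc hqc huρm huρb
  have hLw_int : IntegrableOn (fun τ => L (q τ) (u τ) τ (w τ)) (Set.Icc 0 T) :=
    integrableOn_comp_of_ae_norm_le (x := fun τ => (q τ, w τ)) hT.le hLwc (hqc.prodMk hwc)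
      hu.aestronglyMeasurable hub
  have hzc : ContinuousOn (fun t => ‖qρ t - q t - ρ • w t‖) (Set.Icc 0 T) :=
    ((hqρc.sub hqc).sub (hwc.const_smul ρ)).norm
  set h : ℝ → E := fun τ => f (q τ) (u' τ) τ - f (q τ) (u τ) τ with hh
  set P : ℝ → E := fun τ => f (qρ τ) (uρ τ) τ - f (q τ) (uρ τ) τ - ρ • L (q τ) (u τ) τ (w τ)
    with hP
  have hdecomp : ∀ t ∈ Set.Icc 0 T, qρ t - q t - ρ • w t = (∫ τ in (0 : ℝ)..t, P τ) -
      ρ • ∫ s in Set.Icc (0 : ℝ) t,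
        ((1 : ℝ) - ρ⁻¹ * Set.indicator (Q ρ) (fun _ => (1 : ℝ)) s) • h s := by
    intro t ht
    have toI : ∀ {g : ℝ → E}, IntegrableOn g (Set.Icc 0 T) → IntervalIntegrable g volume 0 t := by
      intro g hg
      rw [intervalIntegrable_iff_integrableOn_Icc_of_le ht.1]
      exact hg.mono_set (Set.Icc_subset_Icc_right ht.2)
    have hPi : IntervalIntegrable P volume 0 t :=
      toI ((hfρ_int.sub hfqρ_int).sub (hLw_int.smul ρ))
    have hhi : IntervalIntegrable (fun τ => ρ • (L (q τ) (u τ) τ (w τ) +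
        (f (q τ) (u' τ) τ - f (q τ) (u τ) τ))) volume 0 t :=
      toI ((hLw_int.add (hf'_int.sub hf_int)).smul ρ)
    have hspi : IntervalIntegrable (fun τ => ρ • h τ - (f (q τ) (uρ τ) τ - f (q τ) (u τ) τ))
        volume 0 t :=
      toI (((hf'_int.sub hf_int).smul ρ).sub (hfqρ_int.sub hf_int))
    rw [integral_Icc_eq_integral_Ioc, ← intervalIntegral.integral_of_le ht.1, hqρ t ht, hq t ht,
      hw t ht, add_sub_add_left_eq_sub, ← intervalIntegral.integral_sub (toI hfρ_int) (toI hf_int),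
      ← intervalIntegral.integral_smul, ← intervalIntegral.integral_smul,
      ← intervalIntegral.integral_sub ((toI hfρ_int).sub (toI hf_int)) hhi]
    have hsub : ∫ τ in (0 : ℝ)..t, ρ • ((1 : ℝ) - ρ⁻¹ *
        Set.indicator (Q ρ) (fun _ => (1 : ℝ)) τ) • h τ =
        ∫ τ in (0 : ℝ)..t, (ρ • h τ - (f (q τ) (uρ τ) τ - f (q τ) (u τ) τ)) := by
      refine intervalIntegral.integral_congr fun τ hτ => ?_
      rw [Set.uIcc_of_le ht.1] at hτ
      by_cases hτQ : τ ∈ Q ρ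
      · simp only [hτQ, Set.indicator_of_mem, huQ, mul_one, hh, smul_smul, smul_sub,
          mul_inv_cancel₀ hρ0.ne', sub_smul, one_smul]
        abel
      · simp [hτQ, huQc τ ⟨⟨hτ.1, hτ.2.trans ht.2⟩, hτQ⟩]
    rw [hsub, ← intervalIntegral.integral_sub hPi hspi]
    refine intervalIntegral.integral_congr fun τ _ => ?_
    simp only [hP, hh, smul_add]
    abel
  have hmain := lt_mul_exp_of_le_integral_of_forall_lt (φ := fun t => ‖qρ t - q t - ρ • w t‖)
    (T := T) (K := κ) (a := ρ * (ρ * (1 + 2 * K * W * T) + η * (W * T))) (b := c * ρ)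
    (by positivity) (by nlinarith) hzc ?_
  · intro t ht
    refine (hmain t ht).le.trans ?_
    calc c * ρ * Real.exp (κ * t) ≤ c * ρ * Real.exp (κ * T) := by
          have := ht.2
          gcongr
      _ = ε * ρ := by
          rw [hc, Real.exp_neg]
          field_simp
  intro t ht hlt
  have hPbound : ∀ᵐ s : ℝ, s ∈ Set.Ioc 0 t → ‖P s‖ ≤ κ * ‖qρ s - q s - ρ • w s‖ +
      (η * (ρ * W) + 2 * K * (ρ * W) * Set.indicator (Q ρ) (fun _ => (1 : ℝ)) s) := by
    filter_upwards [(ae_restrict_iff' measurableSet_Icc).1 hub,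
      (ae_restrict_iff' measurableSet_Icc).1 huρb, compl_mem_ae_iff.2 (measure_singleton t)]
      with s hus huρs hst hs
    have hsT : s ∈ Set.Icc 0 T := ⟨hs.1.le, hs.2.trans ht.2⟩
    have hz : ‖qρ s - q s - ρ • w s‖ < ε * ρ := by
      refine (hlt s ⟨hs.1.le, lt_of_le_of_ne hs.2 hst⟩).trans_le ?_
      have := hsT.2
      calc c * ρ * Real.exp (κ * s) ≤ c * ρ * Real.exp (κ * T) := by gcongr
        _ = ε * ρ := by
          rw [hc, Real.exp_neg]
          field_simp
    have hδ : ‖qρ s - q s‖ ≤ ‖qρ s - q s - ρ • w s‖ + ρ * W := by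
      calc ‖qρ s - q s‖ ≤ ‖qρ s - q s - ρ • w s‖ + ‖ρ • w s‖ := norm_le_norm_sub_add _ _
        _ ≤ _ := by
          rw [norm_smul, Real.norm_of_nonneg hρ0.le]
          gcongr
          exact hW s hsT
    have hqs := (hRq s hsT).trans (le_max_left Rq R)
    have hus' := (hus hsT).trans (le_max_right Rq R)
    have huρs' := (huρs hsT).trans (le_max_right Rq R)
    have hrem := htaylor (q s) (qρ s) (uρ s) s hqs huρs' hsT (by linarith)
    have hLs := hK (q s) (u s) s hqs hus' hsT
    have hLρs := hK (q s) (uρ s) s hqs huρs' hsT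
    have hPs : P s = (f (qρ s) (uρ s) s - f (q s) (uρ s) s - L (q s) (uρ s) s (qρ s - q s)) +
        (L (q s) (uρ s) s - L (q s) (u s) s) (qρ s - q s) +
        L (q s) (u s) s (qρ s - q s - ρ • w s) := by
      simp only [hP, map_sub, map_smul, _root_.sub_apply]
      abel
    have hLz : ‖L (q s) (u s) s (qρ s - q s - ρ • w s)‖ ≤ K * ‖qρ s - q s - ρ • w s‖ :=
      ContinuousLinearMap.le_of_opNorm_le _ hLs _
    have hdiff : ‖(L (q s) (uρ s) s - L (q s) (u s) s) (qρ s - q s)‖ ≤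
        2 * K * Set.indicator (Q ρ) (fun _ => (1 : ℝ)) s * ‖qρ s - q s‖ := by
      refine ContinuousLinearMap.le_of_opNorm_le _ ?_ _
      by_cases hsQ : s ∈ Q ρ
      · simpa [hsQ, two_mul] using (norm_sub_le _ _).trans (add_le_add hLρs hLs)
      · simp [hsQ, huQc s ⟨hsT, hsQ⟩]
    have hi0 : 0 ≤ Set.indicator (Q ρ) (fun _ => (1 : ℝ)) s :=
      Set.indicator_nonneg (fun _ _ => zero_le_one) _
    have hi1 : Set.indicator (Q ρ) (fun _ => (1 : ℝ)) s ≤ 1 :=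
      Set.indicator_le_self' (fun _ _ => zero_le_one) _
    generalize Set.indicator (Q ρ) (fun _ => (1 : ℝ)) s = i at hdiff hi0 hi1 ⊢
    have hz0 := norm_nonneg (qρ s - q s - ρ • w s)
    rw [hPs]
    calc _ ≤ η * ‖qρ s - q s‖ + 2 * K * i * ‖qρ s - q s‖ + K * ‖qρ s - q s - ρ • w s‖ :=
          norm_add_le_of_le (norm_add_le_of_le hrem hdiff) hLz
      _ ≤ η * (‖qρ s - q s - ρ • w s‖ + ρ * W) + 2 * K * i * (‖qρ s - q s - ρ • w s‖ + ρ * W) +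
          K * ‖qρ s - q s - ρ • w s‖ := by gcongr
      _ = (η + 2 * K * i + K) * ‖qρ s - q s - ρ • w s‖ + (η * (ρ * W) + 2 * K * (ρ * W) * i) := by
          ring
      _ ≤ _ := by
          gcongr
          nlinarith
  have hφi : IntervalIntegrable (fun s => κ * ‖qρ s - q s - ρ • w s‖) volume 0 t := by
    refine ContinuousOn.intervalIntegrable ?_
    rw [Set.uIcc_of_le ht.1]
    exact (hzc.mono (Set.Icc_subset_Icc_right ht.2)).const_mul κ
  have hindi : IntervalIntegrable (fun s => 2 * K * (ρ * W) *
      Set.indicator (Q ρ) (fun _ => (1 : ℝ)) s) volume 0 t := by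
    refine IntervalIntegrable.const_mul ?_ _
    rw [intervalIntegrable_iff_integrableOn_Ioc_of_le ht.1]
    exact (integrableOn_const (by simp)).indicator hQm
  have hind : ∫ s in (0 : ℝ)..t, Set.indicator (Q ρ) (fun _ => (1 : ℝ)) s ≤ ρ * T := by
    rw [intervalIntegral.integral_of_le ht.1, setIntegral_indicator hQm]
    simp only [integral_const, MeasurableSet.univ, measureReal_restrict_apply, Set.univ_inter,
      smul_eq_mul, mul_one]
    refine ENNReal.toReal_le_of_le_ofReal (by positivity) ?_
    exact (measure_mono Set.inter_subset_right).trans hQvol.le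
  have hPint := intervalIntegral.norm_integral_le_of_norm_le ht.1 hPbound
    (hφi.add (intervalIntegrable_const.add hindi))
  rw [intervalIntegral.integral_add hφi (intervalIntegrable_const.add hindi),
    intervalIntegral.integral_add intervalIntegrable_const hindi,
    intervalIntegral.integral_const] at hPint
  have hspike := hQint t ht
  have hKW : 2 * K * (ρ * W) * ∫ s in (0 : ℝ)..t, Set.indicator (Q ρ) (fun _ => (1 : ℝ)) s ≤
      2 * K * (ρ * W) * (ρ * T) := by gcongr
  have hηt : (t - 0) * (η * (ρ * W)) ≤ T * (η * (ρ * W)) := by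
    have := ht.2
    rw [sub_zero]
    gcongr
  rw [smul_eq_mul] at hPint
  have hnorm := norm_sub_le (∫ τ in (0 : ℝ)..t, P τ) (ρ • ∫ s in Set.Icc (0 : ℝ) t,
    ((1 : ℝ) - ρ⁻¹ * Set.indicator (Q ρ) (fun _ => (1 : ℝ)) s) • h s)
  rw [← hdecomp t ht, norm_smul, Real.norm_of_nonneg hρ0.le] at hnorm
  have hρρ := mul_le_mul_of_nonneg_left hspike hρ0.le
  simp only [intervalIntegral.integral_const_mul] at hPint ⊢
  linarith

end Control

/-- Differentiability of the trajectory with respect to implicit spike variations: with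
`h(τ) = f(q(τ),u'(τ),τ) − f(q(τ),u(τ),τ)`, `w` the associated variation vector, and
`u_ρ` the implicit spike variation of `u` built from the sets `Q_ρ`, for every `ε > 0`
there exists `ρ₀ > 0` such that any global solution `q_ρ` of the Cauchy problem for
`u_ρ` with `0 < ρ < ρ₀` satisfies `sup_{t∈[0,T]} ‖q_ρ(t) − q(t) − ρ w(t)‖ ≤ ε ρ`. -/
theorem stmt_4 (T : ℝ) (hT : 0 < T) (n m : ℕ) (hn : 0 < n) (hm : 0 < m)
    (f : (Fin n → ℝ) → (Fin m → ℝ) → ℝ → (Fin n → ℝ))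
    (f₁ : (Fin n → ℝ) → (Fin m → ℝ) → ℝ → Matrix (Fin n) (Fin n) ℝ)
    (q₀ : Fin n → ℝ)
    (hfcont : ContinuousOn (fun p : ((Fin n → ℝ) × (Fin m → ℝ)) × ℝ => f p.1.1 p.1.2 p.2)
      (Set.univ ×ˢ Set.Icc 0 T))
    (hfC1 : ∀ t ∈ Set.Icc (0:ℝ) T,
      ContDiff ℝ 1 fun p : (Fin n → ℝ) × (Fin m → ℝ) => f p.1 p.2 t)
    (hf₁ : ∀ (x : Fin n → ℝ) (v : Fin m → ℝ), ∀ t ∈ Set.Icc (0:ℝ) T,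
      ∃ D : (Fin n → ℝ) →L[ℝ] (Fin n → ℝ),
        HasFDerivAt (fun y => f y v t) D x ∧ ∀ z, D z = f₁ x v t *ᵥ z)
    (hf₁cont : ContinuousOn
      (fun p : ((Fin n → ℝ) × (Fin m → ℝ)) × ℝ => f₁ p.1.1 p.1.2 p.2)
      (Set.univ ×ˢ Set.Icc 0 T))
    -- the controls `u`, `u'` (measurable and essentially bounded)
    (u u' : ℝ → (Fin m → ℝ)) (hu : Measurable u) (hu' : Measurable u')
    (Ru : ℝ) (hub : ∀ᵐ τ ∂(volume.restrict (Set.Icc 0 T)), ‖u τ‖ ≤ Ru)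
    (Ru' : ℝ) (hub' : ∀ᵐ τ ∂(volume.restrict (Set.Icc 0 T)), ‖u' τ‖ ≤ Ru')
    -- the reference trajectory `q`
    (q : ℝ → (Fin n → ℝ)) (hqc : ContinuousOn q (Set.Icc 0 T))
    (hq : ∀ t ∈ Set.Icc (0:ℝ) T, q t = q₀ + ∫ τ in (0:ℝ)..t, f (q τ) (u τ) τ)
    -- the variation vector `w`
    (w : ℝ → (Fin n → ℝ)) (hwc : ContinuousOn w (Set.Icc 0 T))
    (hw : ∀ t ∈ Set.Icc (0:ℝ) T, w t = ∫ τ in (0:ℝ)..t,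
      (f₁ (q τ) (u τ) τ *ᵥ w τ + (f (q τ) (u' τ) τ - f (q τ) (u τ) τ)))
    -- the spike-variation sets `Q_ρ`
    (Q : ℝ → Set ℝ)
    (hQ : ∀ ρ ∈ Set.Ioo (0:ℝ) 1, MeasurableSet (Q ρ) ∧ Q ρ ⊆ Set.Icc 0 T ∧
      volume (Q ρ) = ENNReal.ofReal (ρ * T) ∧
      ∀ t ∈ Set.Icc (0:ℝ) T,
        ‖∫ s in Set.Icc (0:ℝ) t, ((1:ℝ) - ρ⁻¹ * Set.indicator (Q ρ) (fun _ => (1:ℝ)) s) •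
            (f (q s) (u' s) s - f (q s) (u s) s)‖ ≤ ρ) :
    ∀ ε > (0:ℝ), ∃ ρ₀ > (0:ℝ), ∀ ρ : ℝ, 0 < ρ → ρ < ρ₀ → ρ < 1 →
      ∀ uρ : ℝ → (Fin m → ℝ),
        (∀ τ ∈ Q ρ, uρ τ = u' τ) → (∀ τ ∈ Set.Icc (0:ℝ) T \ Q ρ, uρ τ = u τ) →
        ∀ qρ : ℝ → (Fin n → ℝ), ContinuousOn qρ (Set.Icc 0 T) →
          (∀ t ∈ Set.Icc (0:ℝ) T, qρ t = q₀ + ∫ τ in (0:ℝ)..t, f (qρ τ) (uρ τ) τ) →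
          ∀ t ∈ Set.Icc (0:ℝ) T, ‖qρ t - q t - ρ • w t‖ ≤ ε * ρ := by
  intro ε hε
  let M : Matrix (Fin n) (Fin n) ℝ →ₗ[ℝ] (Fin n → ℝ) →L[ℝ] (Fin n → ℝ) :=
    (Matrix.toLin'.trans LinearMap.toContinuousLinearMap).toLinearMap
  have hM : ∀ A z, M A z = A *ᵥ z := fun A z => Matrix.toLin'_apply A z
  refine exists_forall_norm_trajectory_sub_le (L := fun x v t => M (f₁ x v t)) (R := max Ru Ru')
    hT hfcont (fun x v t ht => ?_)
    (M.continuous_of_finiteDimensional.comp_continuousOn hf₁cont)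
    hu.stronglyMeasurable hu'.stronglyMeasurable
    (hub.mono fun _ h => h.trans (le_max_left _ _))
    (hub'.mono fun _ h => h.trans (le_max_right _ _)) hqc hq hwc
    (fun t ht => by simpa only [hM] using hw t ht)
    (fun ρ hρ => ⟨(hQ ρ hρ).1, (hQ ρ hρ).2.2⟩) hε
  obtain ⟨D, hD, hDz⟩ := hf₁ x v t ht
  have hMD : M (f₁ x v t) = D := ContinuousLinearMap.ext fun z => by rw [hM, hDz]
  exact hMD ▸ hD
end

section
/- Let B ∈ L¹([0,T],ℝ^d) and ρ ∈ (0,1). Then there exists a Lebesgue-measurable set Q_ρ ⊂ [0,T] with λ(Q_ρ) = ρT such that ‖∫₀ᵀ (1 − (1/ρ) 𝟙_{Q_ρ}(s)) B(s) ds‖ ≤ ρ/2. -/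
open MeasureTheory

/-- A measurable set of finite atomless measure on `ℝ` contains a measurable subset carrying any
prescribed fraction of its mass. -/
theorem exists_measurableSet_subset_measureReal_eq (μ : Measure ℝ) [IsFiniteMeasure μ]
    [NullSingletonClass μ] {A : Set ℝ} (hA : MeasurableSet A) {ρ : ℝ}
    (hρ : ρ ∈ Set.Ioo (0 : ℝ) 1) :
    ∃ q ⊆ A, MeasurableSet q ∧ μ.real q = ρ * μ.real A := by
  rcases (measureReal_nonneg (μ := μ) (s := A)).eq_or_lt' with h0 | hpos
  · exact ⟨∅, Set.empty_subset _, .empty, by simp [h0]⟩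
  set F : ℝ → ℝ := fun t => ∫ x in (-t)..t, A.indicator (fun _ => (1 : ℝ)) x ∂μ with hF
  have hint : Integrable (A.indicator fun _ => (1 : ℝ)) μ :=
    (integrable_const (1 : ℝ)).indicator hA
  have hcont : Continuous F := by
    have h := hint.continuous_primitive 0
    have hsub : F = fun t => (∫ x in (0 : ℝ)..t, A.indicator (fun _ => (1 : ℝ)) x ∂μ)
        - ∫ x in (0 : ℝ)..(-t), A.indicator (fun _ => (1 : ℝ)) x ∂μ := by
      funext t
      exact (intervalIntegral.integral_interval_sub_left hint.intervalIntegrable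
        hint.intervalIntegrable).symm
    rw [hsub]
    exact h.sub (h.comp continuous_neg)
  have hlim : Filter.Tendsto F Filter.atTop (nhds (μ.real A)) := by
    have h := intervalIntegral_tendsto_integral hint
      Filter.tendsto_neg_atTop_atBot (Filter.tendsto_id (α := ℝ))
    simpa [integral_indicator_one, hA, integral_indicator] using h
  have hlt : ρ * μ.real A < μ.real A := by nlinarith [hρ.2]
  obtain ⟨b, hb, hb0⟩ :=
    ((hlim.eventually (lt_mem_nhds hlt)).and (Filter.eventually_ge_atTop 0)).exists
  obtain ⟨t, ht, htF⟩ := intermediate_value_Icc hb0 hcont.continuousOn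
    (show ρ * μ.real A ∈ Set.Icc (F 0) (F b) from
      ⟨by simpa [hF] using (mul_pos hρ.1 hpos).le, hb.le⟩)
  refine ⟨A ∩ Set.Ioc (-t) t, Set.inter_subset_left, hA.inter measurableSet_Ioc, ?_⟩
  rw [← htF, hF]
  simp only
  rw [intervalIntegral.integral_of_le (by linarith [ht.1]), integral_indicator hA]
  simp [measureReal_restrict_apply, hA, Set.inter_comm]

/-- A single measurable set can carry the same fraction of the mass of every level set of a
simple function. -/
theorem MeasureTheory.SimpleFunc.exists_measurableSet_measureReal_inter_preimage {E : Type*} (μ : Measure ℝ)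
    [IsFiniteMeasure μ] [NullSingletonClass μ] (g : SimpleFunc ℝ E) {ρ : ℝ}
    (hρ : ρ ∈ Set.Ioo (0 : ℝ) 1) :
    ∃ Q, MeasurableSet Q ∧ ∀ x, (μ.restrict Q).real (g ⁻¹' {x}) = ρ * μ.real (g ⁻¹' {x}) := by
  choose q hqA hq hμq using fun x =>
    exists_measurableSet_subset_measureReal_eq μ (g.measurableSet_fiber x) hρ
  refine ⟨⋃ y ∈ g.range, q y, Finset.measurableSet_biUnion _ fun y _ => hq y, fun x => ?_⟩
  rw [measureReal_restrict_apply (g.measurableSet_fiber x), ← hμq x]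
  congr 1
  ext s
  simp only [Set.mem_inter_iff, Set.mem_preimage, Set.mem_singleton_iff, Set.mem_iUnion,
    exists_prop]
  constructor
  · rintro ⟨rfl, y, -, hs⟩
    have : g s = y := hqA y hs
    rwa [this]
  · intro hs
    have : g s = x := hqA x hs
    exact ⟨this, x, this ▸ g.mem_range_self s, hs⟩

/-- On a finite atomless measure space on `ℝ`, the integral of an integrable function is
approximated by its rescaled integral over some set carrying a prescribed fraction of the mass. -/
theorem exists_measurableSet_norm_integral_sub_le {E : Type*} [NormedAddCommGroup E]
    [NormedSpace ℝ E] [CompleteSpace E] (μ : Measure ℝ) [IsFiniteMeasure μ]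
    [NullSingletonClass μ] {f : ℝ → E} (hf : Integrable f μ) {ρ : ℝ}
    (hρ : ρ ∈ Set.Ioo (0 : ℝ) 1) {ε : ℝ} (hε : 0 < ε) :
    ∃ Q, MeasurableSet Q ∧ μ.real Q = ρ * μ.real Set.univ ∧
      ‖∫ s, f s ∂μ - ρ⁻¹ • ∫ s in Q, f s ∂μ‖ ≤ ε := by
  have hρ0 : 0 < ρ := hρ.1
  have hc : 0 < 1 + ρ⁻¹ := by positivity
  obtain ⟨g, hg, -⟩ := (memLp_one_iff_integrable.2 hf).exists_simpleFunc_eLpNorm_sub_lt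
    ENNReal.one_ne_top (ε := ENNReal.ofReal (ε / (1 + ρ⁻¹)))
    (ENNReal.ofReal_pos.2 (by positivity)).ne'
  have hgi : ∀ (ν : Measure ℝ) [IsFiniteMeasure ν], Integrable g ν := fun ν _ =>
    g.integrable_of_isFiniteMeasure
  have hfg : Integrable (f - ⇑g) μ := hf.sub (hgi μ)
  rw [eLpNorm_one_eq_lintegral_enorm, ← ofReal_integral_norm_eq_lintegral_enorm hfg,
    ENNReal.ofReal_lt_ofReal_iff (by positivity), lt_div_iff₀ hc] at hg
  obtain ⟨Q, hQ, hQg⟩ := SimpleFunc.exists_measurableSet_measureReal_inter_preimage μ g hρ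
  refine ⟨Q, hQ, ?_, ?_⟩
  · have hsum : ∀ (ν : Measure ℝ) [IsFiniteMeasure ν],
        ∑ y ∈ g.range, ν.real (g ⁻¹' {y}) = ν.real Set.univ := fun ν _ => by
      rw [sum_measureReal_preimage_singleton _ fun y _ => g.measurableSet_fiber y,
        g.coe_range, Set.preimage_range]
    have h := hsum (μ.restrict Q)
    simp_rw [hQg, ← Finset.mul_sum, hsum μ] at h
    simpa using h.symm
  have hg0 : ∫ s in Q, g s ∂μ = ρ • ∫ s, g s ∂μ := by
    rw [g.integral_eq_sum (hgi _), g.integral_eq_sum (hgi _), Finset.smul_sum]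
    simp_rw [hQg, mul_smul]
  have hsplit : ∫ s, f s ∂μ - ρ⁻¹ • ∫ s in Q, f s ∂μ
      = ∫ s, (f - ⇑g) s ∂μ - ρ⁻¹ • ∫ s in Q, (f - ⇑g) s ∂μ := by
    simp only [Pi.sub_apply]
    rw [integral_sub hf (hgi _), integral_sub hf.restrict (hgi _), hg0, smul_sub,
      inv_smul_smul₀ hρ0.ne']
    abel
  have h1 : ‖∫ s, (f - ⇑g) s ∂μ‖ ≤ ∫ s, ‖(f - ⇑g) s‖ ∂μ := norm_integral_le_integral_norm _
  have h2 : ‖∫ s in Q, (f - ⇑g) s ∂μ‖ ≤ ∫ s, ‖(f - ⇑g) s‖ ∂μ :=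
    (norm_integral_le_integral_norm _).trans
      (setIntegral_le_integral hfg.norm (.of_forall fun _ => norm_nonneg _))
  calc _ ≤ ‖∫ s, (f - ⇑g) s ∂μ‖ + ρ⁻¹ * ‖∫ s in Q, (f - ⇑g) s ∂μ‖ := by
        rw [hsplit]
        refine (norm_sub_le _ _).trans_eq ?_
        rw [norm_smul, Real.norm_of_nonneg (by positivity)]
    _ ≤ (∫ s, ‖(f - ⇑g) s‖ ∂μ) + ρ⁻¹ * ∫ s, ‖(f - ⇑g) s‖ ∂μ := by gcongr
    _ ≤ ε := by linarith

/-- For `B ∈ L¹([0,T],ℝ^d)` and `ρ ∈ (0,1)` there is a measurable set `Q_ρ ⊆ [0,T]` with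
`λ(Q_ρ) = ρT` such that `‖∫₀ᵀ (1 - ρ⁻¹ 𝟙_{Q_ρ}(s)) B(s) ds‖ ≤ ρ/2`. -/
theorem stmt_6 (T : ℝ) (hT : 0 < T) (d : ℕ) (hd : 0 < d)
    (B : ℝ → (Fin d → ℝ)) (hB : IntegrableOn B (Set.Icc 0 T))
    (ρ : ℝ) (hρ : ρ ∈ Set.Ioo (0:ℝ) 1) :
    ∃ Q : Set ℝ, MeasurableSet Q ∧ Q ⊆ Set.Icc 0 T ∧
      volume Q = ENNReal.ofReal (ρ * T) ∧
      ‖∫ s in Set.Icc (0:ℝ) T,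
          ((1:ℝ) - ρ⁻¹ * Set.indicator Q (fun _ => (1:ℝ)) s) • B s‖ ≤ ρ / 2 := by
  obtain ⟨Q, hQ, hμQ, hQB⟩ := exists_measurableSet_norm_integral_sub_le
    (volume.restrict (Set.Icc 0 T)) hB hρ (half_pos hρ.1)
  refine ⟨Q ∩ Set.Icc 0 T, hQ.inter measurableSet_Icc, Set.inter_subset_right, ?_, ?_⟩
  · have hfin : volume (Q ∩ Set.Icc 0 T) ≠ ⊤ :=
      measure_ne_top_of_subset Set.inter_subset_right (by simp)
    rw [measureReal_restrict_apply hQ, measureReal_restrict_apply .univ, Set.univ_inter,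
      Real.volume_real_Icc_of_le hT.le, sub_zero] at hμQ
    rw [← hμQ, ofReal_measureReal hfin]
  · refine (congrArg norm ?_).trans_le hQB
    have hQi : Integrable (fun s => ρ⁻¹ • Q.indicator B s) (volume.restrict (Set.Icc 0 T)) :=
      (Integrable.indicator hB hQ).smul ρ⁻¹
    rw [← integral_indicator hQ, ← integral_smul, ← integral_sub hB hQi]
    refine setIntegral_congr_fun measurableSet_Icc fun s hs => ?_
    by_cases h : s ∈ Q <;> simp [h, hs.1, hs.2, sub_smul]
end

section
/- Let (X,‖·‖) be a separable real Banach space with dual X* and dual norm ‖·‖_*. Then there exists a norm N on X equivalent to ‖·‖ such that its dual norm N*, defined by N*(f) = sup{|f(x)| : x ∈ X, N(x) ≤ 1}, is equivalent to ‖·‖_* on X* and is strictly convex: whenever f, g ∈ X* are nonzero and N*(f + g) = N*(f) + N*(g), there exists μ ≥ 0 with f = μ g. -/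
/-- `N : E → ℝ` is a norm on the real vector space `E`. -/
def IsNorm {E : Type*} [AddCommGroup E] [Module ℝ E] (N : E → ℝ) : Prop :=
  (∀ x : E, 0 ≤ N x) ∧ (∀ x : E, N x = 0 ↔ x = 0) ∧
    (∀ (a : ℝ) (x : E), N (a • x) = |a| * N x) ∧
    ∀ x y : E, N (x + y) ≤ N x + N y

open scoped lp

section SumNorm

variable {X H : Type*} [NormedAddCommGroup X] [NormedSpace ℝ X]
  [NormedAddCommGroup H] [InnerProductSpace ℝ H]

/-- The map `(y, a) ↦ y + T a` on the `ℓ²`-sum of `X` and `H`. -/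
noncomputable def sumMap (T : H →L[ℝ] X) : WithLp 2 (X × H) →ₗ[ℝ] X where
  toFun e := e.fst + T e.snd
  map_add' a b := by simp only [WithLp.add_fst, WithLp.add_snd, map_add]; abel
  map_smul' c a := by simp

/-- The norm on `X` as a quotient of the `ℓ²`-sum of `X` and `H` by the kernel of `sumMap T`. -/
noncomputable def sumNorm (T : H →L[ℝ] X) (x : X) : ℝ :=
  ‖(LinearMap.ker (sumMap T)).mkQ (WithLp.toLp 2 (x, 0))‖

theorem sumNorm_add_le_norm (T : H →L[ℝ] X) (y : X) (a : H) :
    sumNorm T (y + T a) ≤ ‖WithLp.toLp 2 (y, a)‖ := by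
  have h : (LinearMap.ker (sumMap T)).mkQ (WithLp.toLp 2 (y + T a, 0)) =
      (LinearMap.ker (sumMap T)).mkQ (WithLp.toLp 2 (y, a)) := by
    rw [Submodule.mkQ_apply, Submodule.mkQ_apply, Submodule.Quotient.eq, LinearMap.mem_ker]
    simp [sumMap]
  rw [sumNorm, h]
  exact Submodule.Quotient.norm_mk_le _ _

theorem exists_add_eq_of_sumNorm_lt (T : H →L[ℝ] X) (x : X) {r : ℝ} (hr : sumNorm T x < r) :
    ∃ (y : X) (a : H), y + T a = x ∧ ‖WithLp.toLp 2 (y, a)‖ < r := by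
  obtain ⟨m, hm, hlt⟩ := Submodule.Quotient.norm_mk_lt
    ((LinearMap.ker (sumMap T)).mkQ (WithLp.toLp 2 (x, 0))) (sub_pos.2 hr)
  refine ⟨m.fst, m.snd, ?_, ?_⟩
  · rw [Submodule.mkQ_apply, Submodule.Quotient.eq, LinearMap.mem_ker, map_sub, sub_eq_zero] at hm
    simpa [sumMap] using hm
  · have : ‖m‖ < r := by rw [sumNorm] at hlt; linarith
    exact this

theorem sumNorm_le_norm (T : H →L[ℝ] X) (x : X) : sumNorm T x ≤ ‖x‖ := by
  simpa using sumNorm_add_le_norm T x 0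

theorem norm_le_mul_sumNorm (T : H →L[ℝ] X) (x : X) : ‖x‖ ≤ (1 + ‖T‖) * sumNorm T x := by
  have hT : 0 < 1 + ‖T‖ := by positivity
  rw [← div_le_iff₀' hT]
  refine le_of_forall_gt_imp_ge_of_dense fun r hr ↦ ?_
  obtain ⟨y, a, rfl, h⟩ := exists_add_eq_of_sumNorm_lt T x hr
  rw [div_le_iff₀' hT]
  have hy : ‖y‖ ≤ ‖WithLp.toLp 2 (y, a)‖ := WithLp.norm_fst_le X (WithLp.toLp 2 (y, a))
  have ha : ‖a‖ ≤ ‖WithLp.toLp 2 (y, a)‖ := WithLp.norm_snd_le X (WithLp.toLp 2 (y, a))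
  calc ‖y + T a‖ ≤ ‖y‖ + ‖T‖ * ‖a‖ := (norm_add_le _ _).trans (by gcongr; exact T.le_opNorm a)
    _ ≤ r + ‖T‖ * r := by gcongr <;> linarith
    _ = (1 + ‖T‖) * r := by ring

theorem isNorm_sumNorm (T : H →L[ℝ] X) : IsNorm (sumNorm T) := by
  refine ⟨fun x ↦ norm_nonneg _, fun x ↦ ⟨fun h ↦ ?_, ?_⟩, fun c x ↦ ?_, fun x y ↦ ?_⟩
  · have := norm_le_mul_sumNorm T x
    rwa [h, mul_zero, norm_le_zero_iff] at this
  · rintro rfl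
    exact le_antisymm (by simpa using sumNorm_le_norm T 0) (norm_nonneg _)
  · have : WithLp.toLp 2 (c • x, (0 : H)) = c • WithLp.toLp 2 (x, (0 : H)) := by
      rw [← WithLp.toLp_smul]; simp
    rw [sumNorm, this, map_smul, norm_smul, Real.norm_eq_abs, sumNorm]
  · have : WithLp.toLp 2 (x + y, (0 : H)) =
        WithLp.toLp 2 (x, (0 : H)) + WithLp.toLp 2 (y, (0 : H)) := by
      rw [← WithLp.toLp_add]; simp
    rw [sumNorm, this, map_add]
    exact norm_add_le _ _

variable [CompleteSpace H]

/-- The vector of `H` representing the functional `f ∘ T`. -/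
noncomputable def rieszPullback (T : H →L[ℝ] X) : (X →L[ℝ] ℝ) →ₗ[ℝ] H where
  toFun f := (InnerProductSpace.toDual ℝ H).symm (f.comp T)
  map_add' f g := by rw [ContinuousLinearMap.add_comp, map_add]
  map_smul' c f := by simp [ContinuousLinearMap.smul_comp]

theorem inner_rieszPullback (T : H →L[ℝ] X) (f : X →L[ℝ] ℝ) (a : H) :
    inner ℝ (rieszPullback T f) a = f (T a) :=
  InnerProductSpace.toDual_symm_apply

theorem norm_rieszPullback_le (T : H →L[ℝ] X) (f : X →L[ℝ] ℝ) :
    ‖rieszPullback T f‖ ≤ ‖f‖ * ‖T‖ :=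
  ((InnerProductSpace.toDual ℝ H).symm.norm_map _).trans_le (f.opNorm_comp_le T)

theorem abs_apply_le_mul_sumNorm (T : H →L[ℝ] X) (f : X →L[ℝ] ℝ) (x : X) :
    |f x| ≤ √(‖f‖ ^ 2 + ‖rieszPullback T f‖ ^ 2) * sumNorm T x := by
  set p := √(‖f‖ ^ 2 + ‖rieszPullback T f‖ ^ 2) with hp
  have hp0 : 0 ≤ p := Real.sqrt_nonneg _
  have key : ∀ r, sumNorm T x < r → |f x| ≤ p * r := fun r hr ↦ by
    obtain ⟨y, a, rfl, h⟩ := exists_add_eq_of_sumNorm_lt T x hr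
    refine le_trans ?_ (mul_le_mul_of_nonneg_left h.le hp0)
    rw [WithLp.prod_norm_eq_of_L2, hp, ← Real.sqrt_mul (by positivity)]
    refine Real.le_sqrt_of_sq_le ?_
    have h1 : |f y| ≤ ‖f‖ * ‖y‖ := f.le_opNorm y
    have h2 : |f (T a)| ≤ ‖rieszPullback T f‖ * ‖a‖ := by
      rw [← inner_rieszPullback]; exact abs_real_inner_le_norm _ _
    have h3 : |f (y + T a)| ≤ ‖f‖ * ‖y‖ + ‖rieszPullback T f‖ * ‖a‖ := by
      rw [map_add]; exact (abs_add_le _ _).trans (add_le_add h1 h2)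
    calc |f (y + T a)| ^ 2 ≤ (‖f‖ * ‖y‖ + ‖rieszPullback T f‖ * ‖a‖) ^ 2 := by gcongr
      _ ≤ (‖f‖ ^ 2 + ‖rieszPullback T f‖ ^ 2) * (‖y‖ ^ 2 + ‖a‖ ^ 2) := by
        nlinarith [sq_nonneg (‖f‖ * ‖a‖ - ‖rieszPullback T f‖ * ‖y‖)]
  refine ge_of_tendsto (x := nhdsWithin (sumNorm T x) (Set.Ioi (sumNorm T x)))
    (f := fun r ↦ p * r) ?_ (Filter.eventually_of_mem self_mem_nhdsWithin key)
  exact ((continuous_const_mul p).tendsto _).mono_left nhdsWithin_le_nhds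

theorem sSup_sumNorm_eq (T : H →L[ℝ] X) (f : X →L[ℝ] ℝ) :
    sSup {r : ℝ | ∃ x : X, sumNorm T x ≤ 1 ∧ |f x| = r} =
      √(‖f‖ ^ 2 + ‖rieszPullback T f‖ ^ 2) := by
  set h := rieszPullback T f with hh
  set p := √(‖f‖ ^ 2 + ‖h‖ ^ 2) with hp
  have hp0 : 0 ≤ p := Real.sqrt_nonneg _
  have hpsq : p ^ 2 = ‖f‖ ^ 2 + ‖h‖ ^ 2 := Real.sq_sqrt (by positivity)
  obtain ⟨-, -, hsmul, -⟩ := isNorm_sumNorm T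
  have hub : ∀ r ∈ {r : ℝ | ∃ x : X, sumNorm T x ≤ 1 ∧ |f x| = r}, r ≤ p := by
    rintro r ⟨x, hx, rfl⟩
    exact (abs_apply_le_mul_sumNorm T f x).trans (mul_le_of_le_one_right hp0 hx)
  have hne : {r : ℝ | ∃ x : X, sumNorm T x ≤ 1 ∧ |f x| = r}.Nonempty :=
    ⟨_, 0, (sumNorm_le_norm T 0).trans (by simp), rfl⟩
  refine le_antisymm (csSup_le hne hub) ?_
  rcases hp0.eq_or_lt with h0 | hpos
  · rw [← h0]
    exact Real.sSup_nonneg (by rintro r ⟨x, -, rfl⟩; exact abs_nonneg _)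
  refine le_of_forall_lt_imp_le_of_dense fun s hs ↦ ?_
  obtain ⟨y, hy, hfy⟩ : ∃ y : X, ‖y‖ ≤ 1 ∧ s * p ≤ ‖f‖ * f y + ‖h‖ ^ 2 := by
    rcases (norm_nonneg f).eq_or_lt with hf | hf
    · refine ⟨0, by simp, ?_⟩
      rw [← hf] at hpsq ⊢
      nlinarith
    · have hlt : (s * p - ‖h‖ ^ 2) / ‖f‖ < ‖f‖ := by
        rw [div_lt_iff₀ hf]; nlinarith
      obtain ⟨y, hy, hlt⟩ := f.exists_lt_apply_of_lt_opNorm hlt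
      rw [div_lt_iff₀ hf, Real.norm_eq_abs] at hlt
      rcases abs_cases (f y) with ⟨e, -⟩ | ⟨e, -⟩
      · exact ⟨y, hy.le, by rw [e] at hlt; linarith⟩
      · exact ⟨-y, by simpa using hy.le, by rw [e] at hlt; rw [map_neg]; linarith⟩
  have hN : sumNorm T (‖f‖ • y + T h) ≤ p := by
    refine (sumNorm_add_le_norm T _ _).trans ?_
    rw [WithLp.prod_norm_eq_of_L2]
    refine Real.sqrt_le_sqrt ?_
    have : ‖‖f‖ • y‖ ≤ ‖f‖ := by
      rw [norm_smul, norm_norm]; exact mul_le_of_le_one_right (norm_nonneg f) hy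
    change ‖‖f‖ • y‖ ^ 2 + ‖h‖ ^ 2 ≤ _
    gcongr
  have hfx : f (‖f‖ • y + T h) = ‖f‖ * f y + ‖h‖ ^ 2 := by
    rw [map_add, map_smul, smul_eq_mul, ← inner_rieszPullback, real_inner_self_eq_norm_sq]
  refine le_trans ?_ (le_csSup ⟨p, hub⟩ ⟨p⁻¹ • (‖f‖ • y + T h), ?_, rfl⟩)
  · rw [map_smul, hfx, smul_eq_mul]
    refine le_trans ?_ (le_abs_self _)
    rw [inv_mul_eq_div, le_div_iff₀ hpos]
    exact hfy
  · rw [hsmul, abs_of_pos (inv_pos.2 hpos), inv_mul_eq_div, div_le_one hpos]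
    exact hN

end SumNorm

/-- Equality in Minkowski's inequality in the plane forces equality in the second
coordinate estimate. -/
theorem eq_add_of_sqrt_sq_add_sq_eq {a b c u v w : ℝ} (hc : 0 ≤ c) (hw : 0 ≤ w)
    (hcab : c ≤ a + b) (hwuv : w ≤ u + v)
    (h : √(c ^ 2 + w ^ 2) = √(a ^ 2 + u ^ 2) + √(b ^ 2 + v ^ 2)) : w = u + v := by
  have h1 := Real.sq_sqrt (show 0 ≤ a ^ 2 + u ^ 2 by positivity)
  have h2 := Real.sq_sqrt (show 0 ≤ b ^ 2 + v ^ 2 by positivity)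
  have h3 := Real.sq_sqrt (show 0 ≤ c ^ 2 + w ^ 2 by positivity)
  have hmul : a * b + u * v ≤ √(a ^ 2 + u ^ 2) * √(b ^ 2 + v ^ 2) := by
    rw [← Real.sqrt_mul (by positivity)]
    refine Real.le_sqrt_of_sq_le ?_
    nlinarith [sq_nonneg (a * v - b * u)]
  rw [h] at h3
  have hc2 : c ^ 2 ≤ (a + b) ^ 2 := by gcongr
  refine le_antisymm hwuv (le_of_sq_le_sq ?_ hw)
  nlinarith

/-- A separable normed space admits an operator from `ℓ²` whose adjoint is injective. -/
theorem exists_lp_two_map_separating (X : Type*) [NormedAddCommGroup X] [NormedSpace ℝ X]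
    [CompleteSpace X] [TopologicalSpace.SeparableSpace X] :
    ∃ T : ℓ²(ℕ, ℝ) →L[ℝ] X, ∀ f : X →L[ℝ] ℝ, (∀ a, f (T a) = 0) → f = 0 := by
  let d : ℕ → X := TopologicalSpace.denseSeq X
  let u : ℕ → X := fun n ↦ ((1 / 2 : ℝ) ^ n / (1 + ‖d n‖)) • d n
  have hu : ∀ n, ‖u n‖ ≤ (1 / 2 : ℝ) ^ n := fun n ↦ by
    have : 0 < 1 + ‖d n‖ := by positivity
    rw [norm_smul, Real.norm_of_nonneg (by positivity), div_mul_eq_mul_div, div_le_iff₀ this]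
    gcongr
    linarith
  have hbound : ∀ (a : ℓ²(ℕ, ℝ)) n, ‖a n • u n‖ ≤ ‖a‖ * (1 / 2 : ℝ) ^ n := fun a n ↦ by
    rw [norm_smul]
    gcongr
    · exact lp.norm_apply_le_norm (by norm_num) a n
    · exact hu n
  have hsum : ∀ a : ℓ²(ℕ, ℝ), Summable fun n ↦ a n • u n := fun a ↦
    Summable.of_norm_bounded (summable_geometric_two.mul_left ‖a‖) (hbound a)
  let L : ℓ²(ℕ, ℝ) →ₗ[ℝ] X :=
    { toFun := fun a ↦ ∑' n, a n • u n
      map_add' := fun a b ↦ by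
        rw [← (hsum a).tsum_add (hsum b)]
        simp [add_smul]
      map_smul' := fun c a ↦ by
        rw [RingHom.id_apply, ← (hsum a).tsum_const_smul c]
        simp [mul_smul] }
  refine ⟨L.mkContinuous 2 fun a ↦ ?_, fun f hf ↦ ?_⟩
  · refine tsum_of_norm_bounded ?_ (hbound a)
    rw [mul_comm 2]
    exact hasSum_geometric_two.mul_left ‖a‖
  · have hd : ∀ n, f (d n) = 0 := fun n ↦ by
      have h := hf (lp.single 2 n 1)
      have hL : L (lp.single 2 n 1) = u n := by
        change ∑' m, (lp.single 2 n (1 : ℝ) : ℓ²(ℕ, ℝ)) m • u m = u n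
        rw [tsum_eq_single n fun m hm ↦ by rw [lp.single_apply_ne _ _ _ hm, zero_smul],
          lp.single_apply_self, one_smul]
      rw [LinearMap.mkContinuous_apply, hL, map_smul, smul_eq_mul] at h
      have : 0 < 1 + ‖d n‖ := by positivity
      exact (mul_eq_zero.1 h).resolve_left (by positivity)
    refine ContinuousLinearMap.ext fun x ↦ ?_
    exact congrFun ((TopologicalSpace.denseRange_denseSeq X).equalizer f.continuous
      continuous_const (funext hd)) x

/-- On a separable real Banach space `X` there is a norm `N` equivalent to `‖·‖` whose dual
norm `N*(f) = sup {|f x| : N x ≤ 1}` is equivalent to the dual norm `‖·‖_*` on `X*` and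
is strictly convex: whenever `f, g ∈ X*` are nonzero and `N*(f + g) = N*(f) + N*(g)`,
there exists `μ ≥ 0` with `f = μ g`. -/
theorem stmt_8 (X : Type*) [NormedAddCommGroup X] [NormedSpace ℝ X] [CompleteSpace X]
    [TopologicalSpace.SeparableSpace X] :
    ∃ N : X → ℝ, IsNorm N ∧
      (∃ d₁ d₂ : ℝ, 0 < d₁ ∧ 0 < d₂ ∧ ∀ x : X, d₁ * ‖x‖ ≤ N x ∧ N x ≤ d₂ * ‖x‖) ∧
      (∃ c₁ c₂ : ℝ, 0 < c₁ ∧ 0 < c₂ ∧ ∀ f : X →L[ℝ] ℝ,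
        c₁ * ‖f‖ ≤ sSup {r : ℝ | ∃ x : X, N x ≤ 1 ∧ |f x| = r} ∧
        sSup {r : ℝ | ∃ x : X, N x ≤ 1 ∧ |f x| = r} ≤ c₂ * ‖f‖) ∧
      ∀ f g : X →L[ℝ] ℝ, f ≠ 0 → g ≠ 0 →
        sSup {r : ℝ | ∃ x : X, N x ≤ 1 ∧ |(f + g) x| = r} =
          sSup {r : ℝ | ∃ x : X, N x ≤ 1 ∧ |f x| = r} +
          sSup {r : ℝ | ∃ x : X, N x ≤ 1 ∧ |g x| = r} →
        ∃ μ : ℝ, 0 ≤ μ ∧ f = μ • g := by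
  obtain ⟨T, hT⟩ := exists_lp_two_map_separating X
  have hpos : 0 < 1 + ‖T‖ := by positivity
  refine ⟨sumNorm T, isNorm_sumNorm T, ⟨(1 + ‖T‖)⁻¹, 1, by positivity, one_pos, fun x ↦ ⟨?_, ?_⟩⟩,
    ⟨1, 1 + ‖T‖, one_pos, hpos, fun f ↦ ?_⟩, fun f g hf hg h ↦ ?_⟩
  · rw [inv_mul_le_iff₀ hpos]
    exact norm_le_mul_sumNorm T x
  · rw [one_mul]
    exact sumNorm_le_norm T x
  · rw [sSup_sumNorm_eq, one_mul]
    have h := norm_rieszPullback_le T f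
    refine ⟨Real.le_sqrt_of_sq_le (by simp), Real.sqrt_le_iff.2 ⟨by positivity, ?_⟩⟩
    have := pow_le_pow_left₀ (norm_nonneg _) h 2
    nlinarith [mul_nonneg (norm_nonneg T) (sq_nonneg ‖f‖)]
  · rw [sSup_sumNorm_eq, sSup_sumNorm_eq, sSup_sumNorm_eq] at h
    have hker : ∀ k : X →L[ℝ] ℝ, rieszPullback T k = 0 → k = 0 := fun k hk ↦
      hT k fun a ↦ by rw [← inner_rieszPullback, hk, inner_zero_left]
    have heq := eq_add_of_sqrt_sq_add_sq_eq (norm_nonneg (f + g)) (norm_nonneg _)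
      (norm_add_le f g)
      ((congrArg norm (map_add (rieszPullback T) f g)).trans_le (norm_add_le _ _)) h
    rw [map_add, ← sameRay_iff_norm_add] at heq
    obtain ⟨μ, hμ, hfg⟩ := heq.exists_nonneg_right (mt (hker g) hg)
    refine ⟨μ, hμ, sub_eq_zero.1 (hker _ ?_)⟩
    rw [map_sub, map_smul, hfg, sub_self]
end

section
/- Let X be a real normed vector space and let φ : X → ℝ be convex and continuous. Then for every x ∈ X the subdifferential ∂φ(x) is nonempty: there exists a continuous linear functional f ∈ X* such that f(y − x) ≤ φ(y) − φ(x) for every y ∈ X. -/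
/-- A convex continuous function `φ : X → ℝ` on a real normed vector space has a nonempty
subdifferential at every point: there exists a continuous linear functional `f ∈ X*` with
`f(y − x) ≤ φ(y) − φ(x)` for every `y ∈ X`. -/
theorem stmt_9 (X : Type*) [NormedAddCommGroup X] [NormedSpace ℝ X]
    (φ : X → ℝ) (hconv : ConvexOn ℝ Set.univ φ) (hcont : Continuous φ) (x : X) :
    ∃ f : X →L[ℝ] ℝ, ∀ y : X, f (y - x) ≤ φ y - φ x := by
  have hconvex : Convex ℝ {p : X × ℝ | φ p.1 < p.2} := by
    simpa using hconv.convex_strict_epigraph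
  have hopen : IsOpen {p : X × ℝ | φ p.1 < p.2} :=
    isOpen_lt (hcont.comp continuous_fst) continuous_snd
  obtain ⟨g, hg⟩ := geometric_hahn_banach_open_point (x := (x, φ x)) hconvex hopen (by simp)
  have hsplit (v : X) (t : ℝ) : g (v, t) = g (v, 0) + t * g (0, 1) := by
    rw [← smul_eq_mul, ← map_smul, ← map_add]
    simp
  have hneg : g (0, 1) < 0 := by
    have h := hg (x, φ x + 1) (by simp)
    rw [hsplit x (φ x + 1), hsplit x (φ x)] at h
    linarith
  refine ⟨(-g (0, 1))⁻¹ • g.comp (ContinuousLinearMap.inl ℝ X ℝ), fun y ↦ ?_⟩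
  rw [le_sub_iff_add_le]
  refine le_of_forall_gt_imp_ge_of_dense fun t ht ↦ ?_
  have h := hg (y, t) ht
  rw [hsplit y t, hsplit x (φ x)] at h
  have hsub : g (y - x, 0) = g (y, 0) - g (x, 0) := by
    rw [← map_sub]
    simp
  rw [← le_sub_iff_add_le]
  simp only [smul_apply, ContinuousLinearMap.comp_apply,
    ContinuousLinearMap.inl_apply, smul_eq_mul, hsub]
  rw [inv_mul_le_iff₀ (neg_pos.mpr hneg)]
  linarith
end

section
/- Let X be a real normed vector space, let S ⊂ X be a nonempty closed convex set, and let d_S : X → ℝ be the distance function d_S(x) = inf{‖x − z‖ : z ∈ S}. Then for every x ∈ X \ S the subdifferential ∂d_S(x) is nonempty and contained in the unit sphere of X*: there exists f ∈ X* with f(y − x) ≤ d_S(y) − d_S(x) for all y ∈ X, and every such f satisfies ‖f‖_* = 1. -/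
/-- A functional bounded above by `c` on the open ball of radius `r` about `z` satisfies
`r * ‖f‖ ≤ c - f z`. -/
theorem ContinuousLinearMap.mul_opNorm_le_of_forall_ball {X : Type*} [NormedAddCommGroup X]
    [NormedSpace ℝ X] (f : X →L[ℝ] ℝ) {z : X} {r c : ℝ} (hr : 0 < r)
    (h : ∀ a, dist a z < r → f a ≤ c) : r * ‖f‖ ≤ c - f z := by
  rw [← le_div_iff₀' hr]
  refine le_of_forall_lt_imp_le_of_dense fun t ht => ?_
  obtain ⟨u, hu, htu⟩ := f.exists_lt_apply_of_lt_opNorm ht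
  have hru : r * ‖u‖ < r := by nlinarith
  have h₁ := h (z + r • u) (by simpa [dist_eq_norm, norm_smul, abs_of_pos hr] using hru)
  have h₂ := h (z - r • u) (by simpa [dist_eq_norm, norm_smul, abs_of_pos hr] using hru)
  simp only [map_add, map_sub, map_smul, smul_eq_mul] at h₁ h₂
  refine htu.le.trans ?_
  rw [le_div_iff₀' hr, Real.norm_eq_abs]
  rcases abs_cases (f u) with ⟨h, -⟩ | ⟨h, -⟩ <;> rw [h] <;> linarith

/-- For a nonempty closed convex set `S` in a real normed vector space `X` and a point
`x ∉ S`, the subdifferential of the distance function `d_S` at `x` is nonempty and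
contained in the unit sphere of `X*`: there exists a subgradient `f` of `d_S` at `x`,
and every such subgradient satisfies `‖f‖_* = 1`. -/
theorem stmt_12 (X : Type*) [NormedAddCommGroup X] [NormedSpace ℝ X]
    (S : Set X) (hS : S.Nonempty) (hSclosed : IsClosed S) (hSconv : Convex ℝ S)
    (x : X) (hx : x ∉ S) :
    (∃ f : X →L[ℝ] ℝ, ∀ y : X, f (y - x) ≤ Metric.infDist y S - Metric.infDist x S) ∧
      ∀ f : X →L[ℝ] ℝ,
        (∀ y : X, f (y - x) ≤ Metric.infDist y S - Metric.infDist x S) → ‖f‖ = 1 := by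
  have hD : 0 < Metric.infDist x S := (hSclosed.notMem_iff_infDist_pos hS).1 hx
  refine ⟨?_, fun f hf => le_antisymm ?_ ?_⟩
  · have hxT : x ∉ Metric.thickening (Metric.infDist x S) S := by
      rw [Metric.mem_thickening_iff]
      rintro ⟨z, hz, hlt⟩
      exact hlt.not_ge (Metric.infDist_le_dist_of_mem hz)
    obtain ⟨f, hf⟩ := geometric_hahn_banach_open_point
      (hSconv.thickening (Metric.infDist x S)) Metric.isOpen_thickening hxT
    have hbound : ∀ z ∈ S, Metric.infDist x S * ‖f‖ ≤ f x - f z := fun z hz =>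
      f.mul_opNorm_le_of_forall_ball hD fun a ha =>
        (hf a (Metric.mem_thickening_iff.2 ⟨z, hz, ha⟩)).le
    have hf0 : 0 < ‖f‖ := by
      obtain ⟨z, hz⟩ := hS
      have hlt := hf z (Metric.self_subset_thickening hD S hz)
      refine norm_pos_iff.2 ?_
      rintro rfl
      simp at hlt
    refine ⟨‖f‖⁻¹ • f, fun y => ?_⟩
    rw [le_sub_iff_add_le, Metric.le_infDist hS]
    intro z hz
    have hyz : f y - f z ≤ ‖f‖ * dist y z := by
      rw [← map_sub, dist_eq_norm]
      exact (le_abs_self _).trans (f.le_opNorm _)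
    have hz' := hbound z hz
    rw [smul_apply, smul_eq_mul, ← le_sub_iff_add_le, inv_mul_le_iff₀ hf0, map_sub]
    linarith
  · refine f.opNorm_le_bound zero_le_one fun v => ?_
    have key : ∀ w : X, f w ≤ ‖w‖ := fun w => by
      have h₁ := hf (x + w)
      have h₂ := Metric.infDist_le_infDist_add_dist (s := S) (x := x + w) (y := x)
      simp only [add_sub_cancel_left, dist_self_add_left] at h₁ h₂
      linarith
    have h₁ := key v
    have h₂ := key (-v)
    rw [map_neg, norm_neg] at h₂
    rw [one_mul, Real.norm_eq_abs]
    exact abs_le.2 ⟨by linarith, h₁⟩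
  · have key : ∀ z ∈ S, Metric.infDist x S ≤ ‖f‖ * dist x z := fun z hz => by
      have h₁ := hf z
      have h₂ := (le_abs_self _).trans (f.le_opNorm (x - z))
      rw [Metric.infDist_zero_of_mem hz, map_sub] at h₁
      rw [map_sub] at h₂
      rw [dist_eq_norm]
      linarith
    have hf0 : 0 < ‖f‖ := by
      obtain ⟨z, hz⟩ := hS
      exact pos_of_mul_pos_left (hD.trans_le (key z hz)) dist_nonneg
    have hdiv : Metric.infDist x S / ‖f‖ ≤ Metric.infDist x S :=
      (Metric.le_infDist hS).2 fun z hz => (div_le_iff₀' hf0).2 (key z hz)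
    rw [div_le_iff₀ hf0] at hdiv
    exact (le_mul_iff_one_le_right hD).1 hdiv
end

section
/- Let X be a real normed vector space whose dual norm ‖·‖_* is strictly convex on X* (whenever f, g ∈ X* are nonzero and ‖f + g‖_* = ‖f‖_* + ‖g‖_*, there exists μ ≥ 0 with f = μg). Let S ⊂ X be a nonempty closed convex set and let d_S(x) = inf{‖x − z‖ : z ∈ S}. Then for every x ∈ X \ S there is exactly one f ∈ X* satisfying f(y − x) ≤ d_S(y) − d_S(x) for all y ∈ X, and this unique subgradient satisfies ‖f‖_* = 1. -/
open Metric

section InfDistSubgradient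

variable {X : Type*} [NormedAddCommGroup X] [NormedSpace ℝ X] {S : Set X} {x : X}

/-- Every subgradient of the distance function at a point off the closure has norm one. -/
theorem norm_eq_one_of_infDist_subgradient (hS : S.Nonempty) (hd : 0 < infDist x S)
    {f : X →L[ℝ] ℝ} (hf : ∀ y, f (y - x) ≤ infDist y S - infDist x S) : ‖f‖ = 1 := by
  have hle : ∀ v, f v ≤ ‖v‖ := fun v => by
    have h := hf (x + v)
    have h' : infDist (x + v) S ≤ infDist x S + dist (x + v) x := infDist_le_infDist_add_dist
    rw [dist_eq_norm, add_sub_cancel_left] at h'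
    rw [add_sub_cancel_left] at h
    linarith
  apply le_antisymm
  · refine f.opNorm_le_bound zero_le_one fun v => ?_
    rw [one_mul, Real.norm_eq_abs, abs_le']
    refine ⟨hle v, ?_⟩
    simpa using hle (-v)
  · by_contra! hlt
    obtain ⟨s, hs, hxs⟩ : ∃ s ∈ S, ‖f‖ * dist x s < infDist x S := by
      rcases (norm_nonneg f).eq_or_lt with h0 | hpos
      · obtain ⟨s, hs⟩ := hS
        exact ⟨s, hs, by simpa [← h0] using hd⟩
      · obtain ⟨s, hs, h⟩ := (infDist_lt_iff hS).1
          ((lt_div_iff₀ hpos).2 (by nlinarith) : infDist x S < infDist x S / ‖f‖)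
        exact ⟨s, hs, by rwa [lt_div_iff₀' hpos] at h⟩
    have h := hf s
    rw [infDist_zero_of_mem hs] at h
    have h' := (le_abs_self _).trans (f.le_opNorm (x - s))
    rw [← dist_eq_norm] at h'
    rw [← neg_sub, map_neg] at h
    linarith

/-- The distance function to a convex set has a subgradient at each point off the closure. -/
theorem exists_infDist_subgradient (hS : S.Nonempty) (hconv : Convex ℝ S)
    (hd : 0 < infDist x S) :
    ∃ f : X →L[ℝ] ℝ, ∀ y, f (y - x) ≤ infDist y S - infDist x S := by
  obtain ⟨f, u, hball, hSu⟩ := geometric_hahn_banach_open (convex_ball x (infDist x S))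
    isOpen_ball hconv disjoint_ball_infDist
  have hc : 0 < u - f x := sub_pos.2 (hball x (mem_ball_self hd))
  have hbound : ∀ v, infDist x S / (u - f x) * f v ≤ ‖v‖ := fun v => by
    refine le_of_forall_gt_imp_ge_of_dense fun r hr => ?_
    have hr0 : 0 < r := (norm_nonneg v).trans_lt hr
    have h := hball (x + (infDist x S / r) • v) (by
      rw [mem_ball, dist_eq_norm, add_sub_cancel_left, norm_smul, Real.norm_eq_abs,
        abs_of_pos (div_pos hd hr0), div_mul_eq_mul_div, div_lt_iff₀ hr0]
      exact mul_lt_mul_of_pos_left hr hd)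
    rw [map_add, map_smul, smul_eq_mul, ← lt_sub_iff_add_lt', div_mul_eq_mul_div,
      div_lt_iff₀ hr0] at h
    rw [div_mul_eq_mul_div, div_le_iff₀ hc]
    linarith
  refine ⟨-((infDist x S / (u - f x)) • f), fun y => ?_⟩
  rw [le_sub_iff_add_le, le_infDist hS]
  intro s hs
  have h₁ := hbound (s - y)
  have h₂ : infDist x S ≤ infDist x S / (u - f x) * (f s - f x) := by
    rw [div_mul_eq_mul_div, le_div_iff₀ hc]
    exact mul_le_mul_of_nonneg_left (by linarith [hSu s hs]) hd.le
  rw [dist_comm, dist_eq_norm]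
  simp only [neg_apply, smul_apply, smul_eq_mul, map_sub] at h₁ ⊢
  linarith

end InfDistSubgradient

/-- Suppose the dual norm of the real normed vector space `X` is strictly convex: whenever
`f, g ∈ X*` are nonzero and `‖f + g‖_* = ‖f‖_* + ‖g‖_*` there exists `μ ≥ 0` with
`f = μ g`. Then for every nonempty closed convex `S ⊆ X` and every `x ∈ X \ S` there is
exactly one subgradient `f ∈ X*` of the distance function `d_S` at `x`, i.e. exactly one
`f` with `f(y − x) ≤ d_S(y) − d_S(x)` for all `y`, and it satisfies `‖f‖_* = 1`. -/
theorem stmt_13 (X : Type*) [NormedAddCommGroup X] [NormedSpace ℝ X]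
    (hstrict : ∀ f g : X →L[ℝ] ℝ, f ≠ 0 → g ≠ 0 → ‖f + g‖ = ‖f‖ + ‖g‖ →
      ∃ μ : ℝ, 0 ≤ μ ∧ f = μ • g)
    (S : Set X) (hS : S.Nonempty) (hSclosed : IsClosed S) (hSconv : Convex ℝ S)
    (x : X) (hx : x ∉ S) :
    ∃ f : X →L[ℝ] ℝ,
      (∀ y : X, f (y - x) ≤ Metric.infDist y S - Metric.infDist x S) ∧ ‖f‖ = 1 ∧
      ∀ g : X →L[ℝ] ℝ,
        (∀ y : X, g (y - x) ≤ Metric.infDist y S - Metric.infDist x S) → g = f := by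
  have hd : 0 < Metric.infDist x S := (hSclosed.notMem_iff_infDist_pos hS).1 hx
  obtain ⟨f, hf⟩ := exists_infDist_subgradient hS hSconv hd
  have hf1 := norm_eq_one_of_infDist_subgradient hS hd hf
  refine ⟨f, hf, hf1, fun g hg => ?_⟩
  have hg1 := norm_eq_one_of_infDist_subgradient hS hd hg
  have hmid : ‖(2⁻¹ : ℝ) • (g + f)‖ = 1 :=
    norm_eq_one_of_infDist_subgradient hS hd fun y => by
      have h₁ := hf y
      have h₂ := hg y
      simp only [smul_apply, add_apply, smul_eq_mul]
      linarith
  have hsum : ‖g + f‖ = ‖g‖ + ‖f‖ := by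
    rw [norm_smul, Real.norm_of_nonneg (by norm_num)] at hmid
    linarith
  obtain ⟨μ, hμ, rfl⟩ := hstrict g f (norm_ne_zero_iff.1 (by simp [hg1]))
    (norm_ne_zero_iff.1 (by simp [hf1])) hsum
  rw [norm_smul, hf1, mul_one, Real.norm_of_nonneg hμ] at hg1
  rw [hg1, one_smul]
end

section
/- Let A ∈ L^∞([0,T],ℝ^{n×n}), let μ₁,…,μ_j be finite nonnegative Borel measures on [0,T], let B₁,…,B_j : [0,T] → ℝ^n be continuous, and let q₀ ∈ ℝ^n. Then there exists a unique bounded measurable function q : [0,T] → ℝ^n satisfying the forward linear Cauchy–Stieltjes integral equation q(t) = q₀ + ∫₀ᵗ A(τ) · q(τ) dτ + Σᵢ₌₁ʲ ∫_{[0,t)} B_i dμ_i for every t ∈ [0,T]. Similarly, for any p_T ∈ ℝ^n there exists a unique bounded measurable p : [0,T] → ℝ^n satisfying the backward equation p(t) = p_T + ∫ₜᵀ A(τ)ᵀ · p(τ) dτ + Σᵢ₌₁ʲ ∫_{[t,T)} B_i dμ_i for every t ∈ [0,T]. -/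
open MeasureTheory Matrix

attribute [local instance] Matrix.normedAddCommGroup Matrix.normedSpace

open Set Filter Topology
open scoped Nat

/-- A set integral over a jointly measurable family of sets depends measurably on the parameter. -/
theorem stronglyMeasurable_setIntegral {α β E : Type*} [MeasurableSpace α] [MeasurableSpace β]
    [NormedAddCommGroup E] [NormedSpace ℝ E] {μ : Measure β} [SFinite μ] {f : β → E}
    (hf : StronglyMeasurable f) {S : α → Set β}
    (hS : MeasurableSet {x : α × β | x.2 ∈ S x.1}) :
    StronglyMeasurable fun a => ∫ b in S a, f b ∂μ := by
  have hSa (a : α) : MeasurableSet (S a) := measurable_prodMk_left hS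
  have h : StronglyMeasurable fun x : α × β => (S x.1).indicator f x.2 :=
    (hf.comp_measurable measurable_snd).indicator hS
  simpa only [integral_indicator (hSa _)] using
    StronglyMeasurable.integral_prod_right (ν := μ) (f := fun a => (S a).indicator f) h

section Volterra

variable {E : Type*} [NormedAddCommGroup E] [NormedSpace ℝ E]
  {L : ℝ → E →L[ℝ] E} {f g : ℝ → E} {T K C : ℝ}

theorem stronglyMeasurable_clm_apply (hL : StronglyMeasurable L) (hf : StronglyMeasurable f) :
    StronglyMeasurable fun τ => L τ (f τ) :=
  (isBoundedBilinearMap_apply (𝕜 := ℝ) (E := E) (F := E)).continuous.comp_stronglyMeasurable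
    (hL.prodMk hf)

theorem stronglyMeasurable_intervalIntegral (hf : StronglyMeasurable f) (a : ℝ) :
    StronglyMeasurable fun t => ∫ τ in a..t, f τ := by
  refine (stronglyMeasurable_setIntegral hf ?_).sub (stronglyMeasurable_setIntegral hf ?_)
  · exact (measurableSet_lt measurable_const measurable_snd).inter
      (measurableSet_le measurable_snd measurable_fst)
  · exact (measurableSet_lt measurable_fst measurable_snd).inter
      (measurableSet_le measurable_snd measurable_const)

theorem ae_norm_clm_apply_le {B : ℝ → ℝ} (hLK : ∀ᵐ τ ∂(volume.restrict (Icc 0 T)), ‖L τ‖ ≤ K)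
    (hf : ∀ τ ∈ Icc 0 T, ‖f τ‖ ≤ B τ) :
    ∀ᵐ τ, τ ∈ Icc 0 T → ‖L τ (f τ)‖ ≤ K * B τ := by
  rw [ae_restrict_iff' measurableSet_Icc] at hLK
  filter_upwards [hLK] with τ hτ hmem
  exact (L τ).le_of_opNorm_le_of_le (hτ hmem) (hf τ hmem)

theorem intervalIntegrable_clm_apply (hL : StronglyMeasurable L)
    (hLK : ∀ᵐ τ ∂(volume.restrict (Icc 0 T)), ‖L τ‖ ≤ K)
    (hf : StronglyMeasurable f) (hfC : ∀ τ ∈ Icc 0 T, ‖f τ‖ ≤ C) {t : ℝ} (ht : t ∈ Icc 0 T) :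
    IntervalIntegrable (fun τ => L τ (f τ)) volume 0 t := by
  rw [intervalIntegrable_iff_integrableOn_Ioc_of_le ht.1]
  refine Measure.integrableOn_of_bounded (M := K * C) (by simp)
    (stronglyMeasurable_clm_apply hL hf).aestronglyMeasurable ?_
  rw [ae_restrict_iff' measurableSet_Ioc]
  filter_upwards [ae_norm_clm_apply_le hLK hfC] with τ h hτ
  exact h ⟨hτ.1.le, hτ.2.trans ht.2⟩

/-- One Volterra integration improves a bound of order `k` in the exponential series to one of
order `k + 1`. -/
theorem norm_volterra_le (hLK : ∀ᵐ τ ∂(volume.restrict (Icc 0 T)), ‖L τ‖ ≤ K) (k : ℕ)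
    (hf : ∀ τ ∈ Icc 0 T, ‖f τ‖ ≤ C * ((K * τ) ^ k / k !)) {t : ℝ} (ht : t ∈ Icc 0 T) :
    ‖∫ τ in (0 : ℝ)..t, L τ (f τ)‖ ≤ C * ((K * t) ^ (k + 1) / (k + 1)!) := by
  have hcont : Continuous fun τ : ℝ => K * (C * ((K * τ) ^ k / k !)) := by fun_prop
  refine (intervalIntegral.norm_integral_le_of_norm_le ht.1 ?_
    (hcont.intervalIntegrable 0 t)).trans_eq ?_
  · filter_upwards [ae_norm_clm_apply_le hLK hf] with τ h hτ
    exact h ⟨hτ.1.le, hτ.2.trans ht.2⟩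
  · have : (fun τ : ℝ => K * (C * ((K * τ) ^ k / k !))) =
        fun τ => (C * K ^ (k + 1) / k !) * τ ^ k := by
      ext τ; rw [mul_pow]; ring
    rw [this, intervalIntegral.integral_const_mul, integral_pow, Nat.factorial_succ]
    push_cast
    field_simp
    ring

/-- The terms of the Neumann series of a Volterra equation on `[0, T]` with kernel `L` and
forcing `g`, extended by zero. -/
noncomputable def volterraTerm (L : ℝ → E →L[ℝ] E) (g : ℝ → E) (T : ℝ) : ℕ → ℝ → E
  | 0 => (Icc 0 T).indicator g
  | k + 1 => (Icc 0 T).indicator fun t => ∫ τ in (0 : ℝ)..t, L τ (volterraTerm L g T k τ)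

theorem stronglyMeasurable_volterraTerm (hL : StronglyMeasurable L) (hg : StronglyMeasurable g) :
    ∀ k, StronglyMeasurable (volterraTerm L g T k)
  | 0 => hg.indicator measurableSet_Icc
  | k + 1 => (stronglyMeasurable_intervalIntegral (stronglyMeasurable_clm_apply hL
      (stronglyMeasurable_volterraTerm hL hg k)) 0).indicator measurableSet_Icc

theorem norm_volterraTerm_le (hLK : ∀ᵐ τ ∂(volume.restrict (Icc 0 T)), ‖L τ‖ ≤ K)
    (hg : ∀ t ∈ Icc 0 T, ‖g t‖ ≤ C) (k : ℕ) :
    ∀ t ∈ Icc 0 T, ‖volterraTerm L g T k t‖ ≤ C * ((K * t) ^ k / k !) := by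
  induction k with
  | zero => intro t ht; simpa [volterraTerm, ht] using hg t ht
  | succ k ih =>
    intro t ht
    rw [volterraTerm, indicator_of_mem ht]
    exact norm_volterra_le hLK k ih ht

theorem volterra_eq_zero (hLK : ∀ᵐ τ ∂(volume.restrict (Icc 0 T)), ‖L τ‖ ≤ K)
    (hf : ∀ t ∈ Icc 0 T, ‖f t‖ ≤ C)
    (hfeq : ∀ t ∈ Icc 0 T, f t = ∫ τ in (0 : ℝ)..t, L τ (f τ)) :
    ∀ t ∈ Icc 0 T, f t = 0 := by
  have hbound (k : ℕ) : ∀ t ∈ Icc 0 T, ‖f t‖ ≤ C * ((K * t) ^ k / k !) := by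
    induction k with
    | zero => simpa using hf
    | succ k ih =>
      intro t ht
      rw [hfeq t ht]
      exact norm_volterra_le hLK k ih ht
  intro t ht
  have hlim := (FloorSemiring.tendsto_pow_div_factorial_atTop (K * t)).const_mul C
  rw [mul_zero] at hlim
  exact norm_le_zero_iff.1 (ge_of_tendsto' hlim fun k => hbound k t ht)

/-- A linear Volterra equation with essentially bounded measurable kernel and bounded measurable
forcing has a unique bounded measurable solution. -/
theorem existsUnique_volterra [CompleteSpace E] (hL : StronglyMeasurable L)
    (hLK : ∀ᵐ τ ∂(volume.restrict (Icc 0 T)), ‖L τ‖ ≤ K)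
    (hg : StronglyMeasurable g) (hgC : ∀ t ∈ Icc 0 T, ‖g t‖ ≤ C) :
    ∃ q : ℝ → E, (StronglyMeasurable q ∧ ∃ M : ℝ, ∀ t ∈ Icc 0 T, ‖q t‖ ≤ M) ∧
      (∀ t ∈ Icc 0 T, q t = g t + ∫ τ in (0 : ℝ)..t, L τ (q τ)) ∧
      ∀ q' : ℝ → E, (StronglyMeasurable q' ∧ ∃ M : ℝ, ∀ t ∈ Icc 0 T, ‖q' t‖ ≤ M) →
        (∀ t ∈ Icc 0 T, q' t = g t + ∫ τ in (0 : ℝ)..t, L τ (q' τ)) →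
        ∀ t ∈ Icc 0 T, q' t = q t := by
  wlog hK : 0 ≤ K generalizing K
  · exact this (K := max K 0) (hLK.mono fun τ h => h.trans (le_max_left _ _)) (le_max_right _ _)
  set z := volterraTerm L g T with hz
  have hzmeas : ∀ k, StronglyMeasurable (z k) := stronglyMeasurable_volterraTerm hL hg
  have hzle (k : ℕ) : ∀ t ∈ Icc 0 T, ‖z k t‖ ≤ C * ((K * T) ^ k / k !) := fun t ht => by
    have hC : 0 ≤ C := (norm_nonneg _).trans (hgC t ht)
    refine (norm_volterraTerm_le hLK hgC k t ht).trans ?_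
    have := ht.1
    gcongr
    exact ht.2
  have hbsum : Summable fun k : ℕ => C * ((K * T) ^ k / k !) :=
    (Real.summable_pow_div_factorial (K * T)).mul_left C
  have hzsum (t : ℝ) : Summable fun k => z k t := by
    by_cases ht : t ∈ Icc 0 T
    · exact .of_norm_bounded hbsum fun k => hzle k t ht
    · convert! summable_zero with k
      cases k <;> simp only [hz, volterraTerm, indicator_of_notMem ht]
  have hqmeas : StronglyMeasurable fun t => ∑' k, z k t :=
    stronglyMeasurable_of_tendsto atTop
      (fun N => Finset.stronglyMeasurable_sum (Finset.range N) fun k _ => hzmeas k)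
      (tendsto_pi_nhds.2 fun t => by simpa using (hzsum t).hasSum.tendsto_sum_nat)
  have hqle : ∀ t ∈ Icc 0 T, ‖∑' k, z k t‖ ≤ ∑' k : ℕ, C * ((K * T) ^ k / k !) := fun t ht =>
    tsum_of_norm_bounded hbsum.hasSum fun k => hzle k t ht
  have hqeq : ∀ t ∈ Icc 0 T,
      ∑' k, z k t = g t + ∫ τ in (0 : ℝ)..t, L τ (∑' k, z k τ) := fun t ht => by
    rw [(hzsum t).tsum_eq_zero_add]
    have h0 : z 0 t = g t := by simp only [hz, volterraTerm, indicator_of_mem ht]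
    have hsucc (k : ℕ) : z (k + 1) t = ∫ τ in (0 : ℝ)..t, L τ (z k τ) := by
      simp only [hz, volterraTerm, indicator_of_mem ht]
    rw [h0]
    simp only [hsucc]
    congr 1
    refine (intervalIntegral.hasSum_integral_of_dominated_convergence
      (fun k _ => K * (C * ((K * T) ^ k / k !)))
      (fun k => (stronglyMeasurable_clm_apply hL (hzmeas k)).aestronglyMeasurable) (fun k => ?_)
      (.of_forall fun _ _ => hbsum.mul_left K) intervalIntegrable_const
      (.of_forall fun τ _ => (L τ).hasSum (hzsum τ).hasSum)).tsum_eq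
    filter_upwards [ae_norm_clm_apply_le hLK (hzle k)] with τ h hτ
    rw [uIoc_of_le ht.1] at hτ
    exact h ⟨hτ.1.le, hτ.2.trans ht.2⟩
  refine ⟨_, ⟨hqmeas, _, hqle⟩, hqeq, ?_⟩
  rintro q' ⟨hq'meas, M, hM⟩ hq'eq t ht
  refine sub_eq_zero.1 (volterra_eq_zero (f := fun t => q' t - ∑' k, z k t) hLK
    (fun t ht => (norm_sub_le _ _).trans (add_le_add (hM t ht) (hqle t ht)))
    (fun t ht => ?_) t ht)
  simp only [map_sub]
  rw [intervalIntegral.integral_sub (intervalIntegrable_clm_apply hL hLK hq'meas hM ht)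
    (intervalIntegrable_clm_apply hL hLK hqmeas hqle ht), hq'eq t ht, hqeq t ht]
  abel

end Volterra

/-- The action of matrices on vectors, as a continuous linear map into operators. -/
noncomputable def mulVecCLM (n : ℕ) :
    Matrix (Fin n) (Fin n) ℝ →L[ℝ] (Fin n → ℝ) →L[ℝ] (Fin n → ℝ) :=
  LinearMap.toContinuousLinearMap
    (LinearMap.toContinuousLinearMap.toLinearMap ∘ₗ Matrix.toLin'.toLinearMap)

theorem mulVecCLM_apply {n : ℕ} (A : Matrix (Fin n) (Fin n) ℝ) (v : Fin n → ℝ) :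
    mulVecCLM n A v = A *ᵥ v := rfl

theorem stronglyMeasurable_mulVecCLM {n : ℕ} {A : ℝ → Matrix (Fin n) (Fin n) ℝ}
    (hA : ∀ i k, Measurable fun τ => A τ i k) :
    StronglyMeasurable fun τ => mulVecCLM n (A τ) :=
  (mulVecCLM n).continuous.comp_stronglyMeasurable <|
    (measurable_pi_lambda _ fun i => measurable_pi_lambda _ fun k => hA i k :
      Measurable fun τ i k => A τ i k).stronglyMeasurable

/-- The Volterra existence and uniqueness theorem for matrix-valued kernels. -/
theorem existsUnique_matrix_volterra {n : ℕ} {T K C : ℝ} {A : ℝ → Matrix (Fin n) (Fin n) ℝ}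
    (hA : ∀ i k, Measurable fun τ => A τ i k)
    (hAK : ∀ᵐ τ ∂(volume.restrict (Icc 0 T)), ‖A τ‖ ≤ K) {g : ℝ → Fin n → ℝ}
    (hg : Measurable g) (hgC : ∀ t ∈ Icc 0 T, ‖g t‖ ≤ C) :
    ∃ q : ℝ → Fin n → ℝ, (Measurable q ∧ ∃ M : ℝ, ∀ t ∈ Icc 0 T, ‖q t‖ ≤ M) ∧
      (∀ t ∈ Icc 0 T, q t = g t + ∫ τ in (0 : ℝ)..t, A τ *ᵥ q τ) ∧
      ∀ q' : ℝ → Fin n → ℝ, (Measurable q' ∧ ∃ M : ℝ, ∀ t ∈ Icc 0 T, ‖q' t‖ ≤ M) →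
        (∀ t ∈ Icc 0 T, q' t = g t + ∫ τ in (0 : ℝ)..t, A τ *ᵥ q' τ) →
        ∀ t ∈ Icc 0 T, q' t = q t := by
  simpa only [mulVecCLM_apply, stronglyMeasurable_iff_measurable] using
    existsUnique_volterra (stronglyMeasurable_mulVecCLM hA)
      (hAK.mono fun τ h => (mulVecCLM n).le_opNorm_of_le h) hg.stronglyMeasurable hgC

/-- Time reversal of `existsUnique_matrix_volterra`. -/
theorem existsUnique_matrix_volterra_backward {n : ℕ} {T K C : ℝ}
    {A : ℝ → Matrix (Fin n) (Fin n) ℝ} (hA : ∀ i k, Measurable fun τ => A τ i k)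
    (hAK : ∀ᵐ τ ∂(volume.restrict (Icc 0 T)), ‖A τ‖ ≤ K) {g : ℝ → Fin n → ℝ}
    (hg : Measurable g) (hgC : ∀ t ∈ Icc 0 T, ‖g t‖ ≤ C) :
    ∃ p : ℝ → Fin n → ℝ, (Measurable p ∧ ∃ M : ℝ, ∀ t ∈ Icc 0 T, ‖p t‖ ≤ M) ∧
      (∀ t ∈ Icc 0 T, p t = g t + ∫ τ in t..T, A τ *ᵥ p τ) ∧
      ∀ p' : ℝ → Fin n → ℝ, (Measurable p' ∧ ∃ M : ℝ, ∀ t ∈ Icc 0 T, ‖p' t‖ ≤ M) →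
        (∀ t ∈ Icc 0 T, p' t = g t + ∫ τ in t..T, A τ *ᵥ p' τ) →
        ∀ t ∈ Icc 0 T, p' t = p t := by
  have hrev : Measurable fun t : ℝ => T - t := measurable_const.sub measurable_id
  have hmem {t : ℝ} (ht : t ∈ Icc 0 T) : T - t ∈ Icc 0 T :=
    ⟨sub_nonneg.2 ht.2, sub_le_self T ht.1⟩
  have hAK' : ∀ᵐ τ ∂(volume.restrict (Icc 0 T)), ‖A (T - τ)‖ ≤ K := by
    rw [ae_restrict_iff' measurableSet_Icc] at hAK ⊢
    filter_upwards [(Measure.measurePreserving_sub_left volume T).quasiMeasurePreserving.ae hAK]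
      with τ h hτ using h (hmem hτ)
  obtain ⟨q, ⟨hqm, M, hM⟩, hq, huniq⟩ := existsUnique_matrix_volterra
    (A := fun τ => A (T - τ)) (fun i k => (hA i k).comp hrev) hAK' (hg.comp hrev)
    fun t ht => hgC _ (hmem ht)
  refine ⟨fun t => q (T - t), ⟨hqm.comp hrev, M, fun t ht => hM _ (hmem ht)⟩,
    fun t ht => ?_, ?_⟩
  · have h := hq _ (hmem ht)
    have hint := intervalIntegral.integral_comp_sub_left (a := t) (b := T)
      (fun τ => A (T - τ) *ᵥ q τ) T
    simp only [Function.comp_apply, sub_sub_cancel, sub_self] at h hint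
    simp only [h, hint]
  · rintro p' ⟨hp'm, M', hM'⟩ hp' t ht
    have h := huniq (fun t => p' (T - t)) ⟨hp'm.comp hrev, M', fun t ht => hM' _ (hmem ht)⟩
      (fun s hs => ?_) _ (hmem ht)
    · simpa only [sub_sub_cancel] using h
    · have hint := intervalIntegral.integral_comp_sub_left (a := 0) (b := s)
        (fun τ => A τ *ᵥ p' τ) T
      rw [sub_zero] at hint
      simp only [Function.comp_apply]
      rw [hp' _ (hmem hs), hint]

/-- A sum of integrals of continuous functions over measurably varying subsets of `[0, T]` is a
measurable and bounded function of the parameter. -/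
theorem measurable_bounded_stieltjes {n j : ℕ} {T : ℝ} {μ : Fin j → Measure ℝ}
    (hμ : ∀ i, IsFiniteMeasure (μ i)) {B : Fin j → ℝ → Fin n → ℝ} (hB : ∀ i, Continuous (B i))
    (c : Fin n → ℝ) {S : ℝ → Set ℝ} (hS : MeasurableSet {x : ℝ × ℝ | x.2 ∈ S x.1})
    (hST : ∀ t ∈ Icc 0 T, S t ⊆ Icc 0 T) :
    (Measurable fun t => c + ∑ i, ∫ τ in S t, B i τ ∂(μ i)) ∧
      ∀ t ∈ Icc 0 T, ‖c + ∑ i, ∫ τ in S t, B i τ ∂(μ i)‖ ≤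
        ‖c‖ + ∑ i, ∫ τ in Icc 0 T, ‖B i τ‖ ∂(μ i) := by
  refine ⟨measurable_const.add (Finset.measurable_sum _ fun i _ =>
    (stronglyMeasurable_setIntegral (hB i).stronglyMeasurable hS).measurable), fun t ht => ?_⟩
  refine (norm_add_le _ _).trans (add_le_add_right (norm_sum_le_of_le _ fun i _ => ?_) _)
  refine (norm_integral_le_integral_norm _).trans (setIntegral_mono_set ?_
    (.of_forall fun τ => norm_nonneg _) (hST t ht).eventuallyLE)
  exact (hB i).norm.continuousOn.integrableOn_compact isCompact_Icc


/-- Existence and uniqueness for linear Cauchy–Stieltjes problems: given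
`A ∈ L^∞([0,T],ℝ^{n×n})`, finite nonnegative Borel measures `μ₁,…,μ_j` on `[0,T]` and
continuous `B₁,…,B_j : [0,T] → ℝ^n`, the forward problem
`q(t) = q₀ + ∫₀ᵗ A q dτ + Σᵢ ∫_{[0,t)} Bᵢ dμᵢ` has a unique bounded measurable global
solution, and the backward problem
`p(t) = p_T + ∫ₜᵀ Aᵀ p dτ + Σᵢ ∫_{[t,T)} Bᵢ dμᵢ` has a unique bounded measurable global
solution. -/
theorem stmt_18 (T : ℝ) (hT : 0 < T) (n j : ℕ) (hn : 0 < n) (hj : 0 < j)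
    (A : ℝ → Matrix (Fin n) (Fin n) ℝ)
    (hAmeas : ∀ i k : Fin n, Measurable fun τ => A τ i k)
    (CA : ℝ) (hAbd : ∀ᵐ τ ∂(volume.restrict (Set.Icc 0 T)), ‖A τ‖ ≤ CA)
    (μ : Fin j → Measure ℝ) (hμfin : ∀ i, IsFiniteMeasure (μ i))
    (hμsupp : ∀ i, μ i (Set.Icc 0 T)ᶜ = 0)
    (B : Fin j → ℝ → (Fin n → ℝ)) (hB : ∀ i, Continuous (B i))
    (q₀ pT : Fin n → ℝ) :
    (∃ q : ℝ → (Fin n → ℝ),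
      (Measurable q ∧ ∃ M : ℝ, ∀ t ∈ Set.Icc (0:ℝ) T, ‖q t‖ ≤ M) ∧
      (∀ t ∈ Set.Icc (0:ℝ) T, q t = q₀ + (∫ τ in (0:ℝ)..t, A τ *ᵥ q τ)
          + ∑ i : Fin j, ∫ τ in Set.Ico (0:ℝ) t, B i τ ∂(μ i)) ∧
      ∀ q' : ℝ → (Fin n → ℝ),
        (Measurable q' ∧ ∃ M : ℝ, ∀ t ∈ Set.Icc (0:ℝ) T, ‖q' t‖ ≤ M) →
        (∀ t ∈ Set.Icc (0:ℝ) T, q' t = q₀ + (∫ τ in (0:ℝ)..t, A τ *ᵥ q' τ)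
            + ∑ i : Fin j, ∫ τ in Set.Ico (0:ℝ) t, B i τ ∂(μ i)) →
        ∀ t ∈ Set.Icc (0:ℝ) T, q' t = q t) ∧
    (∃ p : ℝ → (Fin n → ℝ),
      (Measurable p ∧ ∃ M : ℝ, ∀ t ∈ Set.Icc (0:ℝ) T, ‖p t‖ ≤ M) ∧
      (∀ t ∈ Set.Icc (0:ℝ) T, p t = pT + (∫ τ in t..T, (A τ)ᵀ *ᵥ p τ)
          + ∑ i : Fin j, ∫ τ in Set.Ico t T, B i τ ∂(μ i)) ∧
      ∀ p' : ℝ → (Fin n → ℝ),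
        (Measurable p' ∧ ∃ M : ℝ, ∀ t ∈ Set.Icc (0:ℝ) T, ‖p' t‖ ≤ M) →
        (∀ t ∈ Set.Icc (0:ℝ) T, p' t = pT + (∫ τ in t..T, (A τ)ᵀ *ᵥ p' τ)
            + ∑ i : Fin j, ∫ τ in Set.Ico t T, B i τ ∂(μ i)) →
        ∀ t ∈ Set.Icc (0:ℝ) T, p' t = p t) := by
  have hIco : MeasurableSet {x : ℝ × ℝ | x.2 ∈ Ico 0 x.1} :=
    (measurableSet_le measurable_const measurable_snd).inter
      (measurableSet_lt measurable_snd measurable_fst)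
  have hIco' : MeasurableSet {x : ℝ × ℝ | x.2 ∈ Ico x.1 T} :=
    (measurableSet_le measurable_fst measurable_snd).inter
      (measurableSet_lt measurable_snd measurable_const)
  obtain ⟨hfm, hfb⟩ := measurable_bounded_stieltjes (T := T) (S := Ico 0) hμfin hB q₀ hIco
    fun t ht τ hτ => ⟨hτ.1, hτ.2.le.trans ht.2⟩
  obtain ⟨hbm, hbb⟩ := measurable_bounded_stieltjes (T := T) (S := fun t => Ico t T) hμfin hB pT hIco'
    fun t ht τ hτ => ⟨ht.1.trans hτ.1, hτ.2.le⟩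
  constructor
  · simpa only [add_right_comm q₀] using existsUnique_matrix_volterra hAmeas hAbd hfm hfb
  · simpa only [add_right_comm pT] using existsUnique_matrix_volterra_backward
      (A := fun τ => (A τ)ᵀ) (fun i k => hAmeas k i) (by simpa only [norm_transpose] using hAbd)
      hbm hbb
end

section
/- Let A ∈ L^∞([0,T],ℝ^{n×n}) with state-transition matrix Z : [0,T]² → ℝ^{n×n} (i.e. Z(t,s) = Id_n + ∫ₛᵗ A(τ) · Z(τ,s) dτ for all (t,s)), let μ₁,…,μ_j be finite nonnegative Borel measures on [0,T], let B₁,…,B_j : [0,T] → ℝ^n be continuous, and let q₀, p_T ∈ ℝ^n. Then: (i) the function q(t) := Z(t,0) · q₀ + Σᵢ₌₁ʲ ∫_{[0,t)} Z(t,s) · B_i(s) dμ_i(s) satisfies q(t) = q₀ + ∫₀ᵗ A(τ) · q(τ) dτ + Σᵢ ∫_{[0,t)} B_i dμ_i for every t ∈ [0,T]; and (ii) the function p(t) := Z(T,t)ᵀ · p_T + Σᵢ₌₁ʲ ∫_{[t,T)} Z(τ,t)ᵀ · B_i(τ) dμ_i(τ) satisfies p(t) = p_T + ∫ₜᵀ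 A(τ)ᵀ · p(τ) dτ + Σᵢ ∫_{[t,T)} B_i dμ_i for every t ∈ [0,T]. Hence q and p are the unique global solutions of the forward and backward linear Cauchy–Stieltjes problems, respectively. -/
open MeasureTheory Matrix

attribute [local instance] Matrix.normedAddCommGroup Matrix.normedSpace

theorem norm_le_mul_exp_of_norm_le_add_integral {E : Type*} [NormedAddCommGroup E]
    {u : ℝ → E} {a b C K : ℝ} (hK : 0 ≤ K) (hu : ContinuousOn u (Set.Icc a b))
    (h : ∀ t ∈ Set.Icc a b, ‖u t‖ ≤ C + K * ∫ τ in a..t, ‖u τ‖) :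
    ∀ t ∈ Set.Icc a b, ‖u t‖ ≤ C * Real.exp (K * (t - a)) := by
  intro t ht
  have hab : a ≤ b := ht.1.trans ht.2
  set v : ℝ → ℝ := fun r => ‖u (Set.projIcc a b hab r)‖ with hv
  have hvc : Continuous v :=
    (hu.comp_continuous (continuous_subtype_val.comp continuous_projIcc)
      fun r => (Set.projIcc a b hab r).2).norm
  have hvu : ∀ r ∈ Set.Icc a b, v r = ‖u r‖ := fun r hr => by
    simp [hv, Set.projIcc_of_mem hab hr]
  have hint : ∀ r ∈ Set.Icc a b, ∫ τ in a..r, ‖u τ‖ = ∫ τ in a..r, v τ := fun r hr =>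
    intervalIntegral.integral_congr fun x hx => by
      rw [Set.uIcc_of_le hr.1] at hx
      exact (hvu x ⟨hx.1, hx.2.trans hr.2⟩).symm
  have hC : 0 ≤ C := by
    have := h a ⟨le_rfl, hab⟩
    simp only [intervalIntegral.integral_same, mul_zero, add_zero] at this
    exact (norm_nonneg _).trans this
  have hG0 : ∀ r ∈ Set.Icc a b, 0 ≤ ∫ τ in a..r, v τ := fun r hr =>
    intervalIntegral.integral_nonneg hr.1 fun _ _ => norm_nonneg _
  have hG : ∀ r, HasDerivAt (fun r => C + K * ∫ τ in a..r, v τ) (K * v r) r := fun r =>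
    (((hvc.integral_hasStrictDerivAt a r).hasDerivAt).const_mul K).const_add C
  have key := norm_le_gronwallBound_of_norm_deriv_right_le (a := a) (b := b) (δ := C) (K := K)
    (ε := 0) (f := fun r => C + K * ∫ τ in a..r, v τ) (f' := fun r => K * v r)
    (fun r _ => (hG r).continuousAt.continuousWithinAt) (fun r _ => (hG r).hasDerivWithinAt)
    (by simp [abs_of_nonneg hC])
    (fun r hr => by
      have hr' : r ∈ Set.Icc a b := ⟨hr.1, hr.2.le⟩
      have h1 := h r hr'
      rw [hint r hr'] at h1
      have h2 := mul_nonneg hK (hG0 r hr')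
      rw [Real.norm_of_nonneg (mul_nonneg hK (norm_nonneg _)),
        Real.norm_of_nonneg (add_nonneg hC h2), add_zero]
      refine le_of_eq_of_le (congrArg (K * ·) (hvu r hr')) ?_
      exact mul_le_mul_of_nonneg_left h1 hK) t ht
  rw [gronwallBound_ε0] at key
  exact ((h t ht).trans_eq (by rw [hint t ht])).trans ((le_abs_self _).trans key)

theorem norm_bilin_le {M E : Type*} [NormedAddCommGroup M] [NormedSpace ℝ M]
    [NormedAddCommGroup E] [NormedSpace ℝ E] (Λ : M →L[ℝ] E →L[ℝ] E) {A : ℝ → M} {K : ℝ}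
    (hK : ∀ τ, ‖A τ‖ ≤ K) (τ : ℝ) (x : E) : ‖Λ (A τ) x‖ ≤ ‖Λ‖ * K * ‖x‖ :=
  (Λ.le_opNorm₂ _ _).trans (by gcongr; exact hK τ)

/-- A function satisfying a linear Volterra equation on `[a, t]` with integrable right-hand side
is continuous and obeys the Grönwall bound. -/
theorem volterra_continuousOn_and_bound {M E : Type*} [NormedAddCommGroup M] [NormedSpace ℝ M]
    [NormedAddCommGroup E] [NormedSpace ℝ E] (Λ : M →L[ℝ] E →L[ℝ] E) {A : ℝ → M} {K : ℝ}
    (hK : ∀ τ, ‖A τ‖ ≤ K) {a b : ℝ} {u : ℝ → E} {c : E}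
    (hu : ∀ t ∈ Set.Icc a b, u t = c + ∫ τ in a..t, Λ (A τ) (u τ)) (hab : a ≤ b)
    (hint : IntervalIntegrable (fun τ => Λ (A τ) (u τ)) volume a b) :
    ContinuousOn u (Set.Icc a b) ∧
      ∀ t ∈ Set.Icc a b, ‖u t‖ ≤ ‖c‖ * Real.exp (‖Λ‖ * K * (t - a)) := by
  have hK0 : 0 ≤ ‖Λ‖ * K := mul_nonneg Λ.opNorm_nonneg ((norm_nonneg _).trans (hK a))
  have hcont : ContinuousOn u (Set.Icc a b) := by
    have h1 := intervalIntegral.continuousOn_primitive_interval' hint Set.left_mem_uIcc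
    rw [Set.uIcc_of_le hab] at h1
    exact (continuousOn_const.add h1).congr hu
  refine ⟨hcont, norm_le_mul_exp_of_norm_le_add_integral hK0 hcont fun t ht => ?_⟩
  have hut : IntervalIntegrable (fun τ => ‖u τ‖) volume a t :=
    (hcont.mono (by rw [Set.uIcc_of_le ht.1]; exact Set.Icc_subset_Icc_right ht.2)).norm
      |>.intervalIntegrable
  rw [hu t ht, ← intervalIntegral.integral_const_mul]
  exact (norm_add_le _ _).trans (add_le_add le_rfl
    (intervalIntegral.norm_integral_le_of_norm_le ht.1
      (Filter.Eventually.of_forall fun τ _ => norm_bilin_le Λ hK τ _) (hut.const_mul _)))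

/-- The right-hand side of a linear Volterra equation is automatically integrable. -/
theorem volterra_intervalIntegrable {M E : Type*} [NormedAddCommGroup M] [NormedSpace ℝ M]
    [NormedAddCommGroup E] [NormedSpace ℝ E] (Λ : M →L[ℝ] E →L[ℝ] E) {A : ℝ → M} {K : ℝ}
    (hA : StronglyMeasurable A) (hK : ∀ τ, ‖A τ‖ ≤ K) {a b : ℝ} {u : ℝ → E} {c : E}
    (hu : ∀ t ∈ Set.Icc a b, u t = c + ∫ τ in a..t, Λ (A τ) (u τ)) (hab : a ≤ b) :
    IntervalIntegrable (fun τ => Λ (A τ) (u τ)) volume a b := by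
  have hK0 : 0 ≤ ‖Λ‖ * K := mul_nonneg Λ.opNorm_nonneg ((norm_nonneg _).trans (hK a))
  set F : ℝ → E := fun τ => Λ (A τ) (u τ) with hF
  set J : Set ℝ := {t | t ∈ Set.Icc a b ∧ IntervalIntegrable F volume a t} with hJ
  have haJ : a ∈ J := ⟨⟨le_rfl, hab⟩, IntervalIntegrable.refl⟩
  have hJb : BddAbove J := ⟨b, fun t ht => ht.1.2⟩
  set m := sSup J with hm
  have ham : a ≤ m := le_csSup hJb haJ
  have hmb : m ≤ b := csSup_le ⟨a, haJ⟩ fun t ht => ht.1.2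
  have hres : ∀ t ∈ J, ContinuousOn u (Set.Icc a t) ∧
      ∀ r ∈ Set.Icc a t, ‖u r‖ ≤ ‖c‖ * Real.exp (‖Λ‖ * K * (r - a)) := fun t ht =>
    volterra_continuousOn_and_bound Λ hK (fun r hr => hu r ⟨hr.1, hr.2.trans ht.1.2⟩) ht.1.1 ht.2
  have hlt : ∀ t ∈ Set.Ico a m, ∃ t' ∈ J, t < t' := fun t ht => exists_lt_of_lt_csSup ⟨a, haJ⟩ ht.2
  have hgt : ∀ t ∈ Set.Icc a b, t ∉ J → u t = c := fun t ht hn => by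
    rw [hu t ht, intervalIntegral.integral_undef (fun h => hn ⟨ht, h⟩), add_zero]
  have hbound : ∀ t ∈ Set.Icc a b, ‖u t‖ ≤ ‖c‖ * Real.exp (‖Λ‖ * K * (b - a)) := by
    intro t ht
    by_cases htJ : t ∈ J
    · refine ((hres t htJ).2 t ⟨ht.1, le_rfl⟩).trans ?_
      gcongr
      exact ht.2
    · rw [hgt t ht htJ]
      refine le_mul_of_one_le_right (norm_nonneg _) (Real.one_le_exp ?_)
      exact mul_nonneg hK0 (by linarith)
  have hmeas : AEStronglyMeasurable u (volume.restrict (Set.Ioc a b)) := by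
    have h1 : AEStronglyMeasurable u (volume.restrict (Set.Ico a m)) := by
      refine ContinuousOn.aestronglyMeasurable (fun t ht => ?_) measurableSet_Ico
      obtain ⟨t', ht', htt'⟩ := hlt t ht
      refine ((hres t' ht').1 t ⟨ht.1, htt'.le⟩).mono_of_mem_nhdsWithin ?_
      filter_upwards [self_mem_nhdsWithin, mem_nhdsWithin_of_mem_nhds (Iio_mem_nhds htt')]
        with x hx hx' using ⟨hx.1, le_of_lt hx'⟩
    have h2 : AEStronglyMeasurable u (volume.restrict (Set.Ioc m b)) := by
      refine (aestronglyMeasurable_const (b := c)).congr ?_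
      filter_upwards [ae_restrict_mem measurableSet_Ioc] with x hx
      exact (hgt x ⟨ham.trans hx.1.le, hx.2⟩ fun h => (le_csSup hJb h).not_gt hx.1).symm
    have h3 : AEStronglyMeasurable u (volume.restrict {m}) := by
      simp [Measure.restrict_singleton]
    refine (aestronglyMeasurable_union_iff.2 ⟨aestronglyMeasurable_union_iff.2 ⟨h1, h3⟩, h2⟩
      ).mono_measure (Measure.restrict_mono (fun x hx => ?_) le_rfl)
    rcases lt_trichotomy x m with h | h | h
    · exact Or.inl (Or.inl ⟨hx.1.le, h⟩)
    · exact Or.inl (Or.inr h)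
    · exact Or.inr ⟨h, hx.2⟩
  rw [intervalIntegrable_iff_integrableOn_Ioc_of_le hab]
  refine Integrable.of_bound (μ := volume.restrict (Set.Ioc a b)) ?_
    (‖Λ‖ * K * (‖c‖ * Real.exp (‖Λ‖ * K * (b - a)))) ?_
  · exact Λ.aestronglyMeasurable_comp₂ hA.aestronglyMeasurable hmeas
  · filter_upwards [ae_restrict_mem measurableSet_Ioc] with x hx
    refine (norm_bilin_le Λ hK x _).trans ?_
    gcongr
    exact hbound x ⟨hx.1.le, hx.2⟩

/-- A solution of a linear Volterra equation based at any point `s` of the interval is continuous,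
bounded, and has integrable right-hand side. -/
theorem volterra_regularity {M E : Type*} [NormedAddCommGroup M] [NormedSpace ℝ M]
    [NormedAddCommGroup E] [NormedSpace ℝ E] (Λ : M →L[ℝ] E →L[ℝ] E) {A : ℝ → M} {K : ℝ}
    (hA : StronglyMeasurable A) (hK : ∀ τ, ‖A τ‖ ≤ K) {a b s : ℝ} (hs : s ∈ Set.Icc a b)
    {u : ℝ → E} {c : E}
    (hu : ∀ t ∈ Set.Icc a b, u t = c + ∫ τ in s..t, Λ (A τ) (u τ)) :
    ContinuousOn u (Set.Icc a b) ∧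
      IntervalIntegrable (fun τ => Λ (A τ) (u τ)) volume a b ∧
      ∀ t ∈ Set.Icc a b, ‖u t‖ ≤ ‖c‖ * Real.exp (‖Λ‖ * K * (b - a)) := by
  have hK0 : 0 ≤ ‖Λ‖ * K := mul_nonneg Λ.opNorm_nonneg ((norm_nonneg _).trans (hK a))
  have hu₁ : ∀ t ∈ Set.Icc s b, u t = c + ∫ τ in s..t, Λ (A τ) (u τ) := fun t ht =>
    hu t ⟨hs.1.trans ht.1, ht.2⟩
  have hu₂ : ∀ t ∈ Set.Icc (-s) (-a),
      u (-t) = c + ∫ τ in (-s)..t, (-Λ) (A (-τ)) (u (-τ)) := fun t ht => by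
    have h := intervalIntegral.integral_comp_neg (a := -s) (b := t)
      (fun τ => Λ (A τ) (u τ))
    rw [neg_neg] at h
    have hneg : ∀ τ, (-Λ) (A (-τ)) (u (-τ)) = -(Λ (A (-τ)) (u (-τ))) := fun τ => rfl
    rw [hu (-t) ⟨by linarith [ht.2], by linarith [ht.1, hs.2]⟩]
    simp only [hneg, intervalIntegral.integral_neg]
    rw [h, ← intervalIntegral.integral_symm]
  have hA' : StronglyMeasurable fun τ => A (-τ) := hA.comp_measurable measurable_neg
  have i₁ := volterra_intervalIntegrable Λ hA hK hu₁ hs.2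
  have i₂ := volterra_intervalIntegrable (-Λ) hA' (fun τ => hK (-τ)) (u := fun t => u (-t))
    hu₂ (neg_le_neg hs.1)
  obtain ⟨c₁, b₁⟩ := volterra_continuousOn_and_bound Λ hK hu₁ hs.2 i₁
  obtain ⟨c₂, b₂⟩ := volterra_continuousOn_and_bound (-Λ) (fun τ => hK (-τ))
    (u := fun t => u (-t)) hu₂ (neg_le_neg hs.1) i₂
  have c₂' : ContinuousOn u (Set.Icc a s) := by
    have h := c₂.comp (s := Set.Icc a s) continuous_neg.continuousOn
      fun x hx => ⟨neg_le_neg hx.2, neg_le_neg hx.1⟩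
    simpa [Function.comp_def] using h
  have hcont : ContinuousOn u (Set.Icc a b) := by
    rw [← Set.Icc_union_Icc_eq_Icc hs.1 hs.2]
    exact c₂'.union_of_isClosed c₁ isClosed_Icc isClosed_Icc
  refine ⟨hcont, ?_, fun t ht => ?_⟩
  · obtain ⟨C, hC⟩ := isCompact_Icc.exists_bound_of_continuousOn hcont
    have hab := hs.1.trans hs.2
    rw [intervalIntegrable_iff_integrableOn_Ioc_of_le hab]
    refine Integrable.of_bound (μ := volume.restrict (Set.Ioc a b)) ?_ (‖Λ‖ * K * C) ?_
    · exact Λ.aestronglyMeasurable_comp₂ hA.aestronglyMeasurable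
        ((hcont.mono Set.Ioc_subset_Icc_self).aestronglyMeasurable measurableSet_Ioc)
    · filter_upwards [ae_restrict_mem measurableSet_Ioc] with x hx
      refine (norm_bilin_le Λ hK x _).trans ?_
      gcongr
      exact hC x ⟨hx.1.le, hx.2⟩
  · rcases le_total s t with h | h
    · refine (b₁ t ⟨h, ht.2⟩).trans ?_
      gcongr
      · exact ht.2
      · exact hs.1
    · have h2 := b₂ (-t) ⟨neg_le_neg h, neg_le_neg ht.1⟩
      simp only [neg_neg] at h2
      refine h2.trans ?_
      rw [ContinuousLinearMap.opNorm_neg]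
      have h3 : -t - -s ≤ b - a := by linarith [ht.1, hs.2]
      exact mul_le_mul_of_nonneg_left (Real.exp_le_exp.2 (mul_le_mul_of_nonneg_left h3 hK0))
        (norm_nonneg _)

theorem volterra_unique {M E : Type*} [NormedAddCommGroup M] [NormedSpace ℝ M]
    [NormedAddCommGroup E] [NormedSpace ℝ E] (Λ : M →L[ℝ] E →L[ℝ] E) {A : ℝ → M} {K : ℝ}
    (hA : StronglyMeasurable A) (hK : ∀ τ, ‖A τ‖ ≤ K) {a b s : ℝ} (hs : s ∈ Set.Icc a b)
    {u v c : ℝ → E}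
    (hui : IntervalIntegrable (fun τ => Λ (A τ) (u τ)) volume a b)
    (hvi : IntervalIntegrable (fun τ => Λ (A τ) (v τ)) volume a b)
    (hu : ∀ t ∈ Set.Icc a b, u t = c t + ∫ τ in s..t, Λ (A τ) (u τ))
    (hv : ∀ t ∈ Set.Icc a b, v t = c t + ∫ τ in s..t, Λ (A τ) (v τ)) :
    ∀ t ∈ Set.Icc a b, u t = v t := by
  intro t ht
  have hsub : ∀ t ∈ Set.Icc a b, Set.uIcc s t ⊆ Set.uIcc a b := fun t ht =>
    Set.uIcc_subset_uIcc (Set.Icc_subset_uIcc hs) (Set.Icc_subset_uIcc ht)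
  have h := (volterra_regularity Λ hA hK hs (u := fun t => u t - v t) (c := 0)
    fun t ht => by
      simp only [map_sub]
      rw [intervalIntegral.integral_sub (hui.mono_set (hsub t ht)) (hvi.mono_set (hsub t ht)),
        hu t ht, hv t ht]
      abel).2.2 t ht
  simpa [sub_eq_zero] using h

theorem volterra_unique_of_const {M E : Type*} [NormedAddCommGroup M] [NormedSpace ℝ M]
    [NormedAddCommGroup E] [NormedSpace ℝ E] (Λ : M →L[ℝ] E →L[ℝ] E) {A : ℝ → M} {K : ℝ}
    (hA : StronglyMeasurable A) (hK : ∀ τ, ‖A τ‖ ≤ K) {a b s : ℝ} (hs : s ∈ Set.Icc a b)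
    {u v : ℝ → E} {c : E}
    (hu : ∀ t ∈ Set.Icc a b, u t = c + ∫ τ in s..t, Λ (A τ) (u τ))
    (hv : ∀ t ∈ Set.Icc a b, v t = c + ∫ τ in s..t, Λ (A τ) (v τ)) :
    ∀ t ∈ Set.Icc a b, u t = v t :=
  volterra_unique Λ hA hK hs (c := fun _ => c) (volterra_regularity Λ hA hK hs hu).2.1
    (volterra_regularity Λ hA hK hs hv).2.1 hu hv

/-- Fubini's theorem over a measurable region described by its sections in two ways. -/
theorem setIntegral_setIntegral_swap {E : Type*} [NormedAddCommGroup E] [NormedSpace ℝ E]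
    {μ ν : Measure ℝ} [SFinite μ] [IsFiniteMeasure ν] {f : ℝ → ℝ → E}
    (hf : StronglyMeasurable (Function.uncurry f)) {C : ℝ} (hC : ∀ x y, ‖f x y‖ ≤ C)
    {S U : Set ℝ} {V W : ℝ → Set ℝ} (hS : MeasurableSet S) (hμS : μ S ≠ ⊤)
    (hU : MeasurableSet U) (hV : ∀ x, MeasurableSet (V x)) (hW : ∀ y, MeasurableSet (W y))
    (hR : MeasurableSet {z : ℝ × ℝ | z.2 ∈ V z.1})
    (hiff : ∀ x y, x ∈ S ∧ y ∈ V x ↔ y ∈ U ∧ x ∈ W y) :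
    ∫ x in S, ∫ y in V x, f x y ∂ν ∂μ = ∫ y in U, ∫ x in W y, f x y ∂μ ∂ν := by
  set R : Set (ℝ × ℝ) := {z | z.1 ∈ S ∧ z.2 ∈ V z.1} with hRdef
  have hRm : MeasurableSet R := (measurable_fst hS).inter hR
  set g : ℝ → ℝ → E := fun x y => R.indicator (Function.uncurry f) (x, y) with hg
  have hgm : StronglyMeasurable (Function.uncurry g) := hf.indicator hRm
  have : IsFiniteMeasure (μ.restrict S) := ⟨by simpa using hμS.lt_top⟩
  have hint : Integrable (Function.uncurry g) ((μ.restrict S).prod ν) :=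
    Integrable.of_bound hgm.aestronglyMeasurable C (Filter.Eventually.of_forall fun z =>
      (norm_indicator_le_norm_self _ _).trans (hC _ _))
  have h1 : ∀ x ∈ S, ∫ y in V x, f x y ∂ν = ∫ y, g x y ∂ν := fun x hx => by
    rw [← integral_indicator (hV x)]
    refine integral_congr_ae (Filter.Eventually.of_forall fun y => ?_)
    simp only [hg, R, Set.indicator, Function.uncurry, Set.mem_ofPred_eq]
    grind
  have h2 : ∀ y, ∫ x in S, g x y ∂μ = U.indicator (fun y => ∫ x in W y, f x y ∂μ) y := fun y => by
    rw [← integral_indicator hS]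
    by_cases hy : y ∈ U
    · rw [Set.indicator_of_mem hy, ← integral_indicator (hW y)]
      refine integral_congr_ae (Filter.Eventually.of_forall fun x => ?_)
      have := hiff x y
      simp only [hg, R, Set.indicator, Function.uncurry, Set.mem_ofPred_eq]
      grind
    · rw [Set.indicator_of_notMem hy]
      refine integral_eq_zero_of_ae (Filter.Eventually.of_forall fun x => ?_)
      have := hiff x y
      simp only [hg, R, Set.indicator, Function.uncurry, Set.mem_ofPred_eq, Pi.zero_apply]
      grind
  rw [setIntegral_congr_fun hS h1, integral_integral_swap hint, ← integral_indicator hU]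
  exact integral_congr_ae (Filter.Eventually.of_forall h2)

theorem stronglyMeasurable_setIntegral_s19 {E : Type*} [NormedAddCommGroup E] [NormedSpace ℝ E]
    {ν : Measure ℝ} [SFinite ν] {f : ℝ → ℝ → E}
    (hf : StronglyMeasurable (Function.uncurry f)) {V : ℝ → Set ℝ}
    (hV : ∀ x, MeasurableSet (V x)) (hR : MeasurableSet {z : ℝ × ℝ | z.2 ∈ V z.1}) :
    StronglyMeasurable fun x => ∫ y in V x, f x y ∂ν := by
  have h := (hf.indicator hR).integral_prod_right' (ν := ν)
  convert h using 2 with x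
  rw [← integral_indicator (hV x)]
  rfl

theorem integrableOn_of_norm_le {E : Type*} [NormedAddCommGroup E] {ν : Measure ℝ} {f : ℝ → E}
    {S : Set ℝ} {C : ℝ} (hf : StronglyMeasurable f) (hC : ∀ x, ‖f x‖ ≤ C) (hS : ν S ≠ ⊤) :
    IntegrableOn f S ν :=
  Measure.integrableOn_of_bounded hS hf.aestronglyMeasurable (Filter.Eventually.of_forall hC)

theorem stronglyMeasurable_bilin {α M E G : Type*} [MeasurableSpace α] [NormedAddCommGroup M]
    [NormedSpace ℝ M] [NormedAddCommGroup E] [NormedSpace ℝ E] [NormedAddCommGroup G]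
    [NormedSpace ℝ G] (Λ : M →L[ℝ] E →L[ℝ] G)
    {X : α → M} {v : α → E} (hX : StronglyMeasurable X)
    (hv : StronglyMeasurable v) : StronglyMeasurable fun x => Λ (X x) (v x) :=
  Λ.continuous₂.comp_stronglyMeasurable (hX.prodMk hv)

theorem norm_bilin_le_of_le {M E G : Type*} [NormedAddCommGroup M]
    [NormedSpace ℝ M] [NormedAddCommGroup E] [NormedSpace ℝ E] [NormedAddCommGroup G]
    [NormedSpace ℝ G] (Λ : M →L[ℝ] E →L[ℝ] G) {X : M} {v : E} {C D : ℝ}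
    (hX : ‖X‖ ≤ C) (hv : ‖v‖ ≤ D) : ‖Λ X v‖ ≤ ‖Λ‖ * C * D := by
  have hC := (norm_nonneg _).trans hX
  exact (Λ.le_opNorm₂ X v).trans (by gcongr)

section Transition

variable {R : Type*} [NormedRing R] [NormedAlgebra ℝ R]
  {A : ℝ → R} {K a b : ℝ} {Z : ℝ → ℝ → R}

theorem transition_regularity (hA : StronglyMeasurable A) (hK : ∀ τ, ‖A τ‖ ≤ K)
    (hZ : ∀ t ∈ Set.Icc a b, ∀ s ∈ Set.Icc a b, Z t s = 1 + ∫ τ in s..t, A τ * Z τ s)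
    {s : ℝ} (hs : s ∈ Set.Icc a b) :
    ContinuousOn (fun t => Z t s) (Set.Icc a b) ∧
      IntervalIntegrable (fun τ => A τ * Z τ s) volume a b ∧
      ∀ t ∈ Set.Icc a b,
        ‖Z t s‖ ≤ ‖(1 : R)‖ * Real.exp (‖ContinuousLinearMap.mul ℝ R‖ * K * (b - a)) :=
  volterra_regularity (ContinuousLinearMap.mul ℝ R) hA hK hs fun t ht => hZ t ht s hs

variable [CompleteSpace R]

theorem transition_mul (hA : StronglyMeasurable A) (hK : ∀ τ, ‖A τ‖ ≤ K)
    (hZ : ∀ t ∈ Set.Icc a b, ∀ s ∈ Set.Icc a b, Z t s = 1 + ∫ τ in s..t, A τ * Z τ s)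
    {t s r : ℝ} (ht : t ∈ Set.Icc a b) (hs : s ∈ Set.Icc a b) (hr : r ∈ Set.Icc a b) :
    Z t s * Z s r = Z t r := by
  have hi : ∀ s ∈ Set.Icc a b, ∀ x ∈ Set.Icc a b, ∀ y ∈ Set.Icc a b,
      IntervalIntegrable (fun τ => A τ * Z τ s) volume x y := fun s hs x hx y hy =>
    (transition_regularity hA hK hZ hs).2.1.mono_set
      (Set.uIcc_subset_uIcc (Set.Icc_subset_uIcc hx) (Set.Icc_subset_uIcc hy))
  refine volterra_unique_of_const (ContinuousLinearMap.mul ℝ R) hA hK hs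
    (u := fun t => Z t s * Z s r) (v := fun t => Z t r) (c := Z s r)
    (fun t ht => ?_) (fun t ht => ?_) t ht
  · have h := ((ContinuousLinearMap.mul ℝ R).flip (Z s r)).intervalIntegral_comp_comm
      (hi s hs s hs t ht)
    simp only [ContinuousLinearMap.flip_apply, ContinuousLinearMap.mul_apply'] at h ⊢
    simp only [← mul_assoc]
    rw [h, hZ t ht s hs, add_mul, one_mul]
  · simp only [ContinuousLinearMap.mul_apply']
    rw [hZ t ht r hr, hZ s hs r hr, add_assoc,
      intervalIntegral.integral_add_adjacent_intervals (hi r hr r hr s hs) (hi r hr s hs t ht)]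

/-- A state-transition matrix extends from the square to a bounded continuous function. -/
theorem transition_exists_extension (hA : StronglyMeasurable A) (hK : ∀ τ, ‖A τ‖ ≤ K)
    (hZ : ∀ t ∈ Set.Icc a b, ∀ s ∈ Set.Icc a b, Z t s = 1 + ∫ τ in s..t, A τ * Z τ s)
    (hab : a ≤ b) :
    ∃ (Y : ℝ → ℝ → R) (C : ℝ), Continuous (Function.uncurry Y) ∧
      (∀ t s, ‖Y t s‖ ≤ C) ∧ ∀ t ∈ Set.Icc a b, ∀ s ∈ Set.Icc a b, Y t s = Z t s := by
  have ha : a ∈ Set.Icc a b := ⟨le_rfl, hab⟩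
  set P : ℝ → ℝ := fun r => Set.projIcc a b hab r with hP
  have hPm : ∀ r, P r ∈ Set.Icc a b := fun r => (Set.projIcc a b hab r).2
  have hPc : Continuous P := continuous_subtype_val.comp continuous_projIcc
  have hPid : ∀ r ∈ Set.Icc a b, P r = r := fun r hr => by simp [hP, Set.projIcc_of_mem hab hr]
  have hΦ : Continuous fun r => Z (P r) a :=
    (transition_regularity hA hK hZ ha).1.comp_continuous hPc hPm
  have hone : ∀ s ∈ Set.Icc a b, Z s s = 1 := fun s hs => by simp [hZ s hs s hs]
  let U : ℝ → Rˣ := fun r => ⟨Z (P r) a, Z a (P r),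
    by rw [transition_mul hA hK hZ (hPm r) ha (hPm r), hone _ (hPm r)],
    by rw [transition_mul hA hK hZ ha (hPm r) ha, hone a ha]⟩
  have hΨ : Continuous fun r => Z a (P r) := by
    have h : (fun r => Z a (P r)) = fun r => Ring.inverse (Z (P r) a) :=
      funext fun r => (Ring.inverse_unit (U r)).symm
    rw [h]
    exact continuous_iff_continuousAt.2 fun r =>
      ContinuousAt.comp (g := Ring.inverse) (NormedRing.inverse_continuousAt (U r))
        hΦ.continuousAt
  refine ⟨fun t s => Z (P t) (P s), _, ?_,
    fun t s => (transition_regularity hA hK hZ (hPm s)).2.2 (P t) (hPm t), fun t ht s hs => by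
      simp only [hPid t ht, hPid s hs]⟩
  have h : (Function.uncurry fun t s => Z (P t) (P s)) = fun z => Z (P z.1) a * Z a (P z.2) := by
    ext1 z
    exact (transition_mul hA hK hZ (hPm _) ha (hPm _)).symm
  rw [h]
  exact (hΦ.comp continuous_fst).mul (hΨ.comp continuous_snd)

end Transition

section Kernel

variable {R E : Type*} [NormedAddCommGroup R] [NormedSpace ℝ R]
  [NormedAddCommGroup E] [NormedSpace ℝ E]
  (Λ : R →L[ℝ] E →L[ℝ] E) {A : ℝ → R} {K : ℝ}
  {k : ℝ → ℝ → R} {C : ℝ} {g : ℝ → E} {D : ℝ} {ν : Measure ℝ} {V : ℝ → Set ℝ}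

theorem kernel_intervalIntegrable [IsFiniteMeasure ν]
    (hA : StronglyMeasurable A) (hK : ∀ τ, ‖A τ‖ ≤ K)
    (hk : Continuous (Function.uncurry k)) (hC : ∀ x y, ‖k x y‖ ≤ C)
    (hg : StronglyMeasurable g) (hD : ∀ y, ‖g y‖ ≤ D)
    (hV : ∀ x, MeasurableSet (V x)) (hR : MeasurableSet {z : ℝ × ℝ | z.2 ∈ V z.1}) (a b : ℝ) :
    IntervalIntegrable (fun x => Λ (A x) (∫ y in V x, Λ (k x y) (g y) ∂ν)) volume a b := by
  have hkg : StronglyMeasurable (Function.uncurry fun x y => Λ (k x y) (g y)) :=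
    stronglyMeasurable_bilin Λ hk.stronglyMeasurable (hg.comp_measurable measurable_snd)
  have hw := stronglyMeasurable_setIntegral_s19 (ν := ν) hkg hV hR
  have hb : ∀ x, ‖∫ y in V x, Λ (k x y) (g y) ∂ν‖ ≤ ‖Λ‖ * C * D * ν.real Set.univ := fun x => by
    refine (norm_setIntegral_le_of_norm_le_const (measure_lt_top _ _)
      fun y _ => norm_bilin_le_of_le Λ (hC x y) (hD y)).trans ?_
    have hC0 := (norm_nonneg _).trans (hC x x)
    have hD0 := (norm_nonneg _).trans (hD x)
    have hV0 : ν.real (V x) ≤ ν.real Set.univ := measureReal_mono (Set.subset_univ _)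
    gcongr
  rw [intervalIntegrable_iff]
  exact integrableOn_of_norm_le (stronglyMeasurable_bilin Λ hA hw)
    (fun x => norm_bilin_le_of_le Λ (hK x) (hb x)) (by simp [Set.uIoc])

theorem kernel_setIntegral_swap [CompleteSpace R] [CompleteSpace E] [IsFiniteMeasure ν]
    {m : R →L[ℝ] R →L[ℝ] R} (hm : ∀ x y v, Λ (m x y) v = Λ x (Λ y v))
    (hA : StronglyMeasurable A) (hK : ∀ τ, ‖A τ‖ ≤ K)
    (hk : Continuous (Function.uncurry k)) (hC : ∀ x y, ‖k x y‖ ≤ C)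
    (hg : StronglyMeasurable g) (hD : ∀ y, ‖g y‖ ≤ D)
    (hV : ∀ x, MeasurableSet (V x)) (hR : MeasurableSet {z : ℝ × ℝ | z.2 ∈ V z.1})
    {S U : Set ℝ} {W : ℝ → Set ℝ} (hS : MeasurableSet S) (hSfin : volume S ≠ ⊤)
    (hU : MeasurableSet U) (hW : ∀ y, MeasurableSet (W y)) (hWfin : ∀ y, volume (W y) ≠ ⊤)
    (hiff : ∀ x y, x ∈ S ∧ y ∈ V x ↔ y ∈ U ∧ x ∈ W y) :
    ∫ x in S, Λ (A x) (∫ y in V x, Λ (k x y) (g y) ∂ν) =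
      ∫ y in U, Λ (∫ x in W y, m (A x) (k x y)) (g y) ∂ν := by
  have hkg : StronglyMeasurable (Function.uncurry fun x y => Λ (k x y) (g y)) :=
    stronglyMeasurable_bilin Λ hk.stronglyMeasurable (hg.comp_measurable measurable_snd)
  have h1 : ∀ x, Λ (A x) (∫ y in V x, Λ (k x y) (g y) ∂ν) =
      ∫ y in V x, Λ (A x) (Λ (k x y) (g y)) ∂ν :=
    fun x => ((Λ (A x)).integral_comp_comm (integrableOn_of_norm_le
      (hkg.comp_measurable measurable_prodMk_left)
      (fun y => norm_bilin_le_of_le Λ (hC x y) (hD y)) (measure_ne_top _ _))).symm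
  have h2 : ∀ y, Λ (∫ x in W y, m (A x) (k x y)) (g y) =
      ∫ x in W y, Λ (A x) (Λ (k x y) (g y)) := fun y => by
    simp only [← hm]
    exact ((Λ.flip (g y)).integral_comp_comm (integrableOn_of_norm_le
      (stronglyMeasurable_bilin m hA (hk.comp (.prodMk_left y)).stronglyMeasurable)
      (fun x => norm_bilin_le_of_le m (hK x) (hC x y)) (hWfin y))).symm
  simp only [h1, h2]
  exact setIntegral_setIntegral_swap
    (f := fun x y => Λ (A x) (Λ (k x y) (g y)))
    (stronglyMeasurable_bilin Λ (hA.comp_measurable measurable_fst) hkg)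
    (fun x y => norm_bilin_le_of_le Λ (hK x) (norm_bilin_le_of_le Λ (hC x y) (hD y)))
    hS hSfin hU hV hW hR hiff

end Kernel

theorem measurableSet_snd_mem_Ico_left (a : ℝ) :
    MeasurableSet {z : ℝ × ℝ | z.2 ∈ Set.Ico a z.1} :=
  (measurableSet_le measurable_const measurable_snd).inter
    (measurableSet_lt measurable_snd measurable_fst)

theorem measurableSet_snd_mem_Ico_right (b : ℝ) :
    MeasurableSet {z : ℝ × ℝ | z.2 ∈ Set.Ico z.1 b} :=
  (measurableSet_le measurable_fst measurable_snd).inter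
    (measurableSet_lt measurable_snd measurable_const)

theorem exists_bounded_modification {M : Type*} [NormedAddCommGroup M] {A : ℝ → M}
    {K a b : ℝ}
    (hA : StronglyMeasurable A) (hK : ∀ᵐ τ ∂(volume.restrict (Set.Icc a b)), ‖A τ‖ ≤ K) :
    ∃ A' : ℝ → M, StronglyMeasurable A' ∧ (∀ τ, ‖A' τ‖ ≤ |K|) ∧
      ∀ s ∈ Set.Icc a b, ∀ t ∈ Set.Icc a b, ∀ᵐ τ, τ ∈ Set.uIoc s t → A τ = A' τ := by
  refine ⟨{τ | ‖A τ‖ ≤ K}.indicator A,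
    hA.indicator (measurableSet_le hA.norm.measurable measurable_const), fun τ => ?_,
    fun s hs t ht => ?_⟩
  · by_cases h : ‖A τ‖ ≤ K
    · rw [Set.indicator_of_mem (by exact h)]
      exact h.trans (le_abs_self K)
    · rw [Set.indicator_of_notMem (by exact h), norm_zero]
      exact abs_nonneg K
  · filter_upwards [(ae_restrict_iff' measurableSet_Icc).1 hK] with τ hτ hm
    have hτ' := Set.uIoc_subset_uIcc.trans (Set.uIcc_subset_Icc hs ht) hm
    exact (Set.indicator_of_mem (by exact hτ hτ') A).symm

section Superposition

variable {M E : Type*} [NormedAddCommGroup M] [NormedSpace ℝ M]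
  [NormedAddCommGroup E] [NormedSpace ℝ E]
  (Λ : M →L[ℝ] E →L[ℝ] E) {A : ℝ → M} {K a b s : ℝ}

theorem bilin_intervalIntegrable_of_bounded (hA : StronglyMeasurable A) (hK : ∀ τ, ‖A τ‖ ≤ K)
    (hab : a ≤ b) {u : ℝ → E} (hu : StronglyMeasurable u) {C : ℝ}
    (hC : ∀ t ∈ Set.Icc a b, ‖u t‖ ≤ C) :
    IntervalIntegrable (fun τ => Λ (A τ) (u τ)) volume a b := by
  rw [intervalIntegrable_iff_integrableOn_Ioc_of_le hab]
  refine Measure.integrableOn_of_bounded (by simp)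
    (stronglyMeasurable_bilin Λ hA hu).aestronglyMeasurable (M := ‖Λ‖ * K * C) ?_
  filter_upwards [ae_restrict_mem measurableSet_Ioc] with x hx
  exact norm_bilin_le_of_le Λ (hK x) (hC x ⟨hx.1.le, hx.2⟩)

/-- Superposition of a homogeneous solution and finitely many particular solutions of a linear
Volterra equation, together with uniqueness. -/
theorem volterra_superposition {ι : Type*} [Fintype ι]
    (hA : StronglyMeasurable A) (hK : ∀ τ, ‖A τ‖ ≤ K) (hs : s ∈ Set.Icc a b)
    {u h : ℝ → E} {w c : ι → ℝ → E} {c₀ : E}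
    (hu : ∀ t ∈ Set.Icc a b, u t = h t + ∑ i, w i t)
    (hh : ∀ t ∈ Set.Icc a b, h t = c₀ + ∫ τ in s..t, Λ (A τ) (h τ))
    (hwi : ∀ i, IntervalIntegrable (fun τ => Λ (A τ) (w i τ)) volume a b)
    (hw : ∀ i, ∀ t ∈ Set.Icc a b, w i t = (∫ τ in s..t, Λ (A τ) (w i τ)) + c i t) :
    (∀ t ∈ Set.Icc a b, u t = c₀ + (∫ τ in s..t, Λ (A τ) (u τ)) + ∑ i, c i t) ∧
      ∀ u' : ℝ → E, StronglyMeasurable u' → (∃ C : ℝ, ∀ t ∈ Set.Icc a b, ‖u' t‖ ≤ C) →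
        (∀ t ∈ Set.Icc a b, u' t = c₀ + (∫ τ in s..t, Λ (A τ) (u' τ)) + ∑ i, c i t) →
        ∀ t ∈ Set.Icc a b, u' t = u t := by
  have hab := hs.1.trans hs.2
  have hhi := (volterra_regularity Λ hA hK hs hh).2.1
  have hsub : ∀ t ∈ Set.Icc a b, Set.uIcc s t ⊆ Set.uIcc a b := fun t ht =>
    Set.uIcc_subset_uIcc (Set.Icc_subset_uIcc hs) (Set.Icc_subset_uIcc ht)
  have hex : ∀ t ∈ Set.Icc a b, Λ (A t) (u t) = Λ (A t) (h t) + ∑ i, Λ (A t) (w i t) :=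
    fun t ht => by rw [hu t ht, map_add, map_sum]
  have hsi : IntervalIntegrable (fun t => ∑ i, Λ (A t) (w i t)) volume a b := by
    have h := IntervalIntegrable.sum Finset.univ fun i _ => hwi i
    rwa [Finset.sum_fn] at h
  have hui : IntervalIntegrable (fun τ => Λ (A τ) (u τ)) volume a b := by
    refine (hhi.add hsi).congr fun t ht => ?_
    rw [Set.uIoc_of_le hab] at ht
    exact (hex t ⟨ht.1.le, ht.2⟩).symm
  have hsol : ∀ t ∈ Set.Icc a b, u t = c₀ + (∫ τ in s..t, Λ (A τ) (u τ)) + ∑ i, c i t :=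
    fun t ht => by
    have h1 : ∫ τ in s..t, Λ (A τ) (u τ) = (∫ τ in s..t, Λ (A τ) (h τ)) +
        ∑ i, ∫ τ in s..t, Λ (A τ) (w i τ) := by
      rw [← intervalIntegral.integral_finsetSum fun i _ => (hwi i).mono_set (hsub t ht),
        ← intervalIntegral.integral_add (hhi.mono_set (hsub t ht)) (hsi.mono_set (hsub t ht))]
      exact intervalIntegral.integral_congr fun τ hτ => hex τ (Set.uIcc_subset_Icc hs ht hτ)
    rw [h1, hu t ht, hh t ht, Finset.sum_congr rfl fun i _ => hw i t ht, Finset.sum_add_distrib]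
    abel
  refine ⟨hsol, fun u' hu'm ⟨C, hC⟩ hu' => ?_⟩
  refine volterra_unique Λ hA hK hs (c := fun t => c₀ + ∑ i, c i t)
    (bilin_intervalIntegrable_of_bounded Λ hA hK hab hu'm hC) hui
    (fun t ht => ?_) (fun t ht => ?_)
  · rw [add_right_comm]
    exact hu' t ht
  · rw [add_right_comm]
    exact hsol t ht

end Superposition

section Duhamel

variable {R E : Type*} [NormedRing R] [NormedAlgebra ℝ R] [CompleteSpace R]
  [NormedAddCommGroup E] [NormedSpace ℝ E] [CompleteSpace E]
  (Λ : R →L[ℝ] E →L[ℝ] E) {A : ℝ → R} {K a b : ℝ} {Z : ℝ → ℝ → R}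
  {ν : Measure ℝ} {g : ℝ → E} {D : ℝ}

/-- Duhamel's formula for a forward problem driven by the vector measure `g dν`. -/
theorem duhamel_forward [IsFiniteMeasure ν]
    (hone : ∀ v, Λ 1 v = v) (hmul : ∀ x y v, Λ (x * y) v = Λ x (Λ y v))
    (hA : StronglyMeasurable A) (hK : ∀ τ, ‖A τ‖ ≤ K)
    (hZ : ∀ t ∈ Set.Icc a b, ∀ s ∈ Set.Icc a b, Z t s = 1 + ∫ τ in s..t, A τ * Z τ s)
    (hab : a ≤ b) (hg : StronglyMeasurable g) (hD : ∀ y ∈ Set.Icc a b, ‖g y‖ ≤ D) :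
    IntervalIntegrable (fun t => Λ (A t) (∫ s in Set.Ico a t, Λ (Z t s) (g s) ∂ν)) volume a b ∧
    ∀ t ∈ Set.Icc a b, ∫ s in Set.Ico a t, Λ (Z t s) (g s) ∂ν =
      (∫ τ in a..t, Λ (A τ) (∫ s in Set.Ico a τ, Λ (Z τ s) (g s) ∂ν)) +
        ∫ s in Set.Ico a t, g s ∂ν := by
  obtain ⟨Y, C, hYc, hYC, hYZ⟩ := transition_exists_extension hA hK hZ hab
  set g' : ℝ → E := (Set.Icc a b).indicator g with hg'
  have hg'm : StronglyMeasurable g' := hg.indicator measurableSet_Icc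
  have hg'D : ∀ y, ‖g' y‖ ≤ D := fun y => by
    by_cases hy : y ∈ Set.Icc a b
    · simpa [hg', hy] using hD y hy
    · simpa [hg', hy] using (norm_nonneg _).trans (hD a ⟨le_rfl, hab⟩)
  have hg'g : ∀ y ∈ Set.Icc a b, g' y = g y := fun y hy => Set.indicator_of_mem hy g
  have hw : ∀ t ∈ Set.Icc a b, ∫ s in Set.Ico a t, Λ (Y t s) (g' s) ∂ν =
      ∫ s in Set.Ico a t, Λ (Z t s) (g s) ∂ν := fun t ht =>
    setIntegral_congr_fun measurableSet_Ico fun s hs => by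
      have hs' : s ∈ Set.Icc a b := ⟨hs.1, hs.2.le.trans ht.2⟩
      simp only [hYZ t ht s hs', hg'g s hs']
  refine ⟨?_, fun t ht => ?_⟩
  · refine (kernel_intervalIntegrable Λ hA hK hYc hYC hg'm hg'D (V := fun x => Set.Ico a x)
      (fun x => measurableSet_Ico) (measurableSet_snd_mem_Ico_left a) a b
      (ν := ν)).congr fun t ht => ?_
    rw [Set.uIoc_of_le hab] at ht
    simp only [hw t ⟨ht.1.le, ht.2⟩]
  · have h := kernel_setIntegral_swap Λ (m := ContinuousLinearMap.mul ℝ R) (ν := ν) hmul hA hK hYc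
      hYC hg'm hg'D (V := fun x => Set.Ico a x) (fun x => measurableSet_Ico)
      (measurableSet_snd_mem_Ico_left a) (S := Set.Ioc a t) (U := Set.Ico a t)
      (W := fun y => Set.Ioc y t) measurableSet_Ioc (by simp) measurableSet_Ico
      (fun _ => measurableSet_Ioc) (by simp)
      (fun x y => by simp only [Set.mem_Ioc, Set.mem_Ico]; grind)
    have hl : ∫ τ in a..t, Λ (A τ) (∫ s in Set.Ico a τ, Λ (Z τ s) (g s) ∂ν) =
        ∫ x in Set.Ioc a t, Λ (A x) (∫ y in Set.Ico a x, Λ (Y x y) (g' y) ∂ν) := by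
      rw [intervalIntegral.integral_of_le ht.1]
      refine setIntegral_congr_fun measurableSet_Ioc fun x hx => ?_
      simp only [hw x ⟨hx.1.le, hx.2.trans ht.2⟩]
    have hi1 : IntegrableOn (fun s => Λ (Y t s) (g' s)) (Set.Ico a t) ν :=
      integrableOn_of_norm_le (stronglyMeasurable_bilin Λ
        (hYc.comp (.prodMk_right t)).stronglyMeasurable hg'm)
        (fun s => norm_bilin_le_of_le Λ (hYC t s) (hg'D s)) (measure_ne_top _ _)
    have hi2 : IntegrableOn g' (Set.Ico a t) ν :=
      integrableOn_of_norm_le hg'm hg'D (measure_ne_top _ _)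
    have hg2 : ∫ s in Set.Ico a t, g s ∂ν = ∫ s in Set.Ico a t, g' s ∂ν :=
      setIntegral_congr_fun measurableSet_Ico fun s hs =>
        (hg'g s ⟨hs.1, hs.2.le.trans ht.2⟩).symm
    rw [hl, h, ← hw t ht, hg2, ← sub_eq_iff_eq_add, ← integral_sub hi1 hi2]
    refine setIntegral_congr_fun measurableSet_Ico fun s hs => ?_
    have hs' : s ∈ Set.Icc a b := ⟨hs.1, hs.2.le.trans ht.2⟩
    have hin : ∫ x in Set.Ioc s t, ContinuousLinearMap.mul ℝ R (A x) (Y x s) = Y t s - 1 := by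
      rw [hYZ t ht s hs', hZ t ht s hs', add_sub_cancel_left,
        intervalIntegral.integral_of_le hs.2.le]
      refine setIntegral_congr_fun measurableSet_Ioc fun x hx => ?_
      simp only [ContinuousLinearMap.mul_apply',
        hYZ x ⟨hs.1.trans hx.1.le, hx.2.trans ht.2⟩ s hs']
    simp only [hin, map_sub, _root_.sub_apply, hone]

/-- The state-transition matrix solves the adjoint equation in its second argument. -/
theorem transition_adjoint (hA : StronglyMeasurable A) (hK : ∀ τ, ‖A τ‖ ≤ K)
    (hZ : ∀ t ∈ Set.Icc a b, ∀ s ∈ Set.Icc a b, Z t s = 1 + ∫ τ in s..t, A τ * Z τ s)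
    {s t : ℝ} (hs : s ∈ Set.Icc a b) (ht : t ∈ Set.Icc a b) (hst : s ≤ t) :
    Z t s = 1 + ∫ τ in s..t, Z t τ * A τ := by
  have hZ' : ∀ t ∈ Set.Icc s b, ∀ r ∈ Set.Icc s b, Z t r = 1 + ∫ τ in r..t, A τ * Z τ r :=
    fun t ht r hr => hZ t ⟨hs.1.trans ht.1, ht.2⟩ r ⟨hs.1.trans hr.1, hr.2⟩
  have hsb := hst.trans ht.2
  obtain ⟨hi, hd⟩ := duhamel_forward (ContinuousLinearMap.mul ℝ R)
    (ν := volume.restrict (Set.Icc s b)) (fun v => by simp) (fun x y v => by simp [mul_assoc])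
    hA hK hZ' hsb hA (fun y _ => hK y)
  have hcv : ∀ r ∈ Set.Icc s b, ∀ f : ℝ → R,
      ∫ x in Set.Ico s r, f x ∂(volume.restrict (Set.Icc s b)) = ∫ x in s..r, f x := by
    intro r hr f
    rw [Measure.restrict_restrict measurableSet_Ico, Set.inter_eq_self_of_subset_left
      (Set.Ico_subset_Icc_self.trans (Set.Icc_subset_Icc_right hr.2)),
      intervalIntegral.integral_of_le hr.1, integral_Ico_eq_integral_Ioo,
      integral_Ioc_eq_integral_Ioo]
  have hAi : ∀ r, IntervalIntegrable A volume s r := fun r =>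
    intervalIntegrable_iff.2 (integrableOn_of_norm_le hA hK (by simp [Set.uIoc]))
  set w : ℝ → R := fun r => ∫ x in Set.Ico s r, ContinuousLinearMap.mul ℝ R (Z r x) (A x)
    ∂(volume.restrict (Set.Icc s b)) with hw
  have hu := volterra_unique_of_const (ContinuousLinearMap.mul ℝ R) hA hK (s := s)
    ⟨le_rfl, hsb⟩ (u := fun r => Z r s) (v := fun r => 1 + w r) (c := 1)
    (fun r hr => hZ' r hr s ⟨le_rfl, hsb⟩) (fun r hr => by
      have hir : IntervalIntegrable (fun τ => A τ * w τ) volume s r :=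
        hi.mono_set (Set.uIcc_subset_uIcc Set.left_mem_uIcc (Set.Icc_subset_uIcc hr))
      have hdr : w r = (∫ τ in s..r, A τ * w τ) + ∫ τ in s..r, A τ :=
        (hd r hr).trans (by rw [hcv r hr A]; rfl)
      simp only [map_add, ContinuousLinearMap.mul_apply', mul_one]
      rw [intervalIntegral.integral_add (hAi r) hir, add_right_inj]
      exact hdr.trans (add_comm _ _)) t ⟨hst, ht.2⟩
  exact hu.trans (congrArg (1 + ·) (hcv t ⟨hst, ht.2⟩ _))

/-- Duhamel's formula for a backward problem driven by the vector measure `g dν`. -/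
theorem duhamel_backward [IsFiniteMeasure ν]
    (hone : ∀ v, Λ 1 v = v) (hmul : ∀ x y v, Λ (x * y) v = Λ y (Λ x v))
    (hA : StronglyMeasurable A) (hK : ∀ τ, ‖A τ‖ ≤ K)
    (hZ : ∀ t ∈ Set.Icc a b, ∀ s ∈ Set.Icc a b, Z t s = 1 + ∫ τ in s..t, A τ * Z τ s)
    (hab : a ≤ b) (hg : StronglyMeasurable g) (hD : ∀ y ∈ Set.Icc a b, ‖g y‖ ≤ D) :
    IntervalIntegrable (fun t => Λ (A t) (∫ s in Set.Ico t b, Λ (Z s t) (g s) ∂ν)) volume a b ∧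
    ∀ t ∈ Set.Icc a b, ∫ s in Set.Ico t b, Λ (Z s t) (g s) ∂ν =
      (∫ τ in t..b, Λ (A τ) (∫ s in Set.Ico τ b, Λ (Z s τ) (g s) ∂ν)) +
        ∫ s in Set.Ico t b, g s ∂ν := by
  obtain ⟨Y, C, hYc, hYC, hYZ⟩ := transition_exists_extension hA hK hZ hab
  have hYc' : Continuous (Function.uncurry fun x y => Y y x) := hYc.comp continuous_swap
  set g' : ℝ → E := (Set.Icc a b).indicator g with hg'
  have hg'm : StronglyMeasurable g' := hg.indicator measurableSet_Icc
  have hg'D : ∀ y, ‖g' y‖ ≤ D := fun y => by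
    by_cases hy : y ∈ Set.Icc a b
    · simpa [hg', hy] using hD y hy
    · simpa [hg', hy] using (norm_nonneg _).trans (hD a ⟨le_rfl, hab⟩)
  have hg'g : ∀ y ∈ Set.Icc a b, g' y = g y := fun y hy => Set.indicator_of_mem hy g
  have hw : ∀ t ∈ Set.Icc a b, ∫ s in Set.Ico t b, Λ (Y s t) (g' s) ∂ν =
      ∫ s in Set.Ico t b, Λ (Z s t) (g s) ∂ν := fun t ht =>
    setIntegral_congr_fun measurableSet_Ico fun s hs => by
      have hs' : s ∈ Set.Icc a b := ⟨ht.1.trans hs.1, hs.2.le⟩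
      simp only [hYZ s hs' t ht, hg'g s hs']
  refine ⟨?_, fun t ht => ?_⟩
  · refine (kernel_intervalIntegrable Λ hA hK hYc' (fun x y => hYC y x) hg'm hg'D
      (V := fun x => Set.Ico x b) (fun x => measurableSet_Ico)
      (measurableSet_snd_mem_Ico_right b) a b (ν := ν)).congr fun t ht => ?_
    rw [Set.uIoc_of_le hab] at ht
    simp only [hw t ⟨ht.1.le, ht.2⟩]
  · have h := kernel_setIntegral_swap Λ (m := (ContinuousLinearMap.mul ℝ R).flip) (ν := ν)
      (fun x y => hmul y x) hA hK hYc' (fun x y => hYC y x) hg'm hg'D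
      (V := fun x => Set.Ico x b) (fun x => measurableSet_Ico)
      (measurableSet_snd_mem_Ico_right b) (S := Set.Ioc t b) (U := Set.Ico t b)
      (W := fun y => Set.Ioc t y) measurableSet_Ioc (by simp) measurableSet_Ico
      (fun _ => measurableSet_Ioc) (by simp)
      (fun x y => by simp only [Set.mem_Ioc, Set.mem_Ico]; grind)
    have hl : ∫ τ in t..b, Λ (A τ) (∫ s in Set.Ico τ b, Λ (Z s τ) (g s) ∂ν) =
        ∫ x in Set.Ioc t b, Λ (A x) (∫ y in Set.Ico x b, Λ (Y y x) (g' y) ∂ν) := by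
      rw [intervalIntegral.integral_of_le ht.2]
      refine setIntegral_congr_fun measurableSet_Ioc fun x hx => ?_
      simp only [hw x ⟨ht.1.trans hx.1.le, hx.2⟩]
    have hi1 : IntegrableOn (fun s => Λ (Y s t) (g' s)) (Set.Ico t b) ν :=
      integrableOn_of_norm_le (stronglyMeasurable_bilin Λ
        (hYc.comp (.prodMk_left t)).stronglyMeasurable hg'm)
        (fun s => norm_bilin_le_of_le Λ (hYC s t) (hg'D s)) (measure_ne_top _ _)
    have hi2 : IntegrableOn g' (Set.Ico t b) ν :=
      integrableOn_of_norm_le hg'm hg'D (measure_ne_top _ _)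
    have hg2 : ∫ s in Set.Ico t b, g s ∂ν = ∫ s in Set.Ico t b, g' s ∂ν :=
      setIntegral_congr_fun measurableSet_Ico fun s hs =>
        (hg'g s ⟨ht.1.trans hs.1, hs.2.le⟩).symm
    rw [hl, h, ← hw t ht, hg2, ← sub_eq_iff_eq_add, ← integral_sub hi1 hi2]
    refine setIntegral_congr_fun measurableSet_Ico fun s hs => ?_
    have hs' : s ∈ Set.Icc a b := ⟨ht.1.trans hs.1, hs.2.le⟩
    have hin : ∫ x in Set.Ioc t s, (ContinuousLinearMap.mul ℝ R).flip (A x) (Y s x) =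
        Y s t - 1 := by
      rw [hYZ s hs' t ht, transition_adjoint hA hK hZ ht hs' hs.1, add_sub_cancel_left,
        intervalIntegral.integral_of_le hs.1]
      refine setIntegral_congr_fun measurableSet_Ioc fun x hx => ?_
      simp only [ContinuousLinearMap.flip_apply, ContinuousLinearMap.mul_apply',
        hYZ s hs' x ⟨ht.1.trans hx.1.le, hx.2.trans hs'.2⟩]
    simp only [hin, map_sub, _root_.sub_apply, hone]

variable {ι : Type*} [Fintype ι] {μ : ι → Measure ℝ} {B : ι → ℝ → E}

/-- The variation-of-constants formula is the unique bounded solution of the forward linear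
Cauchy–Stieltjes problem. -/
theorem forward_solution (hμ : ∀ i, IsFiniteMeasure (μ i)) (hB : ∀ i, Continuous (B i))
    (hone : ∀ v, Λ 1 v = v) (hmul : ∀ x y v, Λ (x * y) v = Λ x (Λ y v))
    (hA : StronglyMeasurable A) (hK : ∀ᵐ τ ∂(volume.restrict (Set.Icc a b)), ‖A τ‖ ≤ K)
    (hZ : ∀ t ∈ Set.Icc a b, ∀ s ∈ Set.Icc a b, Z t s = 1 + ∫ τ in s..t, A τ * Z τ s)
    (hab : a ≤ b) {q₀ : E} {q : ℝ → E}
    (hq : ∀ t ∈ Set.Icc a b,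
      q t = Λ (Z t a) q₀ + ∑ i, ∫ s in Set.Ico a t, Λ (Z t s) (B i s) ∂(μ i)) :
    (∀ t ∈ Set.Icc a b, q t = q₀ + (∫ τ in a..t, Λ (A τ) (q τ))
        + ∑ i, ∫ τ in Set.Ico a t, B i τ ∂(μ i)) ∧
      ∀ q' : ℝ → E, StronglyMeasurable q' → (∃ M : ℝ, ∀ t ∈ Set.Icc a b, ‖q' t‖ ≤ M) →
        (∀ t ∈ Set.Icc a b, q' t = q₀ + (∫ τ in a..t, Λ (A τ) (q' τ))
            + ∑ i, ∫ τ in Set.Ico a t, B i τ ∂(μ i)) →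
        ∀ t ∈ Set.Icc a b, q' t = q t := by
  obtain ⟨A', hA', hK', hAA'⟩ := exists_bounded_modification hA hK
  have ha : a ∈ Set.Icc a b := ⟨le_rfl, hab⟩
  have hZ' : ∀ t ∈ Set.Icc a b, ∀ s ∈ Set.Icc a b, Z t s = 1 + ∫ τ in s..t, A' τ * Z τ s :=
    fun t ht s hs => (hZ t ht s hs).trans (congrArg (1 + ·)
      (intervalIntegral.integral_congr_ae ((hAA' s hs t ht).mono fun τ h hm => by rw [h hm])))
  have hint : ∀ v : ℝ → E, ∀ t ∈ Set.Icc a b,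
      ∫ τ in a..t, Λ (A τ) (v τ) = ∫ τ in a..t, Λ (A' τ) (v τ) := fun v t ht =>
    intervalIntegral.integral_congr_ae ((hAA' a ha t ht).mono fun τ h hm => by rw [h hm])
  choose D hD using fun i => isCompact_Icc.exists_bound_of_continuousOn
    ((hB i).continuousOn (s := Set.Icc a b))
  have hd := fun i => duhamel_forward (ν := μ i) Λ hone hmul hA' hK' hZ' hab
    (hB i).stronglyMeasurable (hD i)
  have hh : ∀ t ∈ Set.Icc a b,
      Λ (Z t a) q₀ = q₀ + ∫ τ in a..t, Λ (A' τ) (Λ (Z τ a) q₀) := fun t ht => by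
    have h := (Λ.flip q₀).intervalIntegral_comp_comm
      ((transition_regularity hA' hK' hZ' ha).2.1.mono_set
        (Set.uIcc_subset_uIcc Set.left_mem_uIcc (Set.Icc_subset_uIcc ht)))
    simp only [ContinuousLinearMap.flip_apply, hmul] at h
    rw [h, hZ' t ht a ha, map_add, _root_.add_apply, hone]
  obtain ⟨hsol, huniq⟩ := volterra_superposition Λ hA' hK' ha hq hh
    (fun i => (hd i).1) (fun i => (hd i).2)
  refine ⟨fun t ht => by rw [hint q t ht]; exact hsol t ht, fun q' hq'm hC hq' => ?_⟩
  exact huniq q' hq'm hC fun t ht => by rw [← hint q' t ht]; exact hq' t ht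

/-- The adjoint variation-of-constants formula is the unique bounded solution of the backward
linear Cauchy–Stieltjes problem. -/
theorem backward_solution (hμ : ∀ i, IsFiniteMeasure (μ i)) (hB : ∀ i, Continuous (B i))
    (hone : ∀ v, Λ 1 v = v) (hmul : ∀ x y v, Λ (x * y) v = Λ y (Λ x v))
    (hA : StronglyMeasurable A) (hK : ∀ᵐ τ ∂(volume.restrict (Set.Icc a b)), ‖A τ‖ ≤ K)
    (hZ : ∀ t ∈ Set.Icc a b, ∀ s ∈ Set.Icc a b, Z t s = 1 + ∫ τ in s..t, A τ * Z τ s)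
    (hab : a ≤ b) {p₁ : E} {p : ℝ → E}
    (hp : ∀ t ∈ Set.Icc a b,
      p t = Λ (Z b t) p₁ + ∑ i, ∫ s in Set.Ico t b, Λ (Z s t) (B i s) ∂(μ i)) :
    (∀ t ∈ Set.Icc a b, p t = p₁ + (∫ τ in t..b, Λ (A τ) (p τ))
        + ∑ i, ∫ τ in Set.Ico t b, B i τ ∂(μ i)) ∧
      ∀ p' : ℝ → E, StronglyMeasurable p' → (∃ M : ℝ, ∀ t ∈ Set.Icc a b, ‖p' t‖ ≤ M) →
        (∀ t ∈ Set.Icc a b, p' t = p₁ + (∫ τ in t..b, Λ (A τ) (p' τ))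
            + ∑ i, ∫ τ in Set.Ico t b, B i τ ∂(μ i)) →
        ∀ t ∈ Set.Icc a b, p' t = p t := by
  obtain ⟨A', hA', hK', hAA'⟩ := exists_bounded_modification hA hK
  have hb : b ∈ Set.Icc a b := ⟨hab, le_rfl⟩
  have hZ' : ∀ t ∈ Set.Icc a b, ∀ s ∈ Set.Icc a b, Z t s = 1 + ∫ τ in s..t, A' τ * Z τ s :=
    fun t ht s hs => (hZ t ht s hs).trans (congrArg (1 + ·)
      (intervalIntegral.integral_congr_ae ((hAA' s hs t ht).mono fun τ h hm => by rw [h hm])))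
  have hneg : ∀ (v : ℝ → E) (t : ℝ),
      ∫ τ in b..t, (-Λ) (A' τ) (v τ) = ∫ τ in t..b, Λ (A' τ) (v τ) := fun v t =>
    (intervalIntegral.integral_neg (f := fun τ => Λ (A' τ) (v τ))).trans
      (intervalIntegral.integral_symm b t).symm
  have hint : ∀ v : ℝ → E, ∀ t ∈ Set.Icc a b,
      ∫ τ in t..b, Λ (A τ) (v τ) = ∫ τ in b..t, (-Λ) (A' τ) (v τ) := fun v t ht =>
    (intervalIntegral.integral_congr_ae
      ((hAA' t ht b hb).mono fun τ h hm => by rw [h hm])).trans (hneg v t).symm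
  choose D hD using fun i => isCompact_Icc.exists_bound_of_continuousOn
    ((hB i).continuousOn (s := Set.Icc a b))
  have hd := fun i => duhamel_backward (ν := μ i) Λ hone hmul hA' hK' hZ' hab
    (hB i).stronglyMeasurable (hD i)
  obtain ⟨Y, C, hYc, hYC, hYZ⟩ := transition_exists_extension hA' hK' hZ' hab
  have hh : ∀ t ∈ Set.Icc a b,
      Λ (Z b t) p₁ = p₁ + ∫ τ in b..t, (-Λ) (A' τ) (Λ (Z b τ) p₁) := fun t ht => by
    have hi : IntervalIntegrable (fun τ => Y b τ * A' τ) volume t b :=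
      intervalIntegrable_iff.2 (integrableOn_of_norm_le
        ((hYc.comp (.prodMk_right b)).stronglyMeasurable.mul hA')
        (fun τ => norm_bilin_le_of_le (ContinuousLinearMap.mul ℝ R) (hYC b τ) (hK' τ))
        (by simp [Set.uIoc]))
    have hYe : ∫ τ in t..b, Y b τ * A' τ = ∫ τ in t..b, Z b τ * A' τ :=
      intervalIntegral.integral_congr fun τ hτ => by
        simp only [hYZ b hb τ (Set.uIcc_subset_Icc ht hb hτ)]
    have h := (Λ.flip p₁).intervalIntegral_comp_comm hi
    simp only [ContinuousLinearMap.flip_apply, hmul] at h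
    rw [hneg, transition_adjoint hA' hK' hZ' ht hb ht.2, ← hYe, map_add, _root_.add_apply, hone,
      ← h]
    congr 1
    exact intervalIntegral.integral_congr fun τ hτ => by
      simp only [hYZ b hb τ (Set.uIcc_subset_Icc ht hb hτ)]
  obtain ⟨hsol, huniq⟩ := volterra_superposition (-Λ) hA' hK' hb hp hh
    (fun i => (hd i).1.neg) (fun i t ht => by rw [hneg]; exact (hd i).2 t ht)
  refine ⟨fun t ht => by rw [hint p t ht]; exact hsol t ht, fun p' hp'm hC hp' => ?_⟩
  exact huniq p' hp'm hC fun t ht => by rw [← hint p' t ht]; exact hp' t ht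

end Duhamel

/-- Matrices act on vectors through a topological isomorphism onto the algebra of continuous
endomorphisms. -/
theorem exists_mulVec_equiv (n : ℕ) :
    ∃ φ : (Fin n → Fin n → ℝ) ≃L[ℝ] ((Fin n → ℝ) →L[ℝ] (Fin n → ℝ)),
      (∀ (X : Matrix (Fin n) (Fin n) ℝ) v, φ X v = X *ᵥ v) ∧
      φ (1 : Matrix (Fin n) (Fin n) ℝ) = 1 ∧
      ∀ X Y : Matrix (Fin n) (Fin n) ℝ, φ (X * Y : Matrix _ _ ℝ) = φ X * φ Y := by
  let φ : (Fin n → Fin n → ℝ) ≃L[ℝ] ((Fin n → ℝ) →L[ℝ] (Fin n → ℝ)) :=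
    ((Matrix.toLin' : Matrix (Fin n) (Fin n) ℝ ≃ₗ[ℝ] _).trans
      LinearMap.toContinuousLinearMap).toContinuousLinearEquiv
  have hφ : ∀ (X : Matrix (Fin n) (Fin n) ℝ) v, φ X v = X *ᵥ v :=
    fun X v => Matrix.toLin'_apply X v
  exact ⟨φ, hφ, ContinuousLinearMap.ext fun v => (hφ 1 v).trans (one_mulVec v),
    fun X Y => ContinuousLinearMap.ext fun v => (hφ (X * Y) v).trans
      ((hφ X (φ Y v)).trans ((congrArg (X *ᵥ ·) (hφ Y v)).trans (mulVec_mulVec v X Y))).symm⟩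

theorem exists_transpose_mulVec {n : ℕ}
    {φ : (Fin n → Fin n → ℝ) ≃L[ℝ] ((Fin n → ℝ) →L[ℝ] (Fin n → ℝ))}
    (hφ : ∀ (X : Matrix (Fin n) (Fin n) ℝ) v, φ X v = X *ᵥ v)
    (hone : φ (1 : Matrix (Fin n) (Fin n) ℝ) = 1)
    (hmul : ∀ X Y : Matrix (Fin n) (Fin n) ℝ, φ (X * Y : Matrix _ _ ℝ) = φ X * φ Y) :
    ∃ Λ : ((Fin n → ℝ) →L[ℝ] (Fin n → ℝ)) →L[ℝ] (Fin n → ℝ) →L[ℝ] (Fin n → ℝ),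
      (∀ (X : Matrix (Fin n) (Fin n) ℝ) v, Λ (φ X) v = Xᵀ *ᵥ v) ∧
      (∀ v, Λ 1 v = v) ∧ ∀ x y v, Λ (x * y) v = Λ y (Λ x v) := by
  let tr : (Fin n → Fin n → ℝ) →ₗ[ℝ] (Fin n → Fin n → ℝ) :=
    (Matrix.transposeLinearEquiv (Fin n) (Fin n) ℝ ℝ).toLinearMap
  let Λ : ((Fin n → ℝ) →L[ℝ] (Fin n → ℝ)) →L[ℝ] (Fin n → ℝ) →L[ℝ] (Fin n → ℝ) :=
    φ.toContinuousLinearMap ∘L tr.toContinuousLinearMap ∘L φ.symm.toContinuousLinearMap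
  have hΛ : ∀ (X : Matrix (Fin n) (Fin n) ℝ) v, Λ (φ X) v = Xᵀ *ᵥ v := fun X v =>
    (congrArg (fun Y => φ (tr Y) v) (φ.symm_apply_apply X)).trans (hφ Xᵀ v)
  have hΛmul : ∀ (X Y : Matrix (Fin n) (Fin n) ℝ) v, Λ (φ X * φ Y) v = Λ (φ Y) (Λ (φ X) v) :=
    fun X Y v => by rw [← hmul, hΛ, hΛ, hΛ, transpose_mul, mulVec_mulVec]
  refine ⟨Λ, hΛ, fun v => by rw [← hone, hΛ, transpose_one, one_mulVec], fun x y v => ?_⟩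
  obtain ⟨X, rfl⟩ := φ.surjective x
  obtain ⟨Y, rfl⟩ := φ.surjective y
  exact hΛmul X Y v

theorem ContinuousLinearEquiv.intervalIntegral_comp_comm {E F : Type*} [NormedAddCommGroup E]
    [NormedSpace ℝ E] [NormedAddCommGroup F] [NormedSpace ℝ F] (φ : E ≃L[ℝ] F) (f : ℝ → E)
    (s t : ℝ) : ∫ τ in s..t, φ (f τ) = φ (∫ τ in s..t, f τ) := by
  simp only [intervalIntegral, φ.integral_comp_comm, map_sub]

/-- Duhamel-type formulas for linear Cauchy–Stieltjes problems: with `Z` the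
state-transition matrix of `A ∈ L^∞([0,T],ℝ^{n×n})`, finite nonnegative Borel measures
`μ₁,…,μ_j` on `[0,T]` and continuous `B₁,…,B_j`, the function
`q(t) := Z(t,0) q₀ + Σᵢ ∫_{[0,t)} Z(t,s) Bᵢ(s) dμᵢ(s)` solves the forward problem
`q(t) = q₀ + ∫₀ᵗ A q dτ + Σᵢ ∫_{[0,t)} Bᵢ dμᵢ` and
`p(t) := Z(T,t)ᵀ p_T + Σᵢ ∫_{[t,T)} Z(τ,t)ᵀ Bᵢ(τ) dμᵢ(τ)` solves the backward problem
`p(t) = p_T + ∫ₜᵀ Aᵀ p dτ + Σᵢ ∫_{[t,T)} Bᵢ dμᵢ`; moreover these are the unique bounded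
measurable global solutions. -/
theorem stmt_19 (T : ℝ) (hT : 0 < T) (n j : ℕ) (hn : 0 < n) (hj : 0 < j)
    (A : ℝ → Matrix (Fin n) (Fin n) ℝ)
    (hAmeas : ∀ i k : Fin n, Measurable fun τ => A τ i k)
    (CA : ℝ) (hAbd : ∀ᵐ τ ∂(volume.restrict (Set.Icc 0 T)), ‖A τ‖ ≤ CA)
    (Z : ℝ → ℝ → Matrix (Fin n) (Fin n) ℝ)
    (hZ : ∀ t ∈ Set.Icc (0:ℝ) T, ∀ s ∈ Set.Icc (0:ℝ) T,
      Z t s = 1 + ∫ τ in s..t, A τ * Z τ s)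
    (μ : Fin j → Measure ℝ) (hμfin : ∀ i, IsFiniteMeasure (μ i))
    (hμsupp : ∀ i, μ i (Set.Icc 0 T)ᶜ = 0)
    (B : Fin j → ℝ → (Fin n → ℝ)) (hB : ∀ i, Continuous (B i))
    (q₀ pT : Fin n → ℝ)
    (q p : ℝ → (Fin n → ℝ))
    (hqdef : ∀ t ∈ Set.Icc (0:ℝ) T,
      q t = Z t 0 *ᵥ q₀ + ∑ i : Fin j, ∫ s in Set.Ico (0:ℝ) t, Z t s *ᵥ B i s ∂(μ i))
    (hpdef : ∀ t ∈ Set.Icc (0:ℝ) T,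
      p t = (Z T t)ᵀ *ᵥ pT + ∑ i : Fin j, ∫ τ in Set.Ico t T, (Z τ t)ᵀ *ᵥ B i τ ∂(μ i)) :
    ((∀ t ∈ Set.Icc (0:ℝ) T, q t = q₀ + (∫ τ in (0:ℝ)..t, A τ *ᵥ q τ)
        + ∑ i : Fin j, ∫ τ in Set.Ico (0:ℝ) t, B i τ ∂(μ i)) ∧
      ∀ q' : ℝ → (Fin n → ℝ),
        (Measurable q' ∧ ∃ M : ℝ, ∀ t ∈ Set.Icc (0:ℝ) T, ‖q' t‖ ≤ M) →
        (∀ t ∈ Set.Icc (0:ℝ) T, q' t = q₀ + (∫ τ in (0:ℝ)..t, A τ *ᵥ q' τ)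
            + ∑ i : Fin j, ∫ τ in Set.Ico (0:ℝ) t, B i τ ∂(μ i)) →
        ∀ t ∈ Set.Icc (0:ℝ) T, q' t = q t) ∧
    ((∀ t ∈ Set.Icc (0:ℝ) T, p t = pT + (∫ τ in t..T, (A τ)ᵀ *ᵥ p τ)
        + ∑ i : Fin j, ∫ τ in Set.Ico t T, B i τ ∂(μ i)) ∧
      ∀ p' : ℝ → (Fin n → ℝ),
        (Measurable p' ∧ ∃ M : ℝ, ∀ t ∈ Set.Icc (0:ℝ) T, ‖p' t‖ ≤ M) →
        (∀ t ∈ Set.Icc (0:ℝ) T, p' t = pT + (∫ τ in t..T, (A τ)ᵀ *ᵥ p' τ)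
            + ∑ i : Fin j, ∫ τ in Set.Ico t T, B i τ ∂(μ i)) →
        ∀ t ∈ Set.Icc (0:ℝ) T, p' t = p t) := by
  obtain ⟨φ, hφ, hone, hmul⟩ := exists_mulVec_equiv n
  obtain ⟨Λ, hΛ, hΛone, hΛmul⟩ := exists_transpose_mulVec hφ hone hmul
  have hAm : StronglyMeasurable fun τ => φ (A τ) :=
    φ.continuous.comp_stronglyMeasurable (Measurable.stronglyMeasurable
      (measurable_pi_lambda _ fun i => measurable_pi_lambda _ fun k => hAmeas i k))
  have hAK : ∀ᵐ τ ∂(volume.restrict (Set.Icc 0 T)),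
      ‖φ (A τ)‖ ≤ ‖φ.toContinuousLinearMap‖ * CA := by
    filter_upwards [hAbd] with τ hτ
    exact (φ.toContinuousLinearMap.le_opNorm (A τ)).trans
      (mul_le_mul_of_nonneg_left hτ (norm_nonneg _))
  have hφZ : ∀ t ∈ Set.Icc (0:ℝ) T, ∀ s ∈ Set.Icc (0:ℝ) T,
      φ (Z t s) = 1 + ∫ τ in s..t, φ (A τ) * φ (Z τ s) := fun t ht s hs => by
    have h := φ.intervalIntegral_comp_comm (fun τ => (A τ * Z τ s : Matrix _ _ ℝ)) s t
    simp only [hmul] at h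
    rw [h, ← hone]
    exact (congrArg φ (hZ t ht s hs)).trans (map_add φ _ _)
  obtain ⟨hq, hq'⟩ := forward_solution (.id ℝ _) hμfin hB (fun _ => rfl)
    (fun _ _ _ => rfl) hAm hAK hφZ hT.le (q₀ := q₀) (q := q)
    (by simpa only [ContinuousLinearMap.id_apply, hφ] using hqdef)
  obtain ⟨hp, hp'⟩ := backward_solution Λ hμfin hB hΛone hΛmul hAm hAK hφZ hT.le
    (p₁ := pT) (p := p) (by simpa only [hΛ] using hpdef)
  simp only [ContinuousLinearMap.id_apply, hφ] at hq hq'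
  simp only [hΛ] at hp hp'
  exact ⟨⟨hq, fun u hu => hq' u hu.1.stronglyMeasurable hu.2⟩,
    ⟨hp, fun u hu => hp' u hu.1.stronglyMeasurable hu.2⟩⟩
end
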